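/- arXiv:2502.06414 — 4 statements merged into one kernel-verified Lean document; each statement's English description precedes it below -/
import Mathlib

section
/- There exists a constant C♯ depending only on the dimension d with the following property. Let ε, η > 0 and let k ≥ 1 be an integer with ε^{d+2}·η·k ≥ C♯. Let F : Q° → ℝ have Lipschitz constant at most 1. Then Q° can be decomposed into a finite collection of dyadic subcubes with pairwise disjoint interiors whose union is Q°, each labelled GOOD or BAD, such that: (I) every GOOD cube Q has sidelength at least 2^{−k} and satisfies |F(x) − L_Q(x)| ≤ ε·δ_Q for all x ∈ Q, where L_Q is the affine function best approximating F in L²(Q); and (II) every BAD cube has sidelength exactly 2^{−k}, and the total volume of the BAD cubes is at most η. -/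
open MeasureTheory

noncomputable section

/-- The dyadic subcube of the unit cube indexed by a scale `j = p.1` and a corner
`k = p.2 ∈ ℤ^d`: it has sidelength `2^{-j}`. -/
def dyadicCube (d : ℕ) (p : ℕ × (Fin d → ℤ)) : Set (EuclideanSpace ℝ (Fin d)) :=
  {x | ∀ i, (p.2 i : ℝ) / 2 ^ p.1 ≤ x i ∧ x i ≤ ((p.2 i : ℝ) + 1) / 2 ^ p.1}

/-- The unit cube `Q° = [0,1]^d` in `ℝ^d`. -/
def unitCube (d : ℕ) : Set (EuclideanSpace ℝ (Fin d)) := {x | ∀ i, 0 ≤ x i ∧ x i ≤ 1}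

/-- `L` is an affine function on `ℝ^d` (a linear function including a constant term). -/
def IsAffineFn {d : ℕ} (L : EuclideanSpace ℝ (Fin d) → ℝ) : Prop :=
  ∃ (a : Fin d → ℝ) (b : ℝ), L = fun x => (∑ i, a i * x i) + b

/-- `L` is the affine function best approximating `F` in `L²(Q)`. -/
def IsBestAffineApprox {d : ℕ} (F : EuclideanSpace ℝ (Fin d) → ℝ)
    (Q : Set (EuclideanSpace ℝ (Fin d))) (L : EuclideanSpace ℝ (Fin d) → ℝ) : Prop :=
  IsAffineFn L ∧ ∀ L', IsAffineFn L' →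
    ∫ x in Q, (F x - L x) ^ 2 ∂volume ≤ ∫ x in Q, (F x - L' x) ^ 2 ∂volume

section Energy

variable {E : Type*} [NormedAddCommGroup E] [MeasurableSpace E] [BorelSpace E]

/-- The squared `L²` norm of the first difference of `G` with step `h`. -/
def firstDiffEnergy (μ : Measure E) (G : E → ℝ) (h : E) : ENNReal :=
  ∫⁻ x, ENNReal.ofReal ((G (x + h) - G x) ^ 2) ∂μ

theorem firstDiffEnergy_le {μ : Measure E} {G : E → ℝ} {R : ℝ}
    (hG : LipschitzWith 1 G) (hR : ∀ x, R < ‖x‖ → G x = 0) (h : E) :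
    firstDiffEnergy μ G h
      ≤ ENNReal.ofReal (‖h‖ ^ 2) * μ (Metric.closedBall 0 (R + ‖h‖)) := by
  unfold firstDiffEnergy
  rw [← lintegral_indicator_const Metric.isClosed_closedBall.measurableSet]
  refine lintegral_mono fun x => ?_
  by_cases hx : x ∈ Metric.closedBall (0 : E) (R + ‖h‖)
  · rw [Set.indicator_of_mem hx]
    refine ENNReal.ofReal_le_ofReal ?_
    rw [← sq_abs (G (x + h) - G x)]
    have := hG.dist_le_mul (x + h) x
    rw [Real.dist_eq] at this
    gcongr
    simpa using this
  · rw [mem_closedBall_zero_iff, not_le] at hx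
    have h1 := norm_sub_le (x + h) h
    rw [add_sub_cancel_right] at h1
    rw [hR x (by linarith [norm_nonneg h]), hR (x + h) (by linarith)]
    simp

variable [NormedSpace ℝ E]

/-- The squared `L²` norm of the symmetric second difference of `G` with step `h`. -/
def secondDiffEnergy (μ : Measure E) (G : E → ℝ) (h : E) : ENNReal :=
  ∫⁻ x, ENNReal.ofReal ((G (x + (2 : ℝ) • h) + G x - 2 * G (x + h)) ^ 2) ∂μ

/-- The squared `L²` norm of the mixed second difference of `G` with steps `v` and `w`. -/
def mixedDiffEnergy (μ : Measure E) (G : E → ℝ) (v w : E) : ENNReal :=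
  ∫⁻ x, ENNReal.ofReal ((G (x + v + w) - G (x + v) - G (x + w) + G x) ^ 2) ∂μ

variable {μ : Measure E} {G : E → ℝ}

theorem firstDiffEnergy_two_smul_add_secondDiffEnergy [μ.IsAddRightInvariant]
    (hG : Continuous G) (h : E) :
    firstDiffEnergy μ G ((2 : ℝ) • h) + secondDiffEnergy μ G h = 4 * firstDiffEnergy μ G h := by
  have htrans : ∫⁻ x, ENNReal.ofReal ((G (x + h + h) - G (x + h)) ^ 2) ∂μ
      = firstDiffEnergy μ G h :=
    lintegral_add_right_eq_self (fun x => ENNReal.ofReal ((G (x + h) - G x) ^ 2)) h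
  unfold firstDiffEnergy secondDiffEnergy at *
  have hm : ∀ f : E → ℝ, Continuous f → Measurable fun x => ENNReal.ofReal (f x) := fun f hf =>
    hf.measurable.ennreal_ofReal
  rw [← lintegral_add_left (hm _ (by fun_prop))]
  calc _ = ∫⁻ x, (2 * ENNReal.ofReal ((G (x + h) - G x) ^ 2)
        + 2 * ENNReal.ofReal ((G (x + h + h) - G (x + h)) ^ 2)) ∂μ := by
        refine lintegral_congr fun x => ?_
        rw [← ENNReal.ofReal_add (by positivity) (by positivity),
          show (2 : ENNReal) = ENNReal.ofReal 2 by simp, ← ENNReal.ofReal_mul (by norm_num),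
          ← ENNReal.ofReal_mul (by norm_num), ← ENNReal.ofReal_add (by positivity) (by positivity),
          two_smul, ← add_assoc]
        congr 1
        ring
    _ = _ := by
        rw [lintegral_add_left ((hm _ (by fun_prop)).const_mul _),
          lintegral_const_mul _ (hm _ (by fun_prop)), lintegral_const_mul _ (hm _ (by fun_prop)),
          htrans, ← add_mul]
        norm_num

theorem sum_secondDiffEnergy_add_firstDiffEnergy [μ.IsAddRightInvariant]
    (hG : Continuous G) (z : E) (N : ℕ) :
    ∑ j ∈ Finset.range N, 4 ^ j * secondDiffEnergy μ G ((1 / 2 : ℝ) ^ (j + 1) • z)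
      + firstDiffEnergy μ G z = 4 ^ N * firstDiffEnergy μ G ((1 / 2 : ℝ) ^ N • z) := by
  induction N with
  | zero => simp
  | succ N ih =>
    have := firstDiffEnergy_two_smul_add_secondDiffEnergy (μ := μ) hG ((1 / 2 : ℝ) ^ (N + 1) • z)
    rw [smul_smul, show (2 : ℝ) * (1 / 2) ^ (N + 1) = (1 / 2) ^ N by ring] at this
    rw [Finset.sum_range_succ, add_right_comm, ih, ← mul_add, this]
    ring

theorem mixedDiffEnergy_le [μ.IsAddRightInvariant] (hG : Continuous G) (v w : E) :
    mixedDiffEnergy μ G v w ≤ 2 * secondDiffEnergy μ G ((1 / 2 : ℝ) • (v + w))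
      + 2 * secondDiffEnergy μ G ((1 / 2 : ℝ) • (v - w)) := by
  have htrans := lintegral_add_right_eq_self (μ := μ)
    (fun x => ENNReal.ofReal ((G (x + (v - w)) + G x - 2 * G (x + (1 / 2 : ℝ) • (v - w))) ^ 2)) w
  unfold mixedDiffEnergy secondDiffEnergy
  have hm : ∀ f : E → ℝ, Continuous f → Measurable fun x => ENNReal.ofReal (f x) := fun f hf =>
    hf.measurable.ennreal_ofReal
  simp only [smul_smul]
  norm_num only [one_smul] at htrans ⊢
  rw [← htrans, ← lintegral_const_mul _ (hm _ (by fun_prop)),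
    ← lintegral_const_mul _ (hm _ (by fun_prop)),
    ← lintegral_add_left ((hm _ (by fun_prop)).const_mul _)]
  refine lintegral_mono fun x => ?_
  have h1 : x + w + (v - w) = x + v := by abel
  have h2 : x + w + (1 / 2 : ℝ) • (v - w) = x + (1 / 2 : ℝ) • (v + w) := by module
  rw [show (2 : ENNReal) = ENNReal.ofReal 2 by simp, ← ENNReal.ofReal_mul (by norm_num),
    ← ENNReal.ofReal_mul (by norm_num), ← ENNReal.ofReal_add (by positivity) (by positivity),
    h1, h2, ← add_assoc]
  refine ENNReal.ofReal_le_ofReal ?_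
  nlinarith [sq_nonneg (G (x + v + w) + G x - 2 * G (x + (1 / 2 : ℝ) • (v + w))
    + (G (x + v) + G (x + w) - 2 * G (x + (1 / 2 : ℝ) • (v + w))))]

theorem sum_secondDiffEnergy_le [μ.IsAddRightInvariant] {R r : ℝ} (hG : LipschitzWith 1 G)
    (hR : ∀ x, R < ‖x‖ → G x = 0) {z : E} (hz : ‖z‖ ≤ r) (N : ℕ) :
    ∑ j ∈ Finset.range N, 4 ^ j * secondDiffEnergy μ G ((1 / 2 : ℝ) ^ (j + 1) • z)
      ≤ ENNReal.ofReal (r ^ 2) * μ (Metric.closedBall 0 (R + r)) := by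
  refine (le_self_add.trans_eq
    (sum_secondDiffEnergy_add_firstDiffEnergy hG.continuous z N)).trans ?_
  have hr : 0 ≤ r := (norm_nonneg z).trans hz
  have hpow : (1 / 2 : ℝ) ^ N ≤ 1 := pow_le_one₀ (by norm_num) (by norm_num)
  have hn : ‖(1 / 2 : ℝ) ^ N • z‖ = (1 / 2) ^ N * ‖z‖ := by
    rw [norm_smul, Real.norm_of_nonneg (by positivity)]
  calc _ ≤ 4 ^ N * (ENNReal.ofReal (‖(1 / 2 : ℝ) ^ N • z‖ ^ 2)
        * μ (Metric.closedBall 0 (R + ‖(1 / 2 : ℝ) ^ N • z‖))) := by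
        gcongr
        exact firstDiffEnergy_le hG hR _
    _ = ENNReal.ofReal (‖z‖ ^ 2) * μ (Metric.closedBall 0 (R + ‖(1 / 2 : ℝ) ^ N • z‖)) := by
        rw [← mul_assoc, show (4 : ENNReal) ^ N = ENNReal.ofReal (4 ^ N) by
          rw [ENNReal.ofReal_pow (by norm_num)]; simp, ← ENNReal.ofReal_mul (by positivity), hn,
          mul_pow, ← pow_mul, mul_comm N 2, pow_mul, ← mul_assoc, ← mul_pow]
        norm_num
    _ ≤ _ := by
        gcongr
        rw [hn]
        nlinarith [norm_nonneg z]

/-- Second differences of a compactly supported Lipschitz function are square summable over dyadic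
scales. -/
theorem sum_mixedDiffEnergy_le [μ.IsAddRightInvariant] {R r : ℝ} (hG : LipschitzWith 1 G)
    (hR : ∀ x, R < ‖x‖ → G x = 0) {v w : E} (hv : ‖v‖ ≤ r) (hw : ‖w‖ ≤ r) (N : ℕ) :
    ∑ j ∈ Finset.range N,
        4 ^ j * mixedDiffEnergy μ G ((1 / 2 : ℝ) ^ j • v) ((1 / 2 : ℝ) ^ j • w)
      ≤ 4 * (ENNReal.ofReal ((2 * r) ^ 2) * μ (Metric.closedBall 0 (R + 2 * r))) := by
  have hadd : ‖v + w‖ ≤ 2 * r := (norm_add_le v w).trans (by linarith)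
  have hsub : ‖v - w‖ ≤ 2 * r := (norm_sub_le v w).trans (by linarith)
  calc _ ≤ ∑ j ∈ Finset.range N,
        (2 * (4 ^ j * secondDiffEnergy μ G ((1 / 2 : ℝ) ^ (j + 1) • (v + w)))
        + 2 * (4 ^ j * secondDiffEnergy μ G ((1 / 2 : ℝ) ^ (j + 1) • (v - w)))) := by
        refine Finset.sum_le_sum fun j _ => ?_
        refine (mul_le_mul_right (mixedDiffEnergy_le hG.continuous _ _) _).trans_eq ?_
        rw [← smul_add, ← smul_sub, smul_smul, smul_smul, ← pow_succ']
        ring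
    _ ≤ _ := by
        rw [Finset.sum_add_distrib, ← Finset.mul_sum, ← Finset.mul_sum]
        refine (add_le_add (mul_le_mul_right (sum_secondDiffEnergy_le hG hR hadd N) _)
          (mul_le_mul_right (sum_secondDiffEnergy_le hG hR hsub N) _)).trans_eq ?_
        rw [← add_mul]
        norm_num

end Energy

section LineInterpolation

theorem sq_integral_le_integral_sq {α : Type*} [MeasurableSpace α] {ν : Measure α}
    [IsFiniteMeasure ν] (hν : ν.real Set.univ ≤ 1) {g : α → ℝ} (hg : Integrable g ν)
    (hg2 : Integrable (fun x => g x ^ 2) ν) : (∫ x, g x ∂ν) ^ 2 ≤ ∫ x, g x ^ 2 ∂ν := by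
  set c := ∫ x, g x ∂ν with hc
  have h0 : 0 ≤ ∫ x, (g x - c) ^ 2 ∂ν := integral_nonneg fun x => sq_nonneg _
  have h1 : ∫ x, (g x - c) ^ 2 ∂ν = (∫ x, g x ^ 2 ∂ν) - 2 * c * c + ν.real Set.univ * c ^ 2 := by
    have : ∀ x, (g x - c) ^ 2 = (g x ^ 2 - 2 * c * g x) + c ^ 2 := fun x => by ring
    simp only [this]
    have h2 : Integrable (fun x => g x ^ 2 - 2 * c * g x) ν := hg2.sub (hg.const_mul _)
    rw [integral_add h2 (integrable_const _),
      integral_sub hg2 (hg.const_mul _), integral_const_mul, integral_const, smul_eq_mul, ← hc]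
  nlinarith [sq_nonneg c]

theorem ofReal_sq_intervalIntegral_le {g : ℝ → ℝ} (hg : Continuous g) {a b : ℝ}
    (ha : a ∈ Set.Icc (-1 : ℝ) 1) (hb : b ∈ Set.Icc (-1 : ℝ) 1) (hab : |b - a| ≤ 1) :
    ENNReal.ofReal ((∫ k in a..b, g k) ^ 2)
      ≤ ∫⁻ k in Set.Icc (-1 : ℝ) 1, ENNReal.ofReal (g k ^ 2) := by
  have hsub : Set.uIoc a b ⊆ Set.Icc (-1 : ℝ) 1 :=
    Set.uIoc_subset_uIcc.trans (Set.uIcc_subset_Icc ha hb)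
  have hInt : ∀ f : ℝ → ℝ, Continuous f → IntegrableOn f (Set.uIoc a b) := fun f hf =>
    hf.integrableOn_uIoc
  have hvol : (volume.restrict (Set.uIoc a b)).real Set.univ ≤ 1 := by
    simpa [Measure.real, Set.uIoc, Real.volume_Ioc, max_sub_min_eq_abs] using hab
  have hsqInt : IntegrableOn (fun k => g k ^ 2) (Set.uIoc a b) := hInt _ (hg.pow 2)
  have : IsFiniteMeasure (volume.restrict (Set.uIoc a b)) :=
    ⟨by simp [Set.uIoc, Real.volume_Ioc]⟩
  rw [← sq_abs, intervalIntegral.abs_integral_eq_abs_integral_uIoc, sq_abs]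
  refine le_trans (ENNReal.ofReal_le_ofReal
    (sq_integral_le_integral_sq hvol (hInt g hg) hsqInt)) ?_
  rw [ofReal_integral_eq_lintegral_ofReal hsqInt
    (Filter.Eventually.of_forall fun x => sq_nonneg _)]
  exact lintegral_mono_set hsub

theorem sub_linear_eq_integral {f : ℝ → ℝ} (hf : Continuous f) (t : ℝ) :
    f t - f 0 - t * (f 1 - f 0)
      = -(∫ k in (0 : ℝ)..1, (f (k + t) - f k - f t + f 0))
        + ∫ k in (0 : ℝ)..t, (f (k + 1) - f k - f 1 + f 0) := by
  have hi : ∀ (g : ℝ → ℝ), Continuous g → ∀ a b : ℝ, IntervalIntegrable g volume a b :=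
    fun g hg a b => hg.intervalIntegrable a b
  have key : ∀ s b : ℝ, ∫ k in (0 : ℝ)..b, (f (k + s) - f k - f s + f 0)
      = (∫ k in s..(b + s), f k) - (∫ k in (0 : ℝ)..b, f k) - b * f s + b * f 0 := by
    intro s b
    rw [intervalIntegral.integral_add (hi _ (by fun_prop) _ _) (hi _ (by fun_prop) _ _),
      intervalIntegral.integral_sub (hi _ (by fun_prop) _ _) (hi _ (by fun_prop) _ _),
      intervalIntegral.integral_sub (hi _ (by fun_prop) _ _) (hi _ (by fun_prop) _ _),
      intervalIntegral.integral_comp_add_right]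
    simp
  rw [key, key, ← intervalIntegral.integral_add_adjacent_intervals (hi f hf t 0)
    (hi f hf 0 (1 + t)),
    ← intervalIntegral.integral_add_adjacent_intervals (hi f hf 1 0) (hi f hf 0 (t + 1)),
    intervalIntegral.integral_symm 0 t, intervalIntegral.integral_symm 0 1, add_comm t 1]
  ring

theorem ofReal_add_sq_le (a b : ℝ) :
    ENNReal.ofReal ((a + b) ^ 2) ≤ 2 * (ENNReal.ofReal (a ^ 2) + ENNReal.ofReal (b ^ 2)) := by
  rw [← ENNReal.ofReal_add (by positivity) (by positivity),
    show (2 : ENNReal) = ENNReal.ofReal 2 by simp, ← ENNReal.ofReal_mul (by norm_num)]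
  exact ENNReal.ofReal_le_ofReal (by nlinarith [sq_nonneg (a - b)])

theorem ofReal_sq_sub_linear_le {f : ℝ → ℝ} (hf : Continuous f) {t : ℝ} (ht : |t| ≤ 1) :
    ENNReal.ofReal ((f t - f 0 - t * (f 1 - f 0)) ^ 2)
      ≤ 2 * ∫⁻ k in Set.Icc (-1 : ℝ) 1, (ENNReal.ofReal ((f (k + t) - f k - f t + f 0) ^ 2)
        + ENNReal.ofReal ((f (k + 1) - f k - f 1 + f 0) ^ 2)) := by
  have hm : Measurable fun k => ENNReal.ofReal ((f (k + t) - f k - f t + f 0) ^ 2) :=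
    (Continuous.measurable (by fun_prop)).ennreal_ofReal
  rw [sub_linear_eq_integral hf, lintegral_add_left hm]
  refine (ofReal_add_sq_le _ _).trans ?_
  rw [neg_sq]
  gcongr
  · exact ofReal_sq_intervalIntegral_le (by fun_prop) (by norm_num) (by norm_num) (by norm_num)
  · exact ofReal_sq_intervalIntegral_le (by fun_prop) (by norm_num) (abs_le.1 ht)
      (by simpa using ht)

end LineInterpolation

section AffineDefect

variable {d : ℕ}

/-- The error at `x + a • τ` of the affine interpolation of `G` at `x` and the points
`x + a • eᵢ`. -/
def affineDefect (G : EuclideanSpace ℝ (Fin d) → ℝ) (a : ℝ) (τ x : EuclideanSpace ℝ (Fin d)) : ℝ :=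
  G (x + a • τ) - G x - ∑ i, τ i * (G (x + a • EuclideanSpace.single i 1) - G x)

/-- The vector agreeing with `τ` in the coordinates below `m` and vanishing in the others. -/
def truncVec (τ : EuclideanSpace ℝ (Fin d)) (m : ℕ) : EuclideanSpace ℝ (Fin d) :=
  WithLp.toLp 2 fun i => if (i : ℕ) < m then τ i else 0

theorem truncVec_succ (τ : EuclideanSpace ℝ (Fin d)) (i : Fin d) :
    truncVec τ (i + 1) = truncVec τ i + τ i • EuclideanSpace.single i (1 : ℝ) := by
  ext l
  rcases lt_trichotomy l i with h | rfl | h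
  · simp [truncVec, h, h.le, h.ne]
  · simp [truncVec]
  · simp [truncVec, h.not_gt, h.not_ge, h.ne']

theorem norm_truncVec_le {τ : EuclideanSpace ℝ (Fin d)} (hτ : ∀ i, |τ i| ≤ 1) (m : ℕ) :
    ‖truncVec τ m‖ ≤ d + 1 := by
  rw [EuclideanSpace.norm_eq]
  refine Real.sqrt_le_iff.2 ⟨by positivity, ?_⟩
  calc ∑ i, ‖truncVec τ m i‖ ^ 2 ≤ ∑ i : Fin d, (1 : ℝ) := by
        refine Finset.sum_le_sum fun i _ => ?_
        rw [Real.norm_eq_abs, sq_le_one_iff_abs_le_one, abs_abs]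
        by_cases h : (i : ℕ) < m <;> simp [truncVec, h, hτ i]
    _ ≤ (d + 1) ^ 2 := by
        simp only [Finset.sum_const, Finset.card_univ, Fintype.card_fin, nsmul_eq_mul, mul_one]
        nlinarith [Nat.cast_nonneg (α := ℝ) d]

theorem affineDefect_eq_sum (G : EuclideanSpace ℝ (Fin d) → ℝ) (a : ℝ)
    (τ x : EuclideanSpace ℝ (Fin d)) :
    affineDefect G a τ x = ∑ i : Fin d,
      ((G (x + a • truncVec τ i + a • τ i • EuclideanSpace.single i (1 : ℝ))
          - G (x + a • truncVec τ i)
          - G (x + a • τ i • EuclideanSpace.single i (1 : ℝ)) + G x)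
        + (G (x + a • τ i • EuclideanSpace.single i (1 : ℝ)) - G x
          - τ i * (G (x + a • EuclideanSpace.single i (1 : ℝ)) - G x))) := by
  have h := Finset.sum_range_sub (fun m => G (x + a • truncVec τ m)) d
  have h0 : truncVec τ 0 = 0 := by ext; simp [truncVec]
  have hd : truncVec τ d = τ := by ext; simp [truncVec]
  rw [h0, hd, smul_zero, add_zero, ← Fin.sum_univ_eq_sum_range
    (fun m => G (x + a • truncVec τ (m + 1)) - G (x + a • truncVec τ m))] at h
  rw [affineDefect, ← h, ← Finset.sum_sub_distrib]
  refine Finset.sum_congr rfl fun i _ => ?_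
  rw [truncVec_succ, smul_add, ← add_assoc]
  ring

/-- The squared `L²` norm of the affine interpolation defect. -/
def affineDefectEnergy (G : EuclideanSpace ℝ (Fin d) → ℝ) (a : ℝ)
    (τ : EuclideanSpace ℝ (Fin d)) : ENNReal :=
  ∫⁻ x, ENNReal.ofReal (affineDefect G a τ x ^ 2)

theorem affineDefectEnergy_le {G : EuclideanSpace ℝ (Fin d) → ℝ} (hG : Continuous G) (a : ℝ)
    {τ : EuclideanSpace ℝ (Fin d)} (hτ : ∀ i, |τ i| ≤ 1) :
    affineDefectEnergy G a τ ≤ d * ∑ i : Fin d, 2 *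
      (mixedDiffEnergy volume G (a • truncVec τ i) (a • τ i • EuclideanSpace.single i (1 : ℝ))
        + 2 * ∫⁻ k in Set.Icc (-1 : ℝ) 1,
          (mixedDiffEnergy volume G (a • k • EuclideanSpace.single i (1 : ℝ))
              (a • τ i • EuclideanSpace.single i (1 : ℝ))
            + mixedDiffEnergy volume G (a • k • EuclideanSpace.single i (1 : ℝ))
              (a • (1 : ℝ) • EuclideanSpace.single i (1 : ℝ)))) := by
  have hm : ∀ f : EuclideanSpace ℝ (Fin d) → ℝ, Continuous f →
      Measurable fun x => ENNReal.ofReal (f x) := fun f hf => hf.measurable.ennreal_ofReal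
  have hline : ∀ (i : Fin d) (s : ℝ), ∫⁻ k in Set.Icc (-1 : ℝ) 1,
      mixedDiffEnergy volume G (a • k • EuclideanSpace.single i (1 : ℝ))
        (a • s • EuclideanSpace.single i (1 : ℝ))
      = ∫⁻ x, ∫⁻ k in Set.Icc (-1 : ℝ) 1, ENNReal.ofReal
        ((G (x + a • k • EuclideanSpace.single i (1 : ℝ) + a • s • EuclideanSpace.single i (1 : ℝ))
          - G (x + a • k • EuclideanSpace.single i (1 : ℝ))
          - G (x + a • s • EuclideanSpace.single i (1 : ℝ)) + G x) ^ 2) := by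
    intro i s
    unfold mixedDiffEnergy
    refine lintegral_lintegral_swap (Measurable.aemeasurable ?_)
    exact (Continuous.measurable (by fun_prop)).ennreal_ofReal
  have hpt : ∀ x, ENNReal.ofReal (affineDefect G a τ x ^ 2) ≤ d * ∑ i : Fin d, 2 *
      (ENNReal.ofReal ((G (x + a • truncVec τ i + a • τ i • EuclideanSpace.single i (1 : ℝ))
          - G (x + a • truncVec τ i)
          - G (x + a • τ i • EuclideanSpace.single i (1 : ℝ)) + G x) ^ 2)
        + 2 * ∫⁻ k in Set.Icc (-1 : ℝ) 1, (ENNReal.ofReal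
        ((G (x + a • k • EuclideanSpace.single i (1 : ℝ)
            + a • τ i • EuclideanSpace.single i (1 : ℝ))
          - G (x + a • k • EuclideanSpace.single i (1 : ℝ))
          - G (x + a • τ i • EuclideanSpace.single i (1 : ℝ)) + G x) ^ 2)
        + ENNReal.ofReal
        ((G (x + a • k • EuclideanSpace.single i (1 : ℝ)
            + a • (1 : ℝ) • EuclideanSpace.single i (1 : ℝ))
          - G (x + a • k • EuclideanSpace.single i (1 : ℝ))
          - G (x + a • (1 : ℝ) • EuclideanSpace.single i (1 : ℝ)) + G x) ^ 2))) := by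
    intro x
    rw [affineDefect_eq_sum]
    refine (ENNReal.ofReal_le_ofReal sq_sum_le_card_mul_sum_sq).trans ?_
    rw [ENNReal.ofReal_mul (by positivity),
      ENNReal.ofReal_sum_of_nonneg (fun _ _ => sq_nonneg _)]
    simp only [Finset.card_univ, Fintype.card_fin, ENNReal.ofReal_natCast]
    gcongr with i
    refine (ofReal_add_sq_le _ _).trans ?_
    gcongr
    have hf : Continuous fun s : ℝ => G (x + a • s • EuclideanSpace.single i (1 : ℝ)) := by
      fun_prop
    have := ofReal_sq_sub_linear_le hf (hτ i)
    simpa only [zero_smul, smul_zero, add_zero, add_smul, smul_add, ← add_assoc, one_smul]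
      using this
  refine (lintegral_mono hpt).trans_eq ?_
  have hm2 : ∀ (i : Fin d) (s : ℝ), Measurable fun x => ∫⁻ k in Set.Icc (-1 : ℝ) 1, ENNReal.ofReal
        ((G (x + a • k • EuclideanSpace.single i (1 : ℝ) + a • s • EuclideanSpace.single i (1 : ℝ))
          - G (x + a • k • EuclideanSpace.single i (1 : ℝ))
          - G (x + a • s • EuclideanSpace.single i (1 : ℝ)) + G x) ^ 2) := fun i s =>
    Measurable.lintegral_prod_right (Continuous.measurable (by fun_prop)).ennreal_ofReal
  have hm3 : ∀ (i : Fin d) (s : ℝ), Measurable fun k : ℝ =>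
      mixedDiffEnergy volume G (a • k • EuclideanSpace.single i (1 : ℝ))
        (a • s • EuclideanSpace.single i (1 : ℝ)) := fun i s =>
    Measurable.lintegral_prod_right (Continuous.measurable (by fun_prop)).ennreal_ofReal
  have hm4 : ∀ (i : Fin d) (s : ℝ) (x : EuclideanSpace ℝ (Fin d)), Measurable fun k : ℝ =>
      ENNReal.ofReal
        ((G (x + a • k • EuclideanSpace.single i (1 : ℝ) + a • s • EuclideanSpace.single i (1 : ℝ))
          - G (x + a • k • EuclideanSpace.single i (1 : ℝ))
          - G (x + a • s • EuclideanSpace.single i (1 : ℝ)) + G x) ^ 2) := fun i s x =>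
    (Continuous.measurable (by fun_prop)).ennreal_ofReal
  simp only [lintegral_add_left (hm3 _ _), lintegral_add_left (hm4 _ _ _), hline]
  have hm5 : ∀ i : Fin d, Measurable fun x =>
      ENNReal.ofReal ((G (x + a • truncVec τ i + a • τ i • EuclideanSpace.single i (1 : ℝ))
          - G (x + a • truncVec τ i)
          - G (x + a • τ i • EuclideanSpace.single i (1 : ℝ)) + G x) ^ 2) := fun i =>
    hm _ (by fun_prop)
  rw [lintegral_const_mul _ (Finset.measurable_fun_sum _ fun i _ =>
      ((hm5 i).fun_add (((hm2 i _).fun_add (hm2 i _)).const_mul _)).const_mul _),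
    lintegral_finsetSum _ (fun i _ =>
      ((hm5 i).fun_add (((hm2 i _).fun_add (hm2 i _)).const_mul _)).const_mul _)]
  congr 1
  refine Finset.sum_congr rfl fun i _ => ?_
  rw [lintegral_const_mul _ ((hm5 i).fun_add (((hm2 i _).fun_add (hm2 i _)).const_mul _)),
    lintegral_add_left (hm5 i), lintegral_const_mul _ ((hm2 i _).fun_add (hm2 i _)),
    lintegral_add_left (hm2 i _)]
  rfl

theorem sum_affineDefectEnergy_le {R : ℝ} {G : EuclideanSpace ℝ (Fin d) → ℝ}
    (hG : LipschitzWith 1 G) (hR : ∀ x, R < ‖x‖ → G x = 0)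
    {τ : EuclideanSpace ℝ (Fin d)} (hτ : ∀ i, |τ i| ≤ 1) (N : ℕ) :
    ∑ j ∈ Finset.range N, 4 ^ j * affineDefectEnergy G ((1 / 2 : ℝ) ^ j) τ
      ≤ 18 * d ^ 2 * (4 * (ENNReal.ofReal ((2 * (d + 1)) ^ 2)
        * volume (Metric.closedBall (0 : EuclideanSpace ℝ (Fin d)) (R + 2 * (d + 1))))) := by
  set C := 4 * (ENNReal.ofReal ((2 * (d + 1)) ^ 2)
    * volume (Metric.closedBall (0 : EuclideanSpace ℝ (Fin d)) (R + 2 * (d + 1)))) with hC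
  have hsingle : ∀ (i : Fin d) (s : ℝ), |s| ≤ 1 →
      ‖s • EuclideanSpace.single i (1 : ℝ)‖ ≤ d + 1 := by
    intro i s hs
    rw [norm_smul, PiLp.norm_single, norm_one, mul_one, Real.norm_eq_abs]
    linarith [Nat.cast_nonneg (α := ℝ) d]
  have key : ∀ v w : EuclideanSpace ℝ (Fin d), ‖v‖ ≤ d + 1 → ‖w‖ ≤ d + 1 →
      ∑ j ∈ Finset.range N, 4 ^ j *
        mixedDiffEnergy volume G ((1 / 2 : ℝ) ^ j • v) ((1 / 2 : ℝ) ^ j • w) ≤ C :=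
    fun v w hv hw => sum_mixedDiffEnergy_le hG hR hv hw N
  have hm3 : ∀ (a : ℝ) (i : Fin d) (s : ℝ), Measurable fun k : ℝ =>
      mixedDiffEnergy volume G (a • k • EuclideanSpace.single i (1 : ℝ))
        (a • s • EuclideanSpace.single i (1 : ℝ)) := fun a i s => by
    have := hG.continuous
    exact Measurable.lintegral_prod_right (Continuous.measurable (by fun_prop)).ennreal_ofReal
  calc _ ≤ ∑ j ∈ Finset.range N, ∑ i : Fin d, 2 * d *
      (4 ^ j * mixedDiffEnergy volume G ((1 / 2 : ℝ) ^ j • truncVec τ i)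
          ((1 / 2 : ℝ) ^ j • τ i • EuclideanSpace.single i (1 : ℝ))
        + 2 * ∫⁻ k in Set.Icc (-1 : ℝ) 1,
          4 ^ j * (mixedDiffEnergy volume G ((1 / 2 : ℝ) ^ j • k • EuclideanSpace.single i (1 : ℝ))
              ((1 / 2 : ℝ) ^ j • τ i • EuclideanSpace.single i (1 : ℝ))
            + mixedDiffEnergy volume G ((1 / 2 : ℝ) ^ j • k • EuclideanSpace.single i (1 : ℝ))
              ((1 / 2 : ℝ) ^ j • (1 : ℝ) • EuclideanSpace.single i (1 : ℝ)))) := by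
        refine Finset.sum_le_sum fun j _ => ?_
        refine (mul_le_mul_right (affineDefectEnergy_le hG.continuous _ hτ) _).trans_eq ?_
        simp only [Finset.mul_sum]
        refine Finset.sum_congr rfl fun i _ => ?_
        rw [lintegral_const_mul _ ((hm3 _ _ _).fun_add (hm3 _ _ _))]
        ring
    _ ≤ ∑ i : Fin d, 2 * d * (C + 2 * ∫⁻ k in Set.Icc (-1 : ℝ) 1, (C + C)) := by
        rw [Finset.sum_comm]
        refine Finset.sum_le_sum fun i _ => ?_
        rw [← Finset.mul_sum, Finset.sum_add_distrib, ← Finset.mul_sum,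
          ← lintegral_finsetSum _ fun j _ => ((hm3 _ _ _).fun_add (hm3 _ _ _)).const_mul _]
        refine mul_le_mul_right (add_le_add
          (key _ _ (norm_truncVec_le hτ i) (hsingle i _ (hτ i))) (mul_le_mul_right ?_ _)) _
        · refine setLIntegral_mono measurable_const fun k hk => ?_
          have hk' : |k| ≤ 1 := abs_le.2 hk
          simp only [mul_add]
          rw [Finset.sum_add_distrib]
          exact add_le_add (key _ _ (hsingle i k hk') (hsingle i _ (hτ i)))
            (key _ _ (hsingle i k hk') (hsingle i _ (by simp)))
    _ = _ := by
        rw [setLIntegral_const, Real.volume_Icc, Finset.sum_const, Finset.card_univ,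
          Fintype.card_fin, nsmul_eq_mul]
        norm_num
        ring

end AffineDefect

section Boxes

variable {d : ℕ}

/-- The closed axis-parallel cube with lowest corner `c` and sidelength `s`. -/
def closedBox (c : Fin d → ℝ) (s : ℝ) : Set (EuclideanSpace ℝ (Fin d)) :=
  {x | ∀ i, c i ≤ x i ∧ x i ≤ c i + s}

/-- The half-open axis-parallel cube with lowest corner `c` and sidelength `s`. -/
def halfOpenBox (c : Fin d → ℝ) (s : ℝ) : Set (EuclideanSpace ℝ (Fin d)) :=
  {x | ∀ i, c i ≤ x i ∧ x i < c i + s}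

/-- The closed cube with center `0` and sidelength `2 * r`. -/
def centeredBox (d : ℕ) (r : ℝ) : Set (EuclideanSpace ℝ (Fin d)) :=
  {x | ∀ i, |x i| ≤ r}

theorem dyadicCube_eq_closedBox (p : ℕ × (Fin d → ℤ)) :
    dyadicCube d p = closedBox (fun i => (p.2 i : ℝ) / 2 ^ p.1) ((1 / 2) ^ p.1) := by
  ext x
  simp only [dyadicCube, closedBox, Set.mem_ofPred_eq, add_div, one_div_pow]

theorem closedBox_eq_preimage (c : Fin d → ℝ) (s : ℝ) :
    closedBox c s = WithLp.ofLp ⁻¹' Set.Icc c (fun i => c i + s) := by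
  ext x
  simp [closedBox, Pi.le_def, forall_and]

theorem halfOpenBox_eq_preimage (c : Fin d → ℝ) (s : ℝ) :
    halfOpenBox c s = WithLp.ofLp ⁻¹' Set.pi Set.univ (fun i => Set.Ico (c i) (c i + s)) := by
  ext x
  simp [halfOpenBox]

theorem isClosed_closedBox (c : Fin d → ℝ) (s : ℝ) : IsClosed (closedBox c s) := by
  rw [closedBox_eq_preimage]
  exact isClosed_Icc.preimage (by fun_prop)

theorem isCompact_closedBox (c : Fin d → ℝ) (s : ℝ) : IsCompact (closedBox c s) := by
  rw [closedBox_eq_preimage]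
  exact (EuclideanSpace.equiv (Fin d) ℝ).toHomeomorph.isCompact_preimage.2 isCompact_Icc

theorem measurableSet_halfOpenBox (c : Fin d → ℝ) (s : ℝ) : MeasurableSet (halfOpenBox c s) := by
  rw [halfOpenBox_eq_preimage]
  exact (PiLp.volume_preserving_ofLp (Fin d)).measurable
    (MeasurableSet.univ_pi fun _ => measurableSet_Ico)

theorem centeredBox_eq_closedBox (r : ℝ) :
    centeredBox d r = closedBox (fun _ => -r) (2 * r) := by
  ext x
  simp only [centeredBox, closedBox, Set.mem_ofPred_eq, abs_le]
  exact forall_congr' fun i => and_congr_right fun _ => by rw [two_mul, neg_add_cancel_left]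

theorem volume_closedBox (c : Fin d → ℝ) {s : ℝ} (hs : 0 ≤ s) :
    volume (closedBox c s) = ENNReal.ofReal (s ^ d) := by
  rw [closedBox_eq_preimage, (PiLp.volume_preserving_ofLp (Fin d)).measure_preimage
    measurableSet_Icc.nullMeasurableSet, Real.volume_Icc_pi]
  simp [ENNReal.ofReal_pow hs]

theorem volume_halfOpenBox (c : Fin d → ℝ) {s : ℝ} (hs : 0 ≤ s) :
    volume (halfOpenBox c s) = ENNReal.ofReal (s ^ d) := by
  rw [halfOpenBox_eq_preimage, (PiLp.volume_preserving_ofLp (Fin d)).measure_preimage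
    (MeasurableSet.univ_pi fun _ => measurableSet_Ico).nullMeasurableSet, Real.volume_pi_Ico]
  simp [ENNReal.ofReal_pow hs]

theorem norm_le_of_forall_abs_le {x : EuclideanSpace ℝ (Fin d)} {r : ℝ} (hr : 0 ≤ r)
    (hx : ∀ i, |x i| ≤ r) : ‖x‖ ≤ d * r := by
  rw [EuclideanSpace.norm_eq]
  refine Real.sqrt_le_iff.2 ⟨by positivity, ?_⟩
  calc ∑ i, ‖x i‖ ^ 2 ≤ ∑ i : Fin d, r ^ 2 :=
        Finset.sum_le_sum fun i _ => pow_le_pow_left₀ (norm_nonneg _) (hx i) 2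
    _ = d * r ^ 2 := by simp
    _ ≤ (d * r) ^ 2 := by
        rw [mul_pow]
        gcongr
        exact_mod_cast Nat.le_self_pow two_ne_zero d

theorem setLIntegral_comp_add_le {f : EuclideanSpace ℝ (Fin d) → ENNReal}
    {s t : Set (EuclideanSpace ℝ (Fin d))} (hs : MeasurableSet s) (ht : MeasurableSet t)
    {h : EuclideanSpace ℝ (Fin d)} (hst : ∀ x ∈ s, x + h ∈ t) :
    ∫⁻ x in s, f (x + h) ≤ ∫⁻ x in t, f x := by
  rw [← lintegral_indicator hs, ← lintegral_indicator ht,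
    ← lintegral_add_right_eq_self (t.indicator f) h]
  refine lintegral_mono fun x => ?_
  by_cases hx : x ∈ s
  · rw [Set.indicator_of_mem hx, Set.indicator_of_mem (hst x hx)]
  · simp [Set.indicator_of_notMem hx]

theorem setLIntegral_centeredBox_smul {f : EuclideanSpace ℝ (Fin d) → ENNReal} (hf : Measurable f)
    {a : ℝ} (ha : 0 < a) :
    ∫⁻ t in centeredBox d a, f (a⁻¹ • t)
      = ENNReal.ofReal (a ^ d) * ∫⁻ τ in centeredBox d 1, f τ := by
  have hmeas : MeasurableSet (centeredBox d 1) := by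
    rw [centeredBox_eq_closedBox]
    exact (isClosed_closedBox _ _).measurableSet
  have hpre : (fun t => a⁻¹ • t) ⁻¹' centeredBox d 1 = centeredBox d a := by
    ext t
    simp [centeredBox, abs_mul, abs_of_pos ha, inv_mul_le_iff₀ ha]
  rw [← hpre, ← setLIntegral_map hmeas hf (measurable_const_smul _),
    Measure.map_addHaar_smul _ (inv_ne_zero ha.ne'), Measure.restrict_smul, lintegral_smul_measure,
    finrank_euclideanSpace_fin, inv_pow, inv_inv, abs_of_nonneg (by positivity), smul_eq_mul]

end Boxes

section BestApproximation

variable {d : ℕ}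

theorem IsAffineFn.continuous {L : EuclideanSpace ℝ (Fin d) → ℝ} (hL : IsAffineFn L) :
    Continuous L := by
  obtain ⟨a, b, rfl⟩ := hL
  fun_prop

theorem ofReal_setIntegral_sq {g : EuclideanSpace ℝ (Fin d) → ℝ}
    {Q : Set (EuclideanSpace ℝ (Fin d))} (hQ : IsCompact Q) (hg : ContinuousOn g Q) :
    ENNReal.ofReal (∫ x in Q, g x ^ 2) = ∫⁻ x in Q, ENNReal.ofReal (g x ^ 2) :=
  ofReal_integral_eq_lintegral_ofReal ((hg.pow 2).integrableOn_compact hQ)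
    (Filter.Eventually.of_forall fun _ => sq_nonneg _)

variable {F L : EuclideanSpace ℝ (Fin d) → ℝ} {c : Fin d → ℝ} {s : ℝ}

theorem sq_mul_pow_le_setIntegral {g : EuclideanSpace ℝ (Fin d) → ℝ}
    (hg : ContinuousOn g (closedBox c s)) {q : Fin d → ℝ} {r m : ℝ} (hr : 0 ≤ r) (hm : 0 ≤ m)
    (hsub : closedBox q r ⊆ closedBox c s) (hlow : ∀ x ∈ closedBox q r, m ≤ |g x|) :
    m ^ 2 * r ^ d ≤ ∫ x in closedBox c s, g x ^ 2 := by
  rw [← ENNReal.ofReal_le_ofReal_iff (integral_nonneg fun _ => sq_nonneg _),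
    ofReal_setIntegral_sq (isCompact_closedBox c s) hg, ENNReal.ofReal_mul (by positivity),
    ← volume_closedBox q hr, ← setLIntegral_const]
  refine le_trans ?_ (lintegral_mono_set hsub)
  refine setLIntegral_mono' (isClosed_closedBox q r).measurableSet fun x hx => ?_
  refine ENNReal.ofReal_le_ofReal ?_
  rw [← sq_abs (g x)]
  exact pow_le_pow_left₀ hm (hlow x hx) 2

theorem abs_sub_le_of_mem_closedBox {x y : EuclideanSpace ℝ (Fin d)} (hx : x ∈ closedBox c s)
    (hy : y ∈ closedBox c s) (i : Fin d) : |x i - y i| ≤ s :=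
  abs_le.2 ⟨by linarith [(hx i).1, (hy i).2], by linarith [(hx i).2, (hy i).1]⟩

theorem abs_sub_le_of_lipschitzOnWith {Q : Set (EuclideanSpace ℝ (Fin d))}
    (hF : LipschitzOnWith 1 F Q) {x y : EuclideanSpace ℝ (Fin d)} (hx : x ∈ Q) (hy : y ∈ Q) {r : ℝ}
    (hr : 0 ≤ r) (hxy : ∀ i, |x i - y i| ≤ r) : |F x - F y| ≤ d * r := by
  have h1 := hF.dist_le_mul x hx y hy
  rw [Real.dist_eq, NNReal.coe_one, one_mul, dist_eq_norm] at h1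
  exact h1.trans (norm_le_of_forall_abs_le hr fun i => by simpa using hxy i)

theorem setIntegral_sq_le_of_isBestAffineApprox (hs : 0 ≤ s)
    (hF : LipschitzOnWith 1 F (closedBox c s)) (hL : IsBestAffineApprox F (closedBox c s) L) :
    ∫ x in closedBox c s, (F x - L x) ^ 2 ≤ (d * s) ^ 2 * s ^ d := by
  have hc : WithLp.toLp 2 c ∈ closedBox c s := fun i => ⟨le_rfl, by simpa using hs⟩
  refine (hL.2 (fun _ => F (WithLp.toLp 2 c)) ⟨0, F (WithLp.toLp 2 c), by simp⟩).trans ?_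
  have hvol : volume (closedBox c s) < ⊤ := by simp [volume_closedBox c hs]
  have := norm_setIntegral_le_of_norm_le_const (μ := volume)
    (f := fun x => (F x - F (WithLp.toLp 2 c)) ^ 2) (C := (d * s) ^ 2) hvol fun x hx => by
      rw [Real.norm_of_nonneg (sq_nonneg _), ← sq_abs]
      exact pow_le_pow_left₀ (abs_nonneg _) (abs_sub_le_of_lipschitzOnWith hF hx hc hs
        (abs_sub_le_of_mem_closedBox hx hc)) 2
  rw [Measure.real, volume_closedBox c hs, ENNReal.toReal_ofReal (by positivity)] at this
  exact (Real.le_norm_self _).trans this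

/-- A bound, depending only on the dimension, for the slopes of best affine approximations of
1-Lipschitz functions. -/
def slopeBound (d : ℕ) : ℝ := 3 * (2 * d ^ 2 * 2 ^ (d + 2) + 1)

theorem abs_slope_le_of_isBestAffineApprox (hs : 0 < s) (hF : LipschitzOnWith 1 F (closedBox c s))
    {a : Fin d → ℝ} {b : ℝ}
    (hL : IsBestAffineApprox F (closedBox c s) fun x => (∑ i, a i * x i) + b) (i : Fin d) :
    |a i| ≤ slopeBound d := by
  set L : EuclideanSpace ℝ (Fin d) → ℝ := fun x => (∑ i, a i * x i) + b with hLdef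
  set h : EuclideanSpace ℝ (Fin d) := (s / 2) • EuclideanSpace.single i 1 with hh
  have hs2 : 0 ≤ s / 2 := by positivity
  have hhi : ∀ l, 0 ≤ h l ∧ h l ≤ s / 2 := fun l => by
    by_cases hl : l = i <;> simp [hh, hl, hs2]
  have hstep : ∀ x, L (x + h) - L x = a i * (s / 2) := fun x => by
    simp only [hLdef, PiLp.add_apply, mul_add, Finset.sum_add_distrib]
    simp [hh, PiLp.single_apply]
  have hcont : ContinuousOn (fun x => F x - L x) (closedBox c s) :=
    hF.continuousOn.sub hL.1.continuous.continuousOn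
  have hsub : closedBox c (s / 2) ⊆ closedBox c s := fun x hx l =>
    ⟨(hx l).1, by linarith [(hx l).2]⟩
  have hshift : ∀ x ∈ closedBox c (s / 2), x + h ∈ closedBox c s := fun x hx l => by
    have := hhi l
    have := hx l
    constructor <;> rw [PiLp.add_apply] <;> linarith
  have hmeas : MeasurableSet (closedBox c (s / 2)) := (isClosed_closedBox _ _).measurableSet
  set e := ∫ x in closedBox c s, (F x - L x) ^ 2 with he
  have he0 : 0 ≤ e := integral_nonneg fun _ => sq_nonneg _
  have hofe := ofReal_setIntegral_sq (isCompact_closedBox c s) hcont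
  rw [← he] at hofe
  have h1 : ∫⁻ x in closedBox c (s / 2), ENNReal.ofReal ((F x - L x) ^ 2) ≤ ENNReal.ofReal e :=
    hofe ▸ lintegral_mono_set hsub
  have h2 : ∫⁻ x in closedBox c (s / 2), ENNReal.ofReal ((F (x + h) - L (x + h)) ^ 2)
      ≤ ENNReal.ofReal e :=
    hofe ▸ setLIntegral_comp_add_le (f := fun x => ENNReal.ofReal ((F x - L x) ^ 2)) hmeas
      (isClosed_closedBox _ _).measurableSet hshift
  have hmeasF : AEMeasurable (fun x => ENNReal.ofReal ((F x - L x) ^ 2))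
      (volume.restrict (closedBox c (s / 2))) :=
    (((hcont.mono hsub).pow 2).aemeasurable hmeas).ennreal_ofReal
  have h3 : ENNReal.ofReal ((a i * (s / 2)) ^ 2) * ENNReal.ofReal ((s / 2) ^ d)
      ≤ ENNReal.ofReal (3 * (e + e + (s / 2) ^ 2 * (s / 2) ^ d)) := by
    rw [← volume_closedBox c (by positivity), ← setLIntegral_const]
    calc _ ≤ ∫⁻ x in closedBox c (s / 2), ENNReal.ofReal 3 *
          (ENNReal.ofReal ((F x - L x) ^ 2) + (ENNReal.ofReal ((F (x + h) - L (x + h)) ^ 2)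
            + ENNReal.ofReal ((s / 2) ^ 2))) := by
          refine setLIntegral_mono' hmeas fun x hx => ?_
          rw [← ENNReal.ofReal_add (by positivity) (by positivity),
            ← ENNReal.ofReal_add (by positivity) (by positivity),
            ← ENNReal.ofReal_mul (by norm_num)]
          refine ENNReal.ofReal_le_ofReal ?_
          have hFx : |F (x + h) - F x| ≤ s / 2 := by
            have := hF.dist_le_mul (x + h) (hshift x hx) x (hsub hx)
            rw [Real.dist_eq, dist_eq_norm, add_sub_cancel_left, hh, norm_smul,
              PiLp.norm_single, Real.norm_of_nonneg (by positivity)] at this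
            simpa using this
          have hFx2 : (F (x + h) - F x) ^ 2 ≤ (s / 2) ^ 2 :=
            sq_le_sq' (abs_le.1 hFx).1 (abs_le.1 hFx).2
          rw [← hstep x]
          nlinarith [sq_nonneg ((F x - L x) + (F (x + h) - L (x + h))),
            sq_nonneg ((F x - L x) - (F (x + h) - F x)),
            sq_nonneg ((F (x + h) - L (x + h)) + (F (x + h) - F x))]
      _ ≤ ENNReal.ofReal 3 * (ENNReal.ofReal e + (ENNReal.ofReal e
            + ENNReal.ofReal ((s / 2) ^ 2) * ENNReal.ofReal ((s / 2) ^ d))) := by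
          rw [lintegral_const_mul' _ _ ENNReal.ofReal_ne_top, lintegral_add_left' hmeasF,
            lintegral_add_right _ measurable_const, setLIntegral_const,
            volume_closedBox c (by positivity)]
          gcongr
      _ = _ := by
          rw [← ENNReal.ofReal_mul (by positivity),
            ← ENNReal.ofReal_add (by positivity) (by positivity),
            ← ENNReal.ofReal_add (by positivity) (by positivity),
            ← ENNReal.ofReal_mul (by norm_num), add_assoc]
  rw [← ENNReal.ofReal_mul (by positivity), ENNReal.ofReal_le_ofReal_iff (by positivity)] at h3
  have h4 : e ≤ (d * s) ^ 2 * s ^ d := setIntegral_sq_le_of_isBestAffineApprox hs.le hF hL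
  have h5 : (d * s) ^ 2 * s ^ d = d ^ 2 * 2 ^ (d + 2) * ((s / 2) ^ 2 * (s / 2) ^ d) := by
    rw [div_pow, div_pow, pow_add 2 d 2]
    field_simp
  have hpos : 0 < (s / 2) ^ 2 * (s / 2) ^ d := by positivity
  have h6 : a i ^ 2 ≤ slopeBound d := by
    refine le_of_mul_le_mul_right ?_ hpos
    rw [slopeBound]
    nlinarith
  have h7 : 1 ≤ slopeBound d := by
    rw [slopeBound]
    nlinarith [show (0 : ℝ) ≤ 2 * d ^ 2 * 2 ^ (d + 2) by positivity]
  exact abs_le_of_sq_le_sq (by nlinarith) (by linarith)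

/-- A bound, depending only on the dimension, for the Lipschitz constant in the maximum metric of
the difference between a 1-Lipschitz function and its best affine approximation. -/
def defectLipschitz (d : ℕ) : ℝ := d + d * slopeBound d + 1

theorem slopeBound_nonneg (d : ℕ) : 0 ≤ slopeBound d := by
  unfold slopeBound
  positivity

theorem abs_sub_sub_le_of_isBestAffineApprox (hs : 0 < s)
    (hF : LipschitzOnWith 1 F (closedBox c s)) (hL : IsBestAffineApprox F (closedBox c s) L)
    {x y : EuclideanSpace ℝ (Fin d)} (hx : x ∈ closedBox c s) (hy : y ∈ closedBox c s) {r : ℝ}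
    (hr : 0 ≤ r) (hxy : ∀ i, |x i - y i| ≤ r) :
    |(F x - L x) - (F y - L y)| ≤ defectLipschitz d * r := by
  obtain ⟨a, b, rfl⟩ := hL.1
  have h1 := abs_sub_le_of_lipschitzOnWith hF hx hy hr hxy
  have h2 : |∑ i, a i * (x i - y i)| ≤ d * slopeBound d * r := by
    refine (Finset.abs_sum_le_sum_abs _ _).trans ?_
    calc _ ≤ ∑ i : Fin d, slopeBound d * r := by
          refine Finset.sum_le_sum fun i _ => ?_
          rw [abs_mul]
          exact mul_le_mul (abs_slope_le_of_isBestAffineApprox hs hF hL i) (hxy i) (abs_nonneg _)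
            (slopeBound_nonneg d)
      _ = _ := by simp [mul_assoc]
  have h3 : (F x - ((∑ i, a i * x i) + b)) - (F y - ((∑ i, a i * y i) + b))
      = (F x - F y) - ∑ i, a i * (x i - y i) := by
    simp only [mul_sub, Finset.sum_sub_distrib]
    ring
  rw [h3, defectLipschitz]
  refine (abs_sub _ _).trans ?_
  linarith

theorem le_setIntegral_sq_of_isBestAffineApprox (hs : 0 < s)
    (hF : LipschitzOnWith 1 F (closedBox c s)) (hL : IsBestAffineApprox F (closedBox c s) L)
    {ε : ℝ} (hε : 0 < ε) {y : EuclideanSpace ℝ (Fin d)} (hy : y ∈ closedBox c s)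
    (hbad : ε * s < |F y - L y|) :
    ε ^ (d + 2) * (s ^ 2 * s ^ d) / (4 * (2 * defectLipschitz d) ^ d)
      ≤ ∫ x in closedBox c s, (F x - L x) ^ 2 := by
  have hcont : ContinuousOn (fun x => F x - L x) (closedBox c s) :=
    hF.continuousOn.sub hL.1.continuous.continuousOn
  set K := defectLipschitz d with hK
  have hdK : (d : ℝ) + 1 ≤ K := by
    have := slopeBound_nonneg d
    rw [hK, defectLipschitz]
    nlinarith [mul_nonneg (Nat.cast_nonneg (α := ℝ) d) this]
  have hK0 : 0 < K := lt_of_lt_of_le (by positivity) hdK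
  have hεK : ε ≤ 2 * K := by
    by_contra! hlt
    have h1 := setIntegral_sq_le_of_isBestAffineApprox hs.le hF hL
    have h2 := sq_mul_pow_le_setIntegral hcont hs.le (m := K * s) (by positivity) subset_rfl
      fun x hx => by
        have := abs_sub_sub_le_of_isBestAffineApprox hs hF hL hy hx hs.le
          (abs_sub_le_of_mem_closedBox hy hx)
        have h3 := abs_sub_abs_le_abs_sub (F y - L y) (F x - L x)
        nlinarith
    have h3 := le_of_mul_le_mul_right (h2.trans h1) (by positivity)
    have h4 := abs_le_of_sq_le_sq h3 (by positivity)
    nlinarith [(abs_le.1 h4).2]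
  set r := ε * s / (2 * K) with hr
  have hr0 : 0 ≤ r := by positivity
  have hrs : r ≤ s := by
    rw [hr, div_le_iff₀ (by positivity)]
    nlinarith
  have hsub : closedBox (fun i => min (y i) (c i + s - r)) r ⊆ closedBox c s := fun x hx i => by
    have h1 := hx i
    have h2 := hy i
    refine ⟨(le_min h2.1 (by linarith)).trans h1.1, h1.2.trans ?_⟩
    linarith [min_le_right (y i) (c i + s - r)]
  have hyq : y ∈ closedBox (fun i => min (y i) (c i + s - r)) r := fun i => by
    refine ⟨min_le_left _ _, ?_⟩
    rcases min_choice (y i) (c i + s - r) with h | h <;> simp only [h]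
    · linarith
    · linarith [(hy i).2]
  have := sq_mul_pow_le_setIntegral hcont hr0 (m := ε * s / 2) (by positivity) hsub fun x hx => by
    have h1 := abs_sub_sub_le_of_isBestAffineApprox hs hF hL hy (hsub hx) hr0
      (abs_sub_le_of_mem_closedBox hyq hx)
    have h2 := abs_sub_abs_le_abs_sub (F y - L y) (F x - L x)
    have h3 : K * r = ε * s / 2 := by
      rw [hr]
      field_simp
    linarith
  refine le_of_eq_of_le ?_ this
  rw [hr, div_pow, div_pow, mul_pow, mul_pow]
  field_simp
  ring

end BestApproximation

section LevelEnergy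

variable {d : ℕ}

theorem measurableSet_centeredBox (r : ℝ) : MeasurableSet (centeredBox d r) := by
  rw [centeredBox_eq_closedBox]
  exact (isClosed_closedBox _ _).measurableSet

theorem volume_centeredBox_one : volume (centeredBox d 1) = 2 ^ d := by
  rw [centeredBox_eq_closedBox, volume_closedBox _ (by norm_num), mul_one,
    ENNReal.ofReal_pow (by norm_num), ENNReal.ofReal_ofNat]

theorem continuous_uncurry_affineDefect {G : EuclideanSpace ℝ (Fin d) → ℝ} (hG : Continuous G)
    (a : ℝ) : Continuous fun q : EuclideanSpace ℝ (Fin d) × EuclideanSpace ℝ (Fin d) =>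
      affineDefect G a q.2 q.1 := by
  unfold affineDefect
  fun_prop

theorem measurable_uncurry_affineDefect_sq {G : EuclideanSpace ℝ (Fin d) → ℝ} (hG : Continuous G)
    (a : ℝ) : Measurable (Function.uncurry fun x τ : EuclideanSpace ℝ (Fin d) =>
      ENNReal.ofReal (affineDefect G a τ x ^ 2)) :=
  ((continuous_uncurry_affineDefect hG a).pow 2).measurable.ennreal_ofReal

variable {F G L : EuclideanSpace ℝ (Fin d) → ℝ} {c : Fin d → ℝ} {a c₀ : ℝ}

theorem ofReal_setIntegral_sq_le_of_mem (ha : 0 < a) (hF : ContinuousOn F (closedBox c a))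
    (hGF : ∀ x ∈ closedBox c a, F x = G x + c₀) (hL : IsBestAffineApprox F (closedBox c a) L)
    {x : EuclideanSpace ℝ (Fin d)} (hx : x ∈ closedBox c a) :
    ENNReal.ofReal (∫ y in closedBox c a, (F y - L y) ^ 2)
      ≤ ∫⁻ t in centeredBox d a, ENNReal.ofReal (affineDefect G a (a⁻¹ • t) x ^ 2) := by
  set L' : EuclideanSpace ℝ (Fin d) → ℝ := fun y =>
    (∑ i, (a⁻¹ * (G (x + a • EuclideanSpace.single i 1) - G x)) * y i)
      + (c₀ + G x - ∑ i, a⁻¹ * (G (x + a • EuclideanSpace.single i 1) - G x) * x i) with hL'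
  have hL'a : IsAffineFn L' := ⟨_, _, rfl⟩
  have heq : ∀ y ∈ closedBox c a, F y - L' y = affineDefect G a (a⁻¹ • (y + -x)) x := fun y hy => by
    rw [hGF y hy, affineDefect, smul_inv_smul₀ ha.ne', add_comm y, add_neg_cancel_left, hL']
    have h1 : ∑ i, (a⁻¹ • (-x + y)) i * (G (x + a • EuclideanSpace.single i 1) - G x)
        = (∑ i, (a⁻¹ * (G (x + a • EuclideanSpace.single i 1) - G x)) * y i)
          - ∑ i, a⁻¹ * (G (x + a • EuclideanSpace.single i 1) - G x) * x i := by
      rw [← Finset.sum_sub_distrib]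
      refine Finset.sum_congr rfl fun i _ => ?_
      simp only [PiLp.smul_apply, PiLp.add_apply, PiLp.neg_apply, smul_eq_mul]
      ring
    rw [h1]
    ring
  have hmeas : MeasurableSet (closedBox c a) := (isClosed_closedBox c a).measurableSet
  calc _ ≤ ENNReal.ofReal (∫ y in closedBox c a, (F y - L' y) ^ 2) :=
        ENNReal.ofReal_le_ofReal (hL.2 L' hL'a)
    _ = ∫⁻ y in closedBox c a, ENNReal.ofReal ((F y - L' y) ^ 2) :=
        ofReal_setIntegral_sq (isCompact_closedBox c a)
          (hF.sub hL'a.continuous.continuousOn)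
    _ = ∫⁻ y in closedBox c a, ENNReal.ofReal (affineDefect G a (a⁻¹ • (y + -x)) x ^ 2) :=
        setLIntegral_congr_fun hmeas fun y hy => by rw [heq y hy]
    _ ≤ _ := setLIntegral_comp_add_le
        (f := fun t => ENNReal.ofReal (affineDefect G a (a⁻¹ • t) x ^ 2)) hmeas
        (measurableSet_centeredBox a) fun y hy i => by
          simpa [sub_eq_add_neg] using abs_sub_le_of_mem_closedBox hy hx i

theorem ofReal_mul_setIntegral_sq_le (ha : 0 < a) (hF : ContinuousOn F (closedBox c a))
    (hG : Continuous G)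
    (hGF : ∀ x ∈ closedBox c a, F x = G x + c₀) (hL : IsBestAffineApprox F (closedBox c a) L) :
    ENNReal.ofReal (∫ y in closedBox c a, (F y - L y) ^ 2)
      ≤ ∫⁻ x in halfOpenBox c a, ∫⁻ τ in centeredBox d 1,
          ENNReal.ofReal (affineDefect G a τ x ^ 2) := by
  have hpos : ENNReal.ofReal (a ^ d) ≠ 0 := by simpa using pow_pos ha d
  have hmeas : ∀ x, Measurable fun τ => ENNReal.ofReal (affineDefect G a τ x ^ 2) := fun x =>
    (measurable_uncurry_affineDefect_sq hG a).of_uncurry_left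
  rw [← ENNReal.mul_le_mul_iff_right hpos ENNReal.ofReal_ne_top, mul_comm,
    ← volume_halfOpenBox c ha.le, ← setLIntegral_const, volume_halfOpenBox c ha.le,
    ← lintegral_const_mul' _ _ ENNReal.ofReal_ne_top]
  refine setLIntegral_mono' (measurableSet_halfOpenBox c a) fun x hx => ?_
  rw [← setLIntegral_centeredBox_smul (hmeas x) ha]
  exact ofReal_setIntegral_sq_le_of_mem ha hF hGF hL fun i => ⟨(hx i).1, (hx i).2.le⟩

theorem sum_ofReal_setIntegral_sq_le {ι : Type*} (S : Finset ι) {c : ι → Fin d → ℝ}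
    {L : ι → EuclideanSpace ℝ (Fin d) → ℝ} (ha : 0 < a)
    (hS : (S : Set ι).PairwiseDisjoint fun p => halfOpenBox (c p) a)
    (hF : ∀ p ∈ S, ContinuousOn F (closedBox (c p) a)) (hG : Continuous G)
    (hGF : ∀ p ∈ S, ∀ x ∈ closedBox (c p) a, F x = G x + c₀)
    (hL : ∀ p ∈ S, IsBestAffineApprox F (closedBox (c p) a) (L p)) :
    ∑ p ∈ S, ENNReal.ofReal (∫ y in closedBox (c p) a, (F y - L p y) ^ 2)
      ≤ ∫⁻ τ in centeredBox d 1, affineDefectEnergy G a τ := by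
  calc _ ≤ ∑ p ∈ S, ∫⁻ x in halfOpenBox (c p) a, ∫⁻ τ in centeredBox d 1,
          ENNReal.ofReal (affineDefect G a τ x ^ 2) :=
        Finset.sum_le_sum fun p hp =>
          ofReal_mul_setIntegral_sq_le ha (hF p hp) hG (hGF p hp) (hL p hp)
    _ = ∫⁻ x in ⋃ p ∈ S, halfOpenBox (c p) a, ∫⁻ τ in centeredBox d 1,
          ENNReal.ofReal (affineDefect G a τ x ^ 2) :=
        (lintegral_biUnion_finset hS (fun p _ => measurableSet_halfOpenBox _ _) _).symm
    _ ≤ ∫⁻ x, ∫⁻ τ in centeredBox d 1, ENNReal.ofReal (affineDefect G a τ x ^ 2) :=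
        setLIntegral_le_lintegral _ _
    _ = _ := lintegral_lintegral_swap (measurable_uncurry_affineDefect_sq hG a).aemeasurable

/-- A bound, depending only on the dimension, for the multiscale energy of 1-Lipschitz functions on
the unit cube. -/
def energyBound (d : ℕ) : ENNReal :=
  18 * d ^ 2 * (4 * (ENNReal.ofReal ((2 * (d + 1)) ^ 2) *
    volume (Metric.closedBall (0 : EuclideanSpace ℝ (Fin d)) (2 * d + 2 * (d + 1))))) * 2 ^ d

theorem energyBound_ne_top (d : ℕ) : energyBound d ≠ ⊤ := by
  have : volume (Metric.closedBall (0 : EuclideanSpace ℝ (Fin d)) (2 * d + 2 * (d + 1))) ≠ ⊤ :=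
    measure_closedBall_lt_top.ne
  unfold energyBound
  finiteness

theorem sum_setLIntegral_affineDefectEnergy_le (hG : LipschitzWith 1 G)
    (hR : ∀ x, 2 * d < ‖x‖ → G x = 0) (N : ℕ) :
    ∑ j ∈ Finset.range N, 4 ^ j * ∫⁻ τ in centeredBox d 1, affineDefectEnergy G ((1 / 2) ^ j) τ
      ≤ energyBound d := by
  have hmeas : ∀ b, Measurable (affineDefectEnergy G b) := fun b =>
    (measurable_uncurry_affineDefect_sq hG.continuous b).lintegral_prod_left
  calc _ = ∫⁻ τ in centeredBox d 1,
        ∑ j ∈ Finset.range N, 4 ^ j * affineDefectEnergy G ((1 / 2) ^ j) τ := by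
        rw [lintegral_finsetSum _ fun j _ => (hmeas _).const_mul _]
        exact Finset.sum_congr rfl fun j _ => (lintegral_const_mul _ (hmeas _)).symm
    _ ≤ ∫⁻ τ in centeredBox d 1, _ := setLIntegral_mono' (measurableSet_centeredBox 1) fun τ hτ =>
        sum_affineDefectEnergy_le hG hR hτ N
    _ = _ := by rw [setLIntegral_const, volume_centeredBox_one, energyBound]

theorem exists_lipschitz_extension_of_unitCube (hF : LipschitzOnWith 1 F (unitCube d)) :
    ∃ (G : EuclideanSpace ℝ (Fin d) → ℝ) (c₀ : ℝ), LipschitzWith 1 G ∧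
      (∀ x, 2 * d < ‖x‖ → G x = 0) ∧ ∀ x ∈ unitCube d, F x = G x + c₀ := by
  obtain ⟨g, hg, hgF⟩ := hF.extend_real
  have hφ : LipschitzWith 1 fun x : EuclideanSpace ℝ (Fin d) => max 0 (2 * d - ‖x‖) := by
    refine LipschitzWith.const_max (LipschitzWith.of_dist_le_mul fun x y => ?_) _
    simpa [Real.dist_eq, dist_eq_norm, abs_sub_comm] using abs_norm_sub_norm_le x y
  have hg0 : LipschitzWith 1 fun x => g x - g 0 := by
    refine LipschitzWith.of_dist_le_mul fun x y => ?_
    simpa using hg.dist_le_mul x y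
  refine ⟨fun x => max (min (g x - g 0) (max 0 (2 * d - ‖x‖))) (-max 0 (2 * d - ‖x‖)), g 0, ?_,
    fun x hx => ?_, fun x hx => ?_⟩
  · simpa using (hg0.min hφ).max hφ.neg
  · beta_reduce
    rw [max_eq_left (by linarith : 2 * (d : ℝ) - ‖x‖ ≤ 0)]
    simp
  · have hx1 : ‖x‖ ≤ d := by
      simpa using norm_le_of_forall_abs_le zero_le_one fun i =>
        abs_le.2 ⟨by linarith [(hx i).1], (hx i).2⟩
    have hx2 : |g x - g 0| ≤ ‖x‖ := by simpa [Real.dist_eq, dist_eq_norm] using hg.dist_le_mul x 0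
    have hx3 : |g x - g 0| ≤ max 0 (2 * d - ‖x‖) := le_max_of_le_right (by linarith)
    beta_reduce
    rw [min_eq_left (abs_le.1 hx3).2, max_eq_left (abs_le.1 hx3).1, sub_add_cancel]
    exact hgF hx

end LevelEnergy

section StoppingCubes

variable {d : ℕ}

/-- The dyadic cube of level `m` containing the dyadic cube with index `p`, for `m ≤ p.1`. -/
def dyadicAncestor (p : ℕ × (Fin d → ℤ)) (m : ℕ) : ℕ × (Fin d → ℤ) :=
  (m, fun i => p.2 i / 2 ^ (p.1 - m))

/-- The corners of the dyadic subcubes of the unit cube of level `j`. -/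
def dyadicCorners (d j : ℕ) : Finset (Fin d → ℤ) :=
  Fintype.piFinset fun _ => Finset.Ico 0 (2 ^ j)

theorem mem_dyadicCorners {j : ℕ} {c : Fin d → ℤ} :
    c ∈ dyadicCorners d j ↔ ∀ i, 0 ≤ c i ∧ c i < 2 ^ j := by
  simp [dyadicCorners]

@[simp]
theorem dyadicAncestor_self (p : ℕ × (Fin d → ℤ)) : dyadicAncestor p p.1 = p := by
  simp [dyadicAncestor]

theorem dyadicAncestor_dyadicAncestor (p : ℕ × (Fin d → ℤ)) {m n : ℕ} (hmn : m ≤ n)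
    (hn : n ≤ p.1) : dyadicAncestor (dyadicAncestor p n) m = dyadicAncestor p m := by
  refine Prod.ext rfl (funext fun i => ?_)
  simp only [dyadicAncestor]
  rw [Int.ediv_ediv_of_nonneg (by positivity), ← pow_add]
  congr 2
  omega

theorem dyadicAncestor_mem_dyadicCorners {p : ℕ × (Fin d → ℤ)} (hp : p.2 ∈ dyadicCorners d p.1)
    {m : ℕ} (hm : m ≤ p.1) : (dyadicAncestor p m).2 ∈ dyadicCorners d m := by
  rw [mem_dyadicCorners] at hp ⊢
  refine fun i => ⟨Int.ediv_nonneg (hp i).1 (by positivity),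
    Int.ediv_lt_of_lt_mul (by positivity) ?_⟩
  rw [← pow_add, Nat.add_sub_cancel' hm]
  exact (hp i).2

theorem dyadicCube_subset_dyadicAncestor (p : ℕ × (Fin d → ℤ)) {m : ℕ} (hm : m ≤ p.1) :
    dyadicCube d p ⊆ dyadicCube d (dyadicAncestor p m) := by
  intro x hx i
  have hpow : (2 : ℝ) ^ p.1 = 2 ^ m * 2 ^ (p.1 - m) := by rw [← pow_add, Nat.add_sub_cancel' hm]
  have h1 : p.2 i / 2 ^ (p.1 - m) * 2 ^ (p.1 - m) ≤ p.2 i :=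
    Int.ediv_mul_le _ (by positivity)
  have h2 : p.2 i + 1 ≤ (p.2 i / 2 ^ (p.1 - m) + 1) * 2 ^ (p.1 - m) :=
    Int.lt_ediv_add_one_mul_self _ (by positivity)
  have h1' : ((p.2 i / 2 ^ (p.1 - m) : ℤ) : ℝ) * 2 ^ (p.1 - m) ≤ p.2 i := by exact_mod_cast h1
  have h2' : (p.2 i : ℝ) + 1 ≤ (((p.2 i / 2 ^ (p.1 - m) : ℤ) : ℝ) + 1) * 2 ^ (p.1 - m) := by
    exact_mod_cast h2
  have hx1 := (hx i).1
  have hx2 := (hx i).2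
  rw [hpow] at hx1 hx2
  constructor
  · refine le_trans ?_ hx1
    rw [dyadicAncestor, div_le_div_iff₀ (by positivity) (by positivity)]
    nlinarith [mul_le_mul_of_nonneg_right h1' (by positivity : (0 : ℝ) ≤ 2 ^ m)]
  · refine hx2.trans ?_
    rw [dyadicAncestor, div_le_div_iff₀ (by positivity) (by positivity)]
    nlinarith [mul_le_mul_of_nonneg_right h2' (by positivity : (0 : ℝ) ≤ 2 ^ m)]

theorem dyadicCube_subset_unitCube {p : ℕ × (Fin d → ℤ)} (hp : p.2 ∈ dyadicCorners d p.1) :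
    dyadicCube d p ⊆ unitCube d := by
  rw [mem_dyadicCorners] at hp
  intro x hx i
  have h1 : (0 : ℝ) ≤ p.2 i := by exact_mod_cast (hp i).1
  have h2 : (p.2 i : ℝ) + 1 ≤ 2 ^ p.1 := by exact_mod_cast (hp i).2
  exact ⟨(by positivity : (0 : ℝ) ≤ p.2 i / 2 ^ p.1).trans (hx i).1,
    (hx i).2.trans ((div_le_one₀ (by positivity)).2 h2)⟩

theorem lt_of_mem_interior_dyadicCube {p : ℕ × (Fin d → ℤ)} {x : EuclideanSpace ℝ (Fin d)}
    (hx : x ∈ interior (dyadicCube d p)) (i : Fin d) :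
    (p.2 i : ℝ) < x i * 2 ^ p.1 ∧ x i * 2 ^ p.1 < p.2 i + 1 := by
  have hpre : dyadicCube d p = (EuclideanSpace.equiv (Fin d) ℝ).toHomeomorph ⁻¹'
      Set.pi Set.univ fun i => Set.Icc ((p.2 i : ℝ) / 2 ^ p.1) (((p.2 i : ℝ) + 1) / 2 ^ p.1) := by
    ext y
    simp only [Set.mem_preimage, Set.mem_univ_pi]
    rfl
  rw [hpre, ← Homeomorph.preimage_interior, interior_pi_set Set.finite_univ] at hx
  have := hx i trivial
  beta_reduce at this
  rw [interior_Icc, Set.mem_Ioo, div_lt_iff₀ (by positivity), lt_div_iff₀ (by positivity)] at this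
  exact this

theorem eq_dyadicAncestor_of_mem_interior {p q : ℕ × (Fin d → ℤ)} (hpq : p.1 ≤ q.1)
    {x : EuclideanSpace ℝ (Fin d)} (hp : x ∈ interior (dyadicCube d p))
    (hq : x ∈ interior (dyadicCube d q)) : p = dyadicAncestor q p.1 := by
  have hq' := interior_mono (dyadicCube_subset_dyadicAncestor q hpq) hq
  refine Prod.ext rfl (funext fun i => ?_)
  have h1 := lt_of_mem_interior_dyadicCube hp i
  have h2 := lt_of_mem_interior_dyadicCube hq' i
  have h3 : p.2 i < (dyadicAncestor q p.1).2 i + 1 := by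
    refine (Int.cast_lt (R := ℝ)).1 ((h1.1.trans h2.2).trans_eq ?_)
    push_cast
    rfl
  have h4 : (dyadicAncestor q p.1).2 i < p.2 i + 1 := by
    refine (Int.cast_lt (R := ℝ)).1 ((h2.1.trans h1.2).trans_eq ?_)
    push_cast
    rfl
  omega

theorem exists_mem_dyadicCube (k : ℕ) {x : EuclideanSpace ℝ (Fin d)} (hx : x ∈ unitCube d) :
    ∃ c ∈ dyadicCorners d k, x ∈ dyadicCube d (k, c) := by
  have hk : (0 : ℝ) < 2 ^ k := by positivity
  have hk1 : (1 : ℤ) ≤ 2 ^ k := one_le_pow₀ (by norm_num)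
  refine ⟨fun i => min ⌊x i * 2 ^ k⌋ (2 ^ k - 1), mem_dyadicCorners.2 fun i => ⟨le_min
    (Int.floor_nonneg.2 (mul_nonneg (hx i).1 hk.le)) (by omega),
    (min_le_right _ _).trans_lt (by omega)⟩, fun i => ?_⟩
  rw [div_le_iff₀ hk, le_div_iff₀ hk]
  refine ⟨le_trans (Int.cast_le.2 (min_le_left _ _)) (Int.floor_le _), ?_⟩
  rcases min_choice ⌊x i * 2 ^ k⌋ (2 ^ k - 1) with h | h <;> simp only [h]
  · exact (Int.lt_floor_add_one _).le
  · push_cast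
    rw [sub_add_cancel]
    exact mul_le_of_le_one_left hk.le (hx i).2

open Classical in
/-- The maximal dyadic cubes of level at most `k` satisfying `P`. -/
def goodCubes (P : ℕ × (Fin d → ℤ) → Prop) (k : ℕ) : Finset (ℕ × (Fin d → ℤ)) :=
  {p ∈ (Finset.range (k + 1)).biUnion fun j => (dyadicCorners d j).image (Prod.mk j) |
    P p ∧ ∀ m < p.1, ¬ P (dyadicAncestor p m)}

open Classical in
/-- The dyadic cubes of level `k` not contained in a cube satisfying `P`. -/
def badCubes (P : ℕ × (Fin d → ℤ) → Prop) (k : ℕ) : Finset (ℕ × (Fin d → ℤ)) :=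
  {p ∈ (dyadicCorners d k).image (Prod.mk k) | ∀ m ≤ k, ¬ P (dyadicAncestor p m)}

variable {P : ℕ × (Fin d → ℤ) → Prop} {k : ℕ} {p q : ℕ × (Fin d → ℤ)}

theorem mem_goodCubes : p ∈ goodCubes P k ↔ p.1 ≤ k ∧ p.2 ∈ dyadicCorners d p.1 ∧ P p ∧
    ∀ m < p.1, ¬ P (dyadicAncestor p m) := by
  obtain ⟨j, c⟩ := p
  simp only [goodCubes, Finset.mem_filter, Finset.mem_biUnion, Finset.mem_range, Finset.mem_image,
    Prod.mk.injEq, Nat.lt_succ_iff]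
  constructor
  · rintro ⟨⟨_, hj, _, hc, rfl, rfl⟩, h⟩
    exact ⟨hj, hc, h⟩
  · rintro ⟨hj, hc, h⟩
    exact ⟨⟨j, hj, c, hc, rfl, rfl⟩, h⟩

theorem mem_badCubes : p ∈ badCubes P k ↔ p.1 = k ∧ p.2 ∈ dyadicCorners d k ∧
    ∀ m ≤ k, ¬ P (dyadicAncestor p m) := by
  obtain ⟨j, c⟩ := p
  simp only [badCubes, Finset.mem_filter, Finset.mem_image, Prod.mk.injEq]
  constructor
  · rintro ⟨⟨_, hc, rfl, rfl⟩, h⟩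
    exact ⟨rfl, hc, h⟩
  · rintro ⟨rfl, hc, h⟩
    exact ⟨⟨c, hc, rfl, rfl⟩, h⟩

theorem disjoint_goodCubes_badCubes (P : ℕ × (Fin d → ℤ) → Prop) (k : ℕ) :
    Disjoint (goodCubes P k) (badCubes P k) :=
  Finset.disjoint_left.2 fun p hg hb => by
    obtain ⟨rfl, -, h⟩ := mem_badCubes.1 hb
    exact h p.1 le_rfl (by simpa using (mem_goodCubes.1 hg).2.2.1)

theorem fst_le_and_mem_dyadicCorners (hp : p ∈ goodCubes P k ∪ badCubes P k) :
    p.1 ≤ k ∧ p.2 ∈ dyadicCorners d p.1 ∧ ∀ m < p.1, ¬ P (dyadicAncestor p m) := by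
  rcases Finset.mem_union.1 hp with h | h
  · obtain ⟨h1, h2, -, h3⟩ := mem_goodCubes.1 h
    exact ⟨h1, h2, h3⟩
  · obtain ⟨rfl, h2, h3⟩ := mem_badCubes.1 h
    exact ⟨le_rfl, h2, fun m hm => h3 m hm.le⟩

theorem interior_inter_interior_eq_empty_of_le (hp : p ∈ goodCubes P k ∪ badCubes P k)
    (hq : q ∈ goodCubes P k ∪ badCubes P k) (hne : p ≠ q) (hle : p.1 ≤ q.1) :
    interior (dyadicCube d p) ∩ interior (dyadicCube d q) = ∅ := by
  refine Set.eq_empty_of_forall_notMem fun x hx => ?_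
  have h := eq_dyadicAncestor_of_mem_interior hle hx.1 hx.2
  obtain ⟨hqk, -, hqP⟩ := fst_le_and_mem_dyadicCorners hq
  rcases hle.lt_or_eq with hlt | heq
  · rcases Finset.mem_union.1 hp with hp | hp
    · exact hqP p.1 hlt (h ▸ (mem_goodCubes.1 hp).2.2.1)
    · have := (mem_badCubes.1 hp).1
      omega
  · rw [heq, dyadicAncestor_self] at h
    exact hne h

theorem interior_inter_interior_eq_empty (hp : p ∈ goodCubes P k ∪ badCubes P k)
    (hq : q ∈ goodCubes P k ∪ badCubes P k) (hne : p ≠ q) :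
    interior (dyadicCube d p) ∩ interior (dyadicCube d q) = ∅ := by
  rcases le_total p.1 q.1 with h | h
  · exact interior_inter_interior_eq_empty_of_le hp hq hne h
  · rw [Set.inter_comm]
    exact interior_inter_interior_eq_empty_of_le hq hp hne.symm h

theorem iUnion_goodCubes_union_badCubes (P : ℕ × (Fin d → ℤ) → Prop) (k : ℕ) :
    ⋃ p ∈ goodCubes P k ∪ badCubes P k, dyadicCube d p = unitCube d := by
  classical
  refine (Set.iUnion₂_subset fun p hp => dyadicCube_subset_unitCube
    (fst_le_and_mem_dyadicCorners hp).2.1).antisymm fun x hx => ?_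
  obtain ⟨c, hc, hxc⟩ := exists_mem_dyadicCube k hx
  rw [Set.mem_iUnion₂]
  by_cases h : ∃ m, m ≤ k ∧ P (dyadicAncestor (k, c) m)
  · have hm := Nat.find_spec h
    refine ⟨dyadicAncestor (k, c) (Nat.find h), Finset.mem_union_left _ (mem_goodCubes.2
      ⟨hm.1, dyadicAncestor_mem_dyadicCorners (p := (k, c)) hc hm.1, hm.2, fun m hlt hP => ?_⟩),
      dyadicCube_subset_dyadicAncestor (k, c) hm.1 hxc⟩
    replace hlt : m < Nat.find h := hlt
    rw [dyadicAncestor_dyadicAncestor (k, c) hlt.le hm.1] at hP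
    exact Nat.find_min h hlt ⟨hlt.le.trans hm.1, hP⟩
  · push Not at h
    exact ⟨(k, c), Finset.mem_union_right _ (mem_badCubes.2 ⟨rfl, hc, h⟩), hxc⟩

theorem volume_dyadicCube_toReal (p : ℕ × (Fin d → ℤ)) :
    (volume (dyadicCube d p)).toReal = ((1 / 2) ^ p.1) ^ d := by
  rw [dyadicCube_eq_closedBox, volume_closedBox _ (by positivity),
    ENNReal.toReal_ofReal (by positivity)]

theorem sum_volume_badCubes (P : ℕ × (Fin d → ℤ) → Prop) (k : ℕ) :
    ∑ p ∈ badCubes P k, (volume (dyadicCube d p)).toReal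
      = (badCubes P k).card * ((1 / 2) ^ k) ^ d := by
  rw [← nsmul_eq_mul]
  refine Finset.sum_eq_card_nsmul fun p hp => ?_
  rw [volume_dyadicCube_toReal, (mem_badCubes.1 hp).1]

open Classical in
theorem card_badCubes_le {j : ℕ} (hj : j ≤ k) : (badCubes P k).card
    ≤ (2 ^ (k - j)) ^ d * ((dyadicCorners d j).filter fun c => ¬ P (j, c)).card := by
  have hmaps : ∀ p ∈ badCubes P k,
      (dyadicAncestor p j).2 ∈ (dyadicCorners d j).filter fun c => ¬ P (j, c) := fun p hp => by
    obtain ⟨rfl, hc, h⟩ := mem_badCubes.1 hp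
    exact Finset.mem_filter.2 ⟨dyadicAncestor_mem_dyadicCorners hc hj, h j hj⟩
  refine Finset.card_le_mul_card_image_of_maps_to hmaps _ fun b _ => ?_
  have hsub : (badCubes P k).filter (fun p => (dyadicAncestor p j).2 = b)
      ⊆ (Fintype.piFinset fun i : Fin d =>
          Finset.Ico (b i * 2 ^ (k - j)) (b i * 2 ^ (k - j) + 2 ^ (k - j))).image (Prod.mk k) := by
    rintro ⟨m, c⟩ hp
    obtain ⟨hp, hb⟩ := Finset.mem_filter.1 hp
    obtain rfl : m = k := (mem_badCubes.1 hp).1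
    refine Finset.mem_image_of_mem _ (Fintype.mem_piFinset.2 fun i => ?_)
    have hbi : c i / 2 ^ (m - j) = b i := congrFun hb i
    have hpos : (0 : ℤ) < 2 ^ (m - j) := by positivity
    rw [Finset.mem_Ico, ← hbi, ← add_one_mul]
    exact ⟨Int.ediv_mul_le _ hpos.ne', Int.lt_ediv_add_one_mul_self _ hpos⟩
  refine ((Finset.card_le_card hsub).trans Finset.card_image_le).trans_eq ?_
  have hcast : ((2 : ℤ) ^ (k - j)).toNat = 2 ^ (k - j) := by
    rw [Int.toNat_pow_of_nonneg (by norm_num)]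
    rfl
  simp only [Fintype.card_piFinset, Int.card_Ico, add_sub_cancel_left, Finset.prod_const,
    Finset.card_univ, Fintype.card_fin, hcast]

open Classical in
theorem sum_volume_badCubes_le {j : ℕ} (hj : j ≤ k) :
    ∑ p ∈ badCubes P k, (volume (dyadicCube d p)).toReal
      ≤ ((dyadicCorners d j).filter fun c => ¬ P (j, c)).card * ((1 / 2) ^ j) ^ d := by
  have h : ((badCubes P k).card : ℝ)
      ≤ (2 ^ (k - j)) ^ d * ((dyadicCorners d j).filter fun c => ¬ P (j, c)).card := by
    exact_mod_cast card_badCubes_le hj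
  rw [sum_volume_badCubes]
  refine (mul_le_mul_of_nonneg_right h (by positivity)).trans_eq ?_
  have h2 : (1 / 2 : ℝ) ^ k = (1 / 2) ^ (k - j) * (1 / 2) ^ j := by
    rw [← pow_add, Nat.sub_add_cancel hj]
  rw [h2, mul_pow, mul_comm ((2 ^ (k - j) : ℝ) ^ d), mul_assoc, ← mul_assoc ((2 ^ (k - j) : ℝ) ^ d),
    ← mul_pow, ← mul_pow]
  have h3 : (2 : ℝ) ^ (k - j) * (1 / 2) ^ (k - j) = 1 := by
    rw [← mul_pow]
    norm_num
  rw [h3, one_mul]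

end StoppingCubes

section BadVolume

variable {d : ℕ}

/-- On the dyadic cube with index `p`, `F` stays within `ε` times the sidelength of its best affine
approximation. -/
def IsGoodCube (F : EuclideanSpace ℝ (Fin d) → ℝ) (ε : ℝ) (p : ℕ × (Fin d → ℤ)) : Prop :=
  ∀ L, IsBestAffineApprox F (dyadicCube d p) L →
    ∀ x ∈ dyadicCube d p, |F x - L x| ≤ ε * ((1 : ℝ) / 2 ^ p.1)

theorem disjoint_halfOpenBox (j : ℕ) {c c' : Fin d → ℤ} (hne : c ≠ c') :
    Disjoint (halfOpenBox (fun i => (c i : ℝ) / 2 ^ j) ((1 / 2) ^ j))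
      (halfOpenBox (fun i => (c' i : ℝ) / 2 ^ j) ((1 / 2) ^ j)) := by
  have key : ∀ (e : Fin d → ℤ) (x : EuclideanSpace ℝ (Fin d)),
      x ∈ halfOpenBox (fun i => (e i : ℝ) / 2 ^ j) ((1 / 2) ^ j) → ∀ i, ⌊x i * 2 ^ j⌋ = e i := by
    intro e x hx i
    have hi := hx i
    rw [one_div_pow, ← add_div, div_le_iff₀ (by positivity), lt_div_iff₀ (by positivity)] at hi
    exact Int.floor_eq_iff.2 hi
  exact Set.disjoint_left.2 fun x hx hx' => hne (funext fun i => (key c x hx i).symm.trans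
    (key c' x hx' i))

variable {F G : EuclideanSpace ℝ (Fin d) → ℝ} {ε c₀ : ℝ}

theorem defectLipschitz_pos (d : ℕ) : 0 < defectLipschitz d := by
  have := slopeBound_nonneg d
  unfold defectLipschitz
  positivity

open Classical in
theorem ofReal_card_mul_le (hε : 0 < ε) (hF : LipschitzOnWith 1 F (unitCube d))
    (hG : Continuous G) (hGF : ∀ x ∈ unitCube d, F x = G x + c₀) (j : ℕ) :
    ENNReal.ofReal (((dyadicCorners d j).filter fun c => ¬ IsGoodCube F ε (j, c)).card *
        (ε ^ (d + 2) * (((1 / 2) ^ j) ^ 2 * ((1 / 2) ^ j) ^ d) /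
          (4 * (2 * defectLipschitz d) ^ d)))
      ≤ ∫⁻ τ in centeredBox d 1, affineDefectEnergy G ((1 / 2) ^ j) τ := by
  set S := (dyadicCorners d j).filter fun c => ¬ IsGoodCube F ε (j, c) with hS
  set box : (Fin d → ℤ) → Set (EuclideanSpace ℝ (Fin d)) := fun c =>
    closedBox (fun i => (c i : ℝ) / 2 ^ j) ((1 / 2) ^ j) with hbox
  have hsub : ∀ c ∈ S, box c ⊆ unitCube d := fun c hc => by
    refine (dyadicCube_eq_closedBox (j, c)).symm.subset.trans ?_
    exact dyadicCube_subset_unitCube (Finset.mem_filter.1 hc).1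
  have hbad : ∀ c ∈ S, ∃ L, IsBestAffineApprox F (box c) L ∧
      ∃ x ∈ box c, ε * (1 / 2) ^ j < |F x - L x| := fun c hc => by
    have h := (Finset.mem_filter.1 hc).2
    unfold IsGoodCube at h
    push Not at h
    simpa only [hbox, dyadicCube_eq_closedBox, one_div_pow, exists_prop] using h
  choose! L hL y hy hlt using hbad
  have ha : (0 : ℝ) < (1 / 2) ^ j := by positivity
  refine le_trans ?_ (sum_ofReal_setIntegral_sq_le S ha
    (fun c _ c' _ hne => disjoint_halfOpenBox j hne)
    (fun c hc => hF.continuousOn.mono (hsub c hc)) hG (fun c hc x hx => hGF x (hsub c hc hx)) hL)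
  rw [ENNReal.ofReal_mul (by positivity), ENNReal.ofReal_natCast, ← nsmul_eq_mul]
  exact Finset.card_nsmul_le_sum _ _ _ fun c hc => ENNReal.ofReal_le_ofReal
    (le_setIntegral_sq_of_isBestAffineApprox ha (hF.mono (hsub c hc)) (hL c hc) hε (hy c hc)
      (hlt c hc))

theorem mul_sum_volume_badCubes_le (hε : 0 < ε) (hF : LipschitzOnWith 1 F (unitCube d)) (k : ℕ) :
    k * ((∑ p ∈ badCubes (IsGoodCube F ε) k, (volume (dyadicCube d p)).toReal) *
        (ε ^ (d + 2) / (4 * (2 * defectLipschitz d) ^ d))) ≤ (energyBound d).toReal := by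
  classical
  obtain ⟨G, c₀, hG, hR, hGF⟩ := exists_lipschitz_extension_of_unitCube hF
  set V := ∑ p ∈ badCubes (IsGoodCube F ε) k, (volume (dyadicCube d p)).toReal
  have hK := defectLipschitz_pos d
  set κ := ε ^ (d + 2) / (4 * (2 * defectLipschitz d) ^ d) with hκ
  have hκ0 : 0 < κ := by positivity
  have hlevel : ∀ j ∈ Finset.range k, ENNReal.ofReal (V * κ)
      ≤ 4 ^ j * ∫⁻ τ in centeredBox d 1, affineDefectEnergy G ((1 / 2) ^ j) τ := fun j hj => by
    refine le_trans ?_ (mul_le_mul_right (ofReal_card_mul_le hε hF hG.continuous hGF j) _)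
    rw [← ENNReal.ofReal_ofNat 4, ← ENNReal.ofReal_pow (by norm_num),
      ← ENNReal.ofReal_mul (by positivity)]
    refine ENNReal.ofReal_le_ofReal ((mul_le_mul_of_nonneg_right (sum_volume_badCubes_le
      (Finset.mem_range.1 hj).le) hκ0.le).trans_eq ?_)
    have h4 : (4 : ℝ) ^ j * ((1 / 2) ^ j) ^ 2 = 1 := by
      rw [← pow_mul, mul_comm j 2, pow_mul, ← mul_pow]
      norm_num
    rw [hκ]
    linear_combination (-(((dyadicCorners d j).filter fun c => ¬ IsGoodCube F ε (j, c)).card *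
      ((1 / 2 : ℝ) ^ j) ^ d * (ε ^ (d + 2) / (4 * (2 * defectLipschitz d) ^ d)))) * h4
  have hsum := (Finset.card_nsmul_le_sum _ _ _ hlevel).trans
    (sum_setLIntegral_affineDefectEnergy_le hG hR k)
  rw [Finset.card_range, nsmul_eq_mul, ← ENNReal.ofReal_natCast,
    ← ENNReal.ofReal_mul (Nat.cast_nonneg k)] at hsum
  exact (ENNReal.ofReal_le_iff_le_toReal (energyBound_ne_top d)).1 hsum

end BadVolume

/-- Fefferman's quantitative differentiation.  There is a constant `C♯`
depending only on `d` such that whenever `ε, η > 0`, `k ≥ 1` and `ε^{d+2} η k ≥ C♯`, and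
`F : Q° → ℝ` has Lipschitz constant at most `1`, the unit cube can be decomposed into finitely
many dyadic GOOD and BAD cubes with pairwise disjoint interiors covering `Q°` such that: GOOD
cubes have sidelength `≥ 2^{-k}` and satisfy `|F − L_Q| ≤ ε δ_Q` on `Q`; BAD cubes have
sidelength exactly `2^{-k}` and total volume at most `η`. -/
theorem cz_decomposition (d : ℕ) :
    ∃ Csharp : ℝ, 0 < Csharp ∧
      ∀ (ε η : ℝ) (k : ℕ) (F : EuclideanSpace ℝ (Fin d) → ℝ),
        0 < ε → 0 < η → 1 ≤ k →
        Csharp ≤ ε ^ (d + 2) * η * k →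
        LipschitzOnWith 1 F (unitCube d) →
        ∃ good bad : Finset (ℕ × (Fin d → ℤ)),
          Disjoint good bad ∧
          (∀ p ∈ good ∪ bad, dyadicCube d p ⊆ unitCube d) ∧
          (⋃ p ∈ (good ∪ bad : Finset (ℕ × (Fin d → ℤ))), dyadicCube d p) = unitCube d ∧
          (∀ p ∈ good ∪ bad, ∀ q ∈ good ∪ bad, p ≠ q →
            interior (dyadicCube d p) ∩ interior (dyadicCube d q) = ∅) ∧
          (∀ p ∈ good,
            ((1 : ℝ) / 2 ^ k ≤ (1 : ℝ) / 2 ^ p.1) ∧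
            ∀ L, IsBestAffineApprox F (dyadicCube d p) L →
              ∀ x ∈ dyadicCube d p, |F x - L x| ≤ ε * ((1 : ℝ) / 2 ^ p.1)) ∧
          (∀ p ∈ bad, p.1 = k) ∧
          (∑ p ∈ bad, (volume (dyadicCube d p)).toReal) ≤ η := by
  have hK := defectLipschitz_pos d
  set K := 4 * (2 * defectLipschitz d) ^ d with hKdef
  have hK0 : 0 < K := by positivity
  refine ⟨(energyBound d).toReal * K + 1, by positivity, fun ε η k F hε hη hk hC hF => ?_⟩
  refine ⟨goodCubes (IsGoodCube F ε) k, badCubes (IsGoodCube F ε) k,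
    disjoint_goodCubes_badCubes _ _, fun p hp => dyadicCube_subset_unitCube
      (fst_le_and_mem_dyadicCorners hp).2.1, iUnion_goodCubes_union_badCubes _ _,
    fun p hp q hq hne => interior_inter_interior_eq_empty hp hq hne, fun p hp => ?_,
    fun p hp => (mem_badCubes.1 hp).1, ?_⟩
  · obtain ⟨hpk, -, hpP, -⟩ := mem_goodCubes.1 hp
    exact ⟨one_div_le_one_div_of_le (by positivity) (pow_le_pow_right₀ one_le_two hpk), hpP⟩
  · have h := mul_sum_volume_badCubes_le hε hF k
    set V := ∑ p ∈ badCubes (IsGoodCube F ε) k, (volume (dyadicCube d p)).toReal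
    have hk0 : (0 : ℝ) < k := by exact_mod_cast hk
    have h2 : V * (ε ^ (d + 2) * k) ≤ (energyBound d).toReal * K := by
      rw [← hKdef, mul_div_assoc', mul_div_assoc', div_le_iff₀ hK0] at h
      linarith
    refine le_of_mul_le_mul_right ?_ (by positivity : 0 < ε ^ (d + 2) * (k : ℝ))
    linarith
end
end

section
/- There exists a constant C depending only on the dimension d such that for every function F : Q° → ℝ with Lipschitz constant at most 1, one has ∑_Q δ_Q^{−2} ∫_Q |F(x) − L_Q(x)|² dx ≤ C, where the sum ranges over all dyadic subcubes Q of Q° (of all scales 2^{−j}, j ≥ 0). -/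
open MeasureTheory

noncomputable section

/-- The multi-indices of the dyadic cubes of scale `k` contained in the unit cube. -/
def dyadicBox (d k : ℕ) : Finset (Fin d → ℤ) := Fintype.piFinset fun _ => Finset.Ico 0 (2 ^ k)

/-- The multi-index of the dyadic child of the cube indexed by `n` lying on the upper side exactly
in the coordinates belonging to `s`. -/
def dyadicChild {d : ℕ} (n : Fin d → ℤ) (s : Finset (Fin d)) : Fin d → ℤ :=
  fun i => 2 * n i + if i ∈ s then 1 else 0

theorem mem_dyadicBox {d k : ℕ} {n : Fin d → ℤ} :
    n ∈ dyadicBox d k ↔ ∀ i, 0 ≤ n i ∧ n i < 2 ^ k := by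
  simp [dyadicBox, Fintype.mem_piFinset]

theorem card_dyadicBox (d k : ℕ) : (dyadicBox d k).card = (2 ^ k) ^ d := by
  have h : ((2 : ℤ) ^ k).toNat = 2 ^ k := by
    rw [← Int.toNat_natCast (2 ^ k)]; simp
  simp [dyadicBox, Fintype.card_piFinset, h]

theorem sum_dyadicBox_child {d : ℕ} (k : ℕ) (φ : (Fin d → ℤ) → ℝ) :
    ∑ n ∈ dyadicBox d k, ∑ s, φ (dyadicChild n s) = ∑ m ∈ dyadicBox d (k + 1), φ m := by
  rw [← Finset.sum_product']
  refine Finset.sum_bij' (fun p _ => dyadicChild p.1 p.2)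
    (fun m _ => (fun i => m i / 2, Finset.univ.filter fun i => m i % 2 = 1)) ?_ ?_ ?_ ?_ ?_
  · rintro ⟨n, s⟩ h
    simp only [Finset.mem_product, mem_dyadicBox, Finset.mem_univ, and_true] at h ⊢
    intro i
    have := h i
    rw [pow_succ]
    simp only [dyadicChild]
    split_ifs <;> omega
  · intro m h
    simp only [Finset.mem_product, mem_dyadicBox, Finset.mem_univ, and_true] at h ⊢
    intro i
    have := h i
    rw [pow_succ] at this
    omega
  · rintro ⟨n, s⟩ h
    ext i
    · simp only [dyadicChild]
      split_ifs <;> omega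
    · rw [Finset.mem_filter_univ]
      by_cases hi : i ∈ s <;> simp [dyadicChild, hi]
  · intro m h
    ext i
    simp only [dyadicChild, Finset.mem_filter, Finset.mem_univ, true_and]
    split_ifs <;> omega
  · intros; rfl

theorem sum_dyadicBox_shift_le {d : ℕ} (k : ℕ) (i : Fin d) (φ : (Fin d → ℤ) → ℝ)
    (hφ : ∀ m, 0 ≤ φ m) (hφ' : ∀ m, 2 ^ k ≤ m i → φ m = 0) :
    ∑ m ∈ dyadicBox d k, φ (m + Pi.single i 1) ≤ ∑ m ∈ dyadicBox d k, φ m := by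
  classical
  rw [← Finset.sum_image (g := fun m : Fin d → ℤ => m + Pi.single i 1) (f := φ)
    (fun a _ b _ h => add_right_cancel h), ← Finset.sum_filter_ne_zero]
  refine Finset.sum_le_sum_of_subset_of_nonneg ?_ fun m _ _ => hφ m
  intro m hm
  obtain ⟨hm, hne⟩ := Finset.mem_filter.1 hm
  obtain ⟨n, hn, rfl⟩ := Finset.mem_image.1 hm
  rw [mem_dyadicBox] at hn ⊢
  intro j
  by_cases hj : j = i
  · subst hj
    have h1 := hn j
    have h2 : ¬ (2 ^ k ≤ (n + Pi.single j 1 : Fin d → ℤ) j) := fun h => hne (hφ' _ h)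
    simp only [Pi.add_apply, Pi.single_eq_same] at h2 ⊢
    omega
  · simpa [hj] using hn j

/-- Averages of a lattice function over dyadic blocks of `2 ^ r` points in each direction. -/
def dyadicMean {d : ℕ} (φ : (Fin d → ℤ) → ℝ) : ℕ → (Fin d → ℤ) → ℝ
  | 0 => φ
  | r + 1 => fun n => (∑ s, dyadicMean φ r (dyadicChild n s)) / 2 ^ d

/-- The difference quotient in direction `i` of a family of functions on the lattices of
mesh `2 ^ (-k)`. -/
def latticeSlope {d : ℕ} (a : ℕ → (Fin d → ℤ) → ℝ) (k : ℕ) (i : Fin d) (n : Fin d → ℤ) : ℝ :=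
  2 ^ k * (a k (n + Pi.single i 1) - a k n)

theorem dyadicChild_add_single {d : ℕ} (n : Fin d → ℤ) (i : Fin d) (s : Finset (Fin d)) :
    dyadicChild (n + Pi.single i 1) s = dyadicChild n s + Pi.single i 1 + Pi.single i 1 := by
  ext j
  by_cases hj : j = i
  · subst hj
    simp only [dyadicChild, Pi.add_apply, Pi.single_eq_same]
    ring
  · simp [dyadicChild, hj]

theorem dyadicChild_insert {d : ℕ} (n : Fin d → ℤ) {i : Fin d} {s : Finset (Fin d)} (hi : i ∉ s) :
    dyadicChild n (insert i s) = dyadicChild n s + Pi.single i 1 := by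
  ext j
  by_cases hj : j = i
  · subst hj
    simp [dyadicChild, hi]
  · simp [dyadicChild, hj]

theorem latticeSlope_eq_mean {d : ℕ} {a : ℕ → (Fin d → ℤ) → ℝ} {k : ℕ}
    (ha : ∀ n, a k n = (∑ s, a (k + 1) (dyadicChild n s)) / 2 ^ d) (i : Fin d) (n : Fin d → ℤ) :
    latticeSlope a k i n = (∑ s, (latticeSlope a (k + 1) i (dyadicChild n s)
      + latticeSlope a (k + 1) i (dyadicChild n s + Pi.single i 1))) / (2 * 2 ^ d) := by
  have h : ∀ s, latticeSlope a (k + 1) i (dyadicChild n s)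
      + latticeSlope a (k + 1) i (dyadicChild n s + Pi.single i 1)
      = 2 ^ (k + 1) * (a (k + 1) (dyadicChild (n + Pi.single i 1) s)
        - a (k + 1) (dyadicChild n s)) := by
    intro s
    rw [dyadicChild_add_single]
    simp only [latticeSlope]
    ring
  simp only [h]
  rw [← Finset.mul_sum, Finset.sum_sub_distrib, latticeSlope, ha, ha n, pow_succ]
  field_simp

theorem sum_sub_mean_sq_le {ι : Type*} [Fintype ι] (p q : ι → ℝ) {c G : ℝ}
    (hc : (Fintype.card ι : ℝ) = c) (hc0 : c ≠ 0) (hG : G = (∑ s, (p s + q s)) / (2 * c)) :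
    ∑ s, (p s - G) ^ 2 ≤ ∑ s, (p s ^ 2 + q s ^ 2) - 2 * c * G ^ 2 := by
  have h1 : ∑ s, (p s + q s) = 2 * c * G := by rw [hG]; field_simp
  have h2 : ∑ s, ((p s - G) ^ 2 + (q s - G) ^ 2)
      = ∑ s, (p s ^ 2 + q s ^ 2) - 2 * c * G ^ 2 := by
    have : ∀ s, (p s - G) ^ 2 + (q s - G) ^ 2
        = (p s ^ 2 + q s ^ 2) - 2 * G * (p s + q s) + 2 * G ^ 2 := fun s => by ring
    simp only [this]
    rw [Finset.sum_add_distrib, Finset.sum_sub_distrib, ← Finset.mul_sum, h1]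
    simp only [Finset.sum_const, Finset.card_univ, nsmul_eq_mul, hc]
    ring
  rw [← h2]
  exact Finset.sum_le_sum fun s _ => le_add_of_nonneg_right (sq_nonneg _)

/-- The oscillation of the slopes of the children around the slope of the parent. -/
def slopeOsc {d : ℕ} (a : ℕ → (Fin d → ℤ) → ℝ) (k : ℕ) (n : Fin d → ℤ) : ℝ :=
  ∑ i, ∑ s, (latticeSlope a (k + 1) i (dyadicChild n s) - latticeSlope a k i n) ^ 2

/-- The Dirichlet energy on the unit cube of the lattice function of mesh `2 ^ (-k)`. -/
def latticeEnergy {d : ℕ} (a : ℕ → (Fin d → ℤ) → ℝ) (k : ℕ) : ℝ :=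
  ((2 : ℝ) ^ k)⁻¹ ^ d * ∑ i, ∑ n ∈ dyadicBox d k, latticeSlope a k i n ^ 2

theorem slopeOsc_nonneg {d : ℕ} (a : ℕ → (Fin d → ℤ) → ℝ) (k : ℕ) (n : Fin d → ℤ) :
    0 ≤ slopeOsc a k n :=
  Finset.sum_nonneg fun _ _ => Finset.sum_nonneg fun _ _ => sq_nonneg _

theorem latticeEnergy_nonneg {d : ℕ} (a : ℕ → (Fin d → ℤ) → ℝ) (k : ℕ) :
    0 ≤ latticeEnergy a k :=
  mul_nonneg (by positivity) <| Finset.sum_nonneg fun _ _ => Finset.sum_nonneg fun _ _ => sq_nonneg _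

theorem sum_slopeOsc_le {d : ℕ} {a : ℕ → (Fin d → ℤ) → ℝ} {k : ℕ}
    (ha : ∀ n, a k n = (∑ s, a (k + 1) (dyadicChild n s)) / 2 ^ d)
    (hz : ∀ i m, 2 ^ (k + 1) ≤ m i → latticeSlope a (k + 1) i m = 0) :
    ((2 : ℝ) ^ k)⁻¹ ^ d * ∑ n ∈ dyadicBox d k, slopeOsc a k n
      ≤ 2 * 2 ^ d * (latticeEnergy a (k + 1) - latticeEnergy a k) := by
  have key : ∀ i, ∑ n ∈ dyadicBox d k,
      ∑ s, (latticeSlope a (k + 1) i (dyadicChild n s) - latticeSlope a k i n) ^ 2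
      ≤ 2 * ∑ m ∈ dyadicBox d (k + 1), latticeSlope a (k + 1) i m ^ 2
        - 2 * 2 ^ d * ∑ n ∈ dyadicBox d k, latticeSlope a k i n ^ 2 := by
    intro i
    have h1 : ∀ n, _ := fun n => sum_sub_mean_sq_le
      (fun s => latticeSlope a (k + 1) i (dyadicChild n s))
      (fun s => latticeSlope a (k + 1) i (dyadicChild n s + Pi.single i 1))
      (c := 2 ^ d) (by simp) (by positivity) (latticeSlope_eq_mean ha i n)
    refine (Finset.sum_le_sum fun n _ => h1 n).trans ?_
    rw [Finset.sum_sub_distrib, ← Finset.mul_sum]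
    simp only [Finset.sum_add_distrib]
    have e1 := sum_dyadicBox_child k (fun m => latticeSlope a (k + 1) i m ^ 2)
    have e2 := sum_dyadicBox_child k (fun m => latticeSlope a (k + 1) i (m + Pi.single i 1) ^ 2)
    beta_reduce at e1 e2 ⊢
    rw [e1, e2]
    have := sum_dyadicBox_shift_le (k + 1) i (fun m => latticeSlope a (k + 1) i m ^ 2)
      (fun m => sq_nonneg _) (fun m hm => by simp [hz i m hm])
    linarith
  have h2 := Finset.sum_le_sum fun i (_ : i ∈ Finset.univ) => key i
  rw [Finset.sum_comm] at h2
  rw [Finset.sum_sub_distrib, ← Finset.mul_sum, ← Finset.mul_sum] at h2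
  have h3 := mul_le_mul_of_nonneg_left h2 (show (0 : ℝ) ≤ ((2 : ℝ) ^ k)⁻¹ ^ d by positivity)
  refine h3.trans (le_of_eq ?_)
  have h4 : ((2 : ℝ) ^ k)⁻¹ ^ d = 2 ^ d * ((2 : ℝ) ^ (k + 1))⁻¹ ^ d := by
    rw [← mul_pow, pow_succ, mul_inv]
    congr 1
    field_simp
  rw [latticeEnergy, latticeEnergy, mul_sub, mul_sub]
  congr 1
  · rw [h4]
    ring
  · ring

theorem abs_sub_empty_le_card_mul {ι : Type*} [DecidableEq ι] {u : Finset ι → ℝ} {M : ℝ}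
    (h : ∀ i s, i ∉ s → |u (insert i s) - u s| ≤ M) (s : Finset ι) :
    |u s - u ∅| ≤ s.card * M := by
  induction s using Finset.induction_on with
  | empty => simp
  | insert i s hi ih =>
    rw [Finset.card_insert_of_notMem hi]
    have := abs_sub_le (u (insert i s)) (u s) (u ∅)
    have := h i s hi
    push_cast
    linarith

theorem sum_finset_ite_mem {ι : Type*} [Fintype ι] [DecidableEq ι] (i : ι) :
    ∑ s : Finset ι, (if i ∈ s then (1 : ℝ) else 0) = 2 ^ Fintype.card ι / 2 := by
  have h1 : ∑ s : Finset ι, (if i ∈ sᶜ then (1 : ℝ) else 0)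
      = ∑ s : Finset ι, (if i ∈ s then (1 : ℝ) else 0) :=
    Equiv.sum_comp (compl_involutive.toPerm (compl : Finset ι → Finset ι))
      (fun s => if i ∈ s then (1 : ℝ) else 0)
  have h2 : ∑ s : Finset ι, ((if i ∈ sᶜ then (1 : ℝ) else 0) + (if i ∈ s then (1 : ℝ) else 0))
      = 2 ^ Fintype.card ι := by
    have : ∀ s : Finset ι,
        (if i ∈ sᶜ then (1 : ℝ) else 0) + (if i ∈ s then (1 : ℝ) else 0) = 1 := by
      intro s
      by_cases hi : i ∈ s <;> simp [hi]
    rw [Finset.sum_congr rfl fun s _ => this s]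
    simp
  rw [Finset.sum_add_distrib, h1] at h2
  linarith

/-- The affine function on the cube of scale `k` and index `n` with mean value `a k n` and slopes
the difference quotients of `a k` at `n`. -/
def localAffine {d : ℕ} (a : ℕ → (Fin d → ℤ) → ℝ) (k : ℕ) (n : Fin d → ℤ)
    (x : EuclideanSpace ℝ (Fin d)) : ℝ :=
  a k n + ∑ i, latticeSlope a k i n * (x i - (n i + 1 / 2) / 2 ^ k)

theorem isAffineFn_localAffine {d : ℕ} (a : ℕ → (Fin d → ℤ) → ℝ) (k : ℕ) (n : Fin d → ℤ) :
    IsAffineFn (localAffine a k n) := by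
  refine ⟨fun i => latticeSlope a k i n,
    a k n - ∑ i, latticeSlope a k i n * ((n i + 1 / 2) / 2 ^ k), ?_⟩
  ext x
  simp only [localAffine, mul_sub, Finset.sum_sub_distrib]
  ring

theorem continuous_localAffine {d : ℕ} (a : ℕ → (Fin d → ℤ) → ℝ) (k : ℕ) (n : Fin d → ℤ) :
    Continuous (localAffine a k n) := by
  unfold localAffine
  fun_prop

theorem abs_sub_center_le {d k : ℕ} {n : Fin d → ℤ} {x : EuclideanSpace ℝ (Fin d)}
    (hx : x ∈ dyadicCube d (k, n)) (i : Fin d) :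
    |x i - (n i + 1 / 2) / 2 ^ k| ≤ 1 / 2 / 2 ^ k := by
  obtain ⟨h1, h2⟩ := hx i
  simp only [add_div] at h1 h2 ⊢
  rw [abs_le]
  have : (1 : ℝ) / 2 ^ k = 1 / 2 / 2 ^ k + 1 / 2 / 2 ^ k := by ring
  constructor <;> linarith

theorem abs_sub_mean_le {ι : Type*} [Fintype ι] {u : ι → ℝ} {c B : ℝ}
    (hc : (Fintype.card ι : ℝ) = c) (hc0 : 0 < c) {s : ι} (h : ∀ t, |u s - u t| ≤ B) :
    |u s - (∑ t, u t) / c| ≤ B := by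
  have h1 : u s - (∑ t, u t) / c = (∑ t, (u s - u t)) / c := by
    rw [Finset.sum_sub_distrib, Finset.sum_const, Finset.card_univ, nsmul_eq_mul, hc]
    field_simp
  rw [h1, abs_div, abs_of_pos hc0, div_le_iff₀ hc0]
  refine (Finset.abs_sum_le_sum_abs _ _).trans ((Finset.sum_le_sum fun t _ => h t).trans ?_)
  rw [Finset.sum_const, Finset.card_univ, nsmul_eq_mul, hc, mul_comm]

theorem localAffine_child_sub_sq_le {d : ℕ} {a : ℕ → (Fin d → ℤ) → ℝ} {k : ℕ}
    (ha : ∀ n, a k n = (∑ s, a (k + 1) (dyadicChild n s)) / 2 ^ d) (n : Fin d → ℤ)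
    (s : Finset (Fin d)) {x : EuclideanSpace ℝ (Fin d)}
    (hx : x ∈ dyadicCube d (k + 1, dyadicChild n s)) :
    (localAffine a (k + 1) (dyadicChild n s) x - localAffine a k n x) ^ 2
      ≤ 4 * d ^ 2 * (4 ^ k)⁻¹ * slopeOsc a k n := by
  set h : ℝ := ((2 : ℝ) ^ k)⁻¹ with hh
  have hpos : 0 < h := by positivity
  have hk : (2 : ℝ) ^ k * h = 1 := by rw [hh]; field_simp
  set w := √(slopeOsc a k n) with hw
  have hw0 : 0 ≤ w := Real.sqrt_nonneg _
  have hosc : ∀ i t, |latticeSlope a (k + 1) i (dyadicChild n t) - latticeSlope a k i n| ≤ w := by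
    intro i t
    apply Real.abs_le_sqrt
    refine le_trans ?_ (Finset.single_le_sum (f := fun i => ∑ s,
      (latticeSlope a (k + 1) i (dyadicChild n s) - latticeSlope a k i n) ^ 2)
      (fun _ _ => Finset.sum_nonneg fun _ _ => sq_nonneg _) (Finset.mem_univ i))
    exact Finset.single_le_sum (f := fun s =>
      (latticeSlope a (k + 1) i (dyadicChild n s) - latticeSlope a k i n) ^ 2)
      (fun _ _ => sq_nonneg _) (Finset.mem_univ t)
  set u : Finset (Fin d) → ℝ := fun t => a (k + 1) (dyadicChild n t)
    - h / 2 * ∑ i, latticeSlope a k i n * (if i ∈ t then 1 else 0) with hu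
  have hstep : ∀ i t, i ∉ t → |u (insert i t) - u t| ≤ h / 2 * w := by
    intro i t hi
    have h1 : ∑ j, latticeSlope a k j n * (if j ∈ insert i t then (1 : ℝ) else 0)
        = ∑ j, latticeSlope a k j n * (if j ∈ t then (1 : ℝ) else 0) + latticeSlope a k i n := by
      have : ∀ j, latticeSlope a k j n * (if j ∈ insert i t then (1 : ℝ) else 0)
          = latticeSlope a k j n * (if j ∈ t then (1 : ℝ) else 0)
            + (if j = i then latticeSlope a k j n else 0) := by
        intro j
        by_cases hj : j = i
        · subst hj; simp [hi]
        · simp [hj]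
      simp only [this, Finset.sum_add_distrib]
      simp
    have h2 : u (insert i t) - u t
        = h / 2 * (latticeSlope a (k + 1) i (dyadicChild n t) - latticeSlope a k i n) := by
      simp only [hu]
      rw [h1, dyadicChild_insert n hi]
      conv_rhs => rw [mul_sub, latticeSlope, pow_succ]
      linear_combination (a (k + 1) (dyadicChild n t)
        - a (k + 1) (dyadicChild n t + Pi.single i 1)) * hk
    rw [h2, abs_mul, abs_of_pos (by positivity : 0 < h / 2)]
    exact mul_le_mul_of_nonneg_left (hosc i t) (by positivity)
  have hempty : ∀ t, |u t - u ∅| ≤ d * (h / 2 * w) := by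
    intro t
    refine (abs_sub_empty_le_card_mul hstep t).trans ?_
    gcongr
    simpa using Finset.card_le_univ t
  have hmean : |u s - (∑ t, u t) / 2 ^ d| ≤ d * h * w := by
    refine abs_sub_mean_le (by simp) (by positivity) fun t => ?_
    have h1 := hempty s
    have h2 := hempty t
    rw [abs_sub_comm] at h2
    have h3 := abs_sub_le (u s) (u ∅) (u t)
    linarith
  have hsum : (∑ t, u t) / 2 ^ d = a k n - h / 4 * ∑ i, latticeSlope a k i n := by
    have : ∑ t, u t = ∑ t, a (k + 1) (dyadicChild n t)
        - h / 2 * (∑ i, latticeSlope a k i n * (2 ^ d / 2)) := by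
      simp only [hu]
      rw [Finset.sum_sub_distrib, ← Finset.mul_sum, Finset.sum_comm]
      simp only [← Finset.mul_sum, sum_finset_ite_mem, Fintype.card_fin]
    rw [this, ← Finset.sum_mul, sub_div, ← ha]
    field_simp
    ring
  have hrest : |∑ i, (latticeSlope a (k + 1) i (dyadicChild n s) - latticeSlope a k i n)
      * (x i - ((dyadicChild n s i : ℤ) + 1 / 2) / 2 ^ (k + 1))| ≤ d * (w * h) := by
    refine (Finset.abs_sum_le_sum_abs _ _).trans ?_
    refine (Finset.sum_le_card_nsmul _ _ (w * h) fun i _ => ?_).trans (by simp)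
    rw [abs_mul]
    refine mul_le_mul (hosc i s) ((abs_sub_center_le hx i).trans ?_) (abs_nonneg _) hw0
    have : (1 : ℝ) / 2 / 2 ^ (k + 1) = h / 4 := by rw [hh, pow_succ]; field_simp; norm_num
    linarith
  have hdiff : localAffine a (k + 1) (dyadicChild n s) x - localAffine a k n x
      = (u s - (∑ t, u t) / 2 ^ d)
        + ∑ i, (latticeSlope a (k + 1) i (dyadicChild n s) - latticeSlope a k i n)
          * (x i - ((dyadicChild n s i : ℤ) + 1 / 2) / 2 ^ (k + 1)) := by
    rw [hsum]
    have h1 : ∀ i, latticeSlope a k i n * (x i - (n i + 1 / 2) / 2 ^ k)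
        = latticeSlope a k i n * (x i - ((dyadicChild n s i : ℤ) + 1 / 2) / 2 ^ (k + 1))
          + h / 2 * (latticeSlope a k i n * (if i ∈ s then 1 else 0))
          - h / 4 * latticeSlope a k i n := by
      intro i
      have : ((dyadicChild n s i : ℤ) : ℝ) = 2 * n i + if i ∈ s then 1 else 0 := by
        simp [dyadicChild]
      rw [this, hh, pow_succ]
      field_simp
      ring
    simp only [localAffine, h1, hu, sub_mul, Finset.sum_sub_distrib, Finset.sum_add_distrib,
      ← Finset.mul_sum]
    ring
  have habs : |localAffine a (k + 1) (dyadicChild n s) x - localAffine a k n x|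
      ≤ 2 * d * h * w := by
    rw [hdiff]
    refine (abs_add_le _ _).trans ?_
    linarith
  have h4 : ((4 : ℝ) ^ k)⁻¹ = h ^ 2 := by
    rw [hh, ← inv_pow, ← inv_pow, ← pow_mul, mul_comm, pow_mul]
    norm_num
  rw [h4, ← Real.sq_sqrt (slopeOsc_nonneg a k n), ← sq_abs]
  calc _ ≤ (2 * d * h * w) ^ 2 := by gcongr
    _ = _ := by rw [hw]; ring

theorem dyadicCube_eq_preimage (d : ℕ) (p : ℕ × (Fin d → ℤ)) :
    dyadicCube d p = WithLp.ofLp ⁻¹' Set.Icc (fun i => (p.2 i : ℝ) / 2 ^ p.1)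
      (fun i => ((p.2 i : ℝ) + 1) / 2 ^ p.1) := by
  ext x
  simp [dyadicCube, Set.mem_Icc, Pi.le_def, forall_and]

theorem isCompact_dyadicCube (d : ℕ) (p : ℕ × (Fin d → ℤ)) : IsCompact (dyadicCube d p) := by
  rw [dyadicCube_eq_preimage]
  exact (PiLp.homeomorph 2 fun _ : Fin d => ℝ).isCompact_preimage.2 isCompact_Icc

theorem volume_real_dyadicCube (d : ℕ) (p : ℕ × (Fin d → ℤ)) :
    volume.real (dyadicCube d p) = ((2 : ℝ) ^ p.1)⁻¹ ^ d := by
  rw [dyadicCube_eq_preimage, Measure.real,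
    (PiLp.volume_preserving_ofLp (Fin d)).measure_preimage measurableSet_Icc.nullMeasurableSet,
    Real.volume_Icc_pi]
  have : ∀ i, ((p.2 i : ℝ) + 1) / 2 ^ p.1 - (p.2 i : ℝ) / 2 ^ p.1 = (2 ^ p.1)⁻¹ := by
    intro i
    ring
  simp only [this]
  simp

theorem dyadicCube_subset_iUnion_child {d : ℕ} (k : ℕ) (n : Fin d → ℤ) :
    dyadicCube d (k, n) ⊆ ⋃ s, dyadicCube d (k + 1, dyadicChild n s) := by
  intro x hx
  rw [Set.mem_iUnion]
  refine ⟨Finset.univ.filter fun i => ((n i : ℝ) + 1 / 2) / 2 ^ k ≤ x i, fun i => ?_⟩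
  have hi := hx i
  simp only [dyadicChild, Finset.mem_filter_univ, pow_succ] at hi ⊢
  rw [div_le_iff₀ (by positivity), le_div_iff₀ (by positivity)] at hi ⊢
  simp only [div_le_iff₀ (show (0 : ℝ) < 2 ^ k by positivity)]
  split_ifs with h <;> push_cast <;> constructor <;> linarith

theorem setIntegral_dyadicCube_le_sum_child {d : ℕ} {g : EuclideanSpace ℝ (Fin d) → ℝ}
    (hg : Continuous g) (hg0 : ∀ x, 0 ≤ g x) (k : ℕ) (n : Fin d → ℤ) :
    ∫ x in dyadicCube d (k, n), g x
      ≤ ∑ s, ∫ x in dyadicCube d (k + 1, dyadicChild n s), g x := by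
  have hint : ∀ s, IntegrableOn g (dyadicCube d (k + 1, dyadicChild n s)) := fun s =>
    hg.continuousOn.integrableOn_compact (isCompact_dyadicCube _ _)
  rw [← integral_finsetSum_measure fun s _ => hint s]
  refine integral_mono_measure ?_ (Filter.Eventually.of_forall hg0)
    (integrable_finsetSum_measure.2 fun s _ => hint s)
  rw [← Measure.sum_fintype]
  exact (Measure.restrict_mono (dyadicCube_subset_iUnion_child k n) le_rfl).trans
    Measure.restrict_iUnion_le

/-- The squared `L²` error of the local affine approximation of `f` on a dyadic cube. -/
def affineError {d : ℕ} (f : EuclideanSpace ℝ (Fin d) → ℝ) (a : ℕ → (Fin d → ℤ) → ℝ) (k : ℕ)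
    (n : Fin d → ℤ) : ℝ :=
  ∫ x in dyadicCube d (k, n), (f x - localAffine a k n x) ^ 2

theorem affineError_nonneg {d : ℕ} (f : EuclideanSpace ℝ (Fin d) → ℝ)
    (a : ℕ → (Fin d → ℤ) → ℝ) (k : ℕ) (n : Fin d → ℤ) : 0 ≤ affineError f a k n :=
  integral_nonneg fun _ => sq_nonneg _

theorem affineError_le_sum_child {d : ℕ} {f : EuclideanSpace ℝ (Fin d) → ℝ} (hf : Continuous f)
    {a : ℕ → (Fin d → ℤ) → ℝ} {k : ℕ}
    (ha : ∀ n, a k n = (∑ s, a (k + 1) (dyadicChild n s)) / 2 ^ d) (n : Fin d → ℤ) :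
    affineError f a k n ≤ 2 * ∑ s, affineError f a (k + 1) (dyadicChild n s)
      + 8 * d ^ 2 * (4 ^ k)⁻¹ * ((2 : ℝ) ^ k)⁻¹ ^ d * slopeOsc a k n := by
  have hcont : ∀ k n, Continuous fun x => (f x - localAffine a k n x) ^ 2 := fun k n =>
    (hf.sub (continuous_localAffine a k n)).pow 2
  refine (setIntegral_dyadicCube_le_sum_child (hcont k n) (fun _ => sq_nonneg _) k n).trans ?_
  set B := 4 * (d : ℝ) ^ 2 * (4 ^ k)⁻¹ * slopeOsc a k n with hB
  have h1 : ∀ s, ∫ x in dyadicCube d (k + 1, dyadicChild n s), (f x - localAffine a k n x) ^ 2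
      ≤ 2 * affineError f a (k + 1) (dyadicChild n s) + 2 * B * ((2 : ℝ) ^ (k + 1))⁻¹ ^ d := by
    intro s
    set Q := dyadicCube d (k + 1, dyadicChild n s) with hQ
    have hK : IsCompact Q := isCompact_dyadicCube _ _
    have hi1 : IntegrableOn (fun x => 2 * (f x - localAffine a (k + 1) (dyadicChild n s) x) ^ 2) Q :=
      ((hcont _ _).const_mul 2).continuousOn.integrableOn_compact hK
    have hi2 : IntegrableOn (fun _ => 2 * B) Q := continuousOn_const.integrableOn_compact hK
    calc _ ≤ ∫ x in Q, (2 * (f x - localAffine a (k + 1) (dyadicChild n s) x) ^ 2 + 2 * B) := by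
          refine setIntegral_mono_on ((hcont _ _).continuousOn.integrableOn_compact hK)
            (hi1.add hi2) hK.measurableSet fun x hx => ?_
          have := localAffine_child_sub_sq_le ha n s hx
          have h2 := sq_nonneg ((f x - localAffine a (k + 1) (dyadicChild n s) x)
            - (localAffine a (k + 1) (dyadicChild n s) x - localAffine a k n x))
          nlinarith
      _ = _ := by
          rw [integral_add hi1 hi2, integral_const_mul, setIntegral_const, smul_eq_mul,
            volume_real_dyadicCube, mul_comm _ (2 * B)]
          rfl
  refine (Finset.sum_le_sum fun s _ => h1 s).trans (le_of_eq ?_)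
  have h4 : ((2 : ℝ) ^ k)⁻¹ ^ d = 2 ^ d * ((2 : ℝ) ^ (k + 1))⁻¹ ^ d := by
    rw [← mul_pow, pow_succ, mul_inv]
    congr 1
    field_simp
  rw [Finset.sum_add_distrib, ← Finset.mul_sum, Finset.sum_const, h4, hB]
  simp only [Finset.card_univ, Fintype.card_finset, Fintype.card_fin, nsmul_eq_mul]
  push_cast
  ring

theorem sum_affineError_le {d : ℕ} {f : EuclideanSpace ℝ (Fin d) → ℝ} (hf : Continuous f)
    {a : ℕ → (Fin d → ℤ) → ℝ} {k : ℕ}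
    (ha : ∀ n, a k n = (∑ s, a (k + 1) (dyadicChild n s)) / 2 ^ d)
    (hz : ∀ i m, 2 ^ (k + 1) ≤ m i → latticeSlope a (k + 1) i m = 0) :
    4 ^ k * ∑ n ∈ dyadicBox d k, affineError f a k n
      ≤ (4 ^ (k + 1) * ∑ n ∈ dyadicBox d (k + 1), affineError f a (k + 1) n) / 2
        + 16 * d ^ 2 * 2 ^ d * (latticeEnergy a (k + 1) - latticeEnergy a k) := by
  have h1 := Finset.sum_le_sum fun n (_ : n ∈ dyadicBox d k) => affineError_le_sum_child hf ha n
  rw [Finset.sum_add_distrib, ← Finset.mul_sum, ← Finset.mul_sum,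
    sum_dyadicBox_child k (affineError f a (k + 1))] at h1
  have h2 := mul_le_mul_of_nonneg_left (sum_slopeOsc_le ha hz)
    (show (0 : ℝ) ≤ 8 * d ^ 2 by positivity)
  have h3 := mul_le_mul_of_nonneg_left h1 (show (0 : ℝ) ≤ 4 ^ k by positivity)
  have h4 : (4 : ℝ) ^ k * (4 ^ k)⁻¹ = 1 := by field_simp
  refine h3.trans ?_
  rw [pow_succ]
  linear_combination h2 + 8 * (d : ℝ) ^ 2 * ((2 : ℝ) ^ k)⁻¹ ^ d
    * (∑ n ∈ dyadicBox d k, slopeOsc a k n) * h4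

theorem sum_range_succ_le_of_le_half_succ_add {N : ℕ} {Y E : ℕ → ℝ} {K : ℝ}
    (h : ∀ k < N, Y k ≤ Y (k + 1) / 2 + K * (E (k + 1) - E k)) (hY : 0 ≤ Y 0) :
    ∑ k ∈ Finset.range (N + 1), Y k ≤ 2 * Y N + 2 * K * (E N - E 0) := by
  have h1 := Finset.sum_le_sum fun k (hk : k ∈ Finset.range N) => h k (Finset.mem_range.1 hk)
  rw [Finset.sum_add_distrib, ← Finset.mul_sum, Finset.sum_range_sub, ← Finset.sum_div] at h1
  have h2 := Finset.sum_range_succ Y N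
  have h3 := Finset.sum_range_succ' Y N
  linarith

/-- The grid averages of the values of `f` at the centers of the dyadic cubes of scale `N`. -/
def centerMean {d : ℕ} (f : EuclideanSpace ℝ (Fin d) → ℝ) (N k : ℕ) : (Fin d → ℤ) → ℝ :=
  dyadicMean (fun m => f (WithLp.toLp 2 fun i => ((m i : ℝ) + 1 / 2) / 2 ^ N)) (N - k)

theorem centerMean_eq {d : ℕ} (f : EuclideanSpace ℝ (Fin d) → ℝ) {N k : ℕ} (hk : k < N)
    (n : Fin d → ℤ) :
    centerMean f N k n = (∑ s, centerMean f N (k + 1) (dyadicChild n s)) / 2 ^ d := by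
  have : N - k = (N - (k + 1)) + 1 := by omega
  rw [centerMean, this]
  rfl

theorem centerMean_self {d : ℕ} (f : EuclideanSpace ℝ (Fin d) → ℝ) (N : ℕ) (m : Fin d → ℤ) :
    centerMean f N N m = f (WithLp.toLp 2 fun i => ((m i : ℝ) + 1 / 2) / 2 ^ N) := by
  rw [centerMean, Nat.sub_self]
  rfl

theorem latticeSlope_centerMean_eq_zero {d : ℕ} {f : EuclideanSpace ℝ (Fin d) → ℝ}
    (hc : ∀ x y i, (∀ j ≠ i, x j = y j) → 1 ≤ x i → 1 ≤ y i → f x = f y) (N r : ℕ) (hr : r ≤ N)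
    (i : Fin d) (m : Fin d → ℤ) (hm : 2 ^ (N - r) ≤ m i) :
    latticeSlope (centerMean f N) (N - r) i m = 0 := by
  induction r generalizing m with
  | zero =>
    rw [Nat.sub_zero] at hm ⊢
    have hm' : (2 : ℝ) ^ N ≤ m i := by exact_mod_cast hm
    rw [latticeSlope, centerMean_self, centerMean_self, sub_eq_zero.2, mul_zero]
    refine hc _ _ i (fun j hj => by simp [hj]) ?_ ?_
    · rw [PiLp.toLp_apply, one_le_div (by positivity)]
      simp only [Pi.add_apply, Pi.single_eq_same]
      push_cast
      linarith
    · rw [PiLp.toLp_apply, one_le_div (by positivity)]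
      linarith
  | succ r ih =>
    have hk : N - (r + 1) + 1 = N - r := by omega
    rw [latticeSlope_eq_mean fun n => centerMean_eq f (by omega) n, hk]
    have hc1 : ∀ s, 2 ^ (N - r) ≤ dyadicChild m s i := by
      intro s
      rw [← hk, pow_succ]
      simp only [dyadicChild]
      split_ifs <;> omega
    refine div_eq_zero_iff.2 (Or.inl (Finset.sum_eq_zero fun s _ => ?_))
    rw [ih (by omega) _ (hc1 s), ih (by omega) _, add_zero]
    have := hc1 s
    simp only [Pi.add_apply, Pi.single_eq_same]
    omega

theorem abs_latticeSlope_centerMean_le {d : ℕ} {f : EuclideanSpace ℝ (Fin d) → ℝ}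
    (hf : ∀ x y, |f x - f y| ≤ ∑ i, |x i - y i|) (N : ℕ) (i : Fin d) (m : Fin d → ℤ) :
    |latticeSlope (centerMean f N) N i m| ≤ 1 := by
  rw [latticeSlope, centerMean_self, centerMean_self, abs_mul, abs_of_pos (by positivity),
    mul_comm, ← le_div_iff₀ (by positivity)]
  refine (hf _ _).trans ?_
  rw [Finset.sum_eq_single i (fun j _ hj => by simp [hj]) (by simp), PiLp.toLp_apply,
    PiLp.toLp_apply, Pi.add_apply, Pi.single_eq_same, ← sub_div]
  push_cast
  rw [show (m i : ℝ) + 1 + 1 / 2 - (m i + 1 / 2) = 1 by ring, abs_of_pos (by positivity)]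

theorem affineError_centerMean_le {d : ℕ} {f : EuclideanSpace ℝ (Fin d) → ℝ}
    (hf : ∀ x y, |f x - f y| ≤ ∑ i, |x i - y i|) (hfc : Continuous f) (N : ℕ) (m : Fin d → ℤ) :
    affineError f (centerMean f N) N m ≤ d ^ 2 * (4 ^ N)⁻¹ * ((2 : ℝ) ^ N)⁻¹ ^ d := by
  have hK := isCompact_dyadicCube d (N, m)
  have hpt : ∀ x ∈ dyadicCube d (N, m),
      (f x - localAffine (centerMean f N) N m x) ^ 2 ≤ d ^ 2 * (4 ^ N)⁻¹ := by
    intro x hx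
    have hb := abs_sub_center_le hx
    have h1 : |f x - localAffine (centerMean f N) N m x| ≤ d * (2 ^ N)⁻¹ := by
      rw [localAffine, centerMean_self, ← sub_sub]
      refine (abs_sub _ _).trans ?_
      have e1 : |f x - f (WithLp.toLp 2 fun i => ((m i : ℝ) + 1 / 2) / 2 ^ N)|
          ≤ d * (1 / 2 / 2 ^ N) := by
        refine (hf _ _).trans ((Finset.sum_le_card_nsmul _ _ (1 / 2 / 2 ^ N)
          fun i _ => hb i).trans (by simp))
      have e2 : |∑ i, latticeSlope (centerMean f N) N i m * (x i - ((m i : ℝ) + 1 / 2) / 2 ^ N)|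
          ≤ d * (1 / 2 / 2 ^ N) := by
        refine (Finset.abs_sum_le_sum_abs _ _).trans
          ((Finset.sum_le_card_nsmul _ _ (1 / 2 / 2 ^ N) fun i _ => ?_).trans (by simp))
        rw [abs_mul]
        calc _ ≤ 1 * (1 / 2 / 2 ^ N : ℝ) := by
              gcongr
              · exact abs_latticeSlope_centerMean_le hf N i m
              · exact hb i
          _ = _ := one_mul _
      refine (add_le_add e1 e2).trans (le_of_eq ?_)
      field_simp
      ring
    have h4 : ((4 : ℝ) ^ N)⁻¹ = ((2 : ℝ) ^ N)⁻¹ ^ 2 := by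
      rw [← inv_pow, ← inv_pow, ← pow_mul, mul_comm, pow_mul]
      norm_num
    rw [h4, ← mul_pow, ← sq_abs]
    gcongr
  calc affineError f (centerMean f N) N m
      ≤ ∫ _ in dyadicCube d (N, m), (d : ℝ) ^ 2 * (4 ^ N)⁻¹ :=
        setIntegral_mono_on (((hfc.sub (continuous_localAffine _ _ _)).pow
          2).continuousOn.integrableOn_compact hK) (continuousOn_const.integrableOn_compact hK)
          hK.measurableSet hpt
    _ = _ := by
        rw [setIntegral_const, smul_eq_mul, volume_real_dyadicCube, mul_comm]

theorem card_dyadicBox_mul (d N : ℕ) :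
    ((dyadicBox d N).card : ℝ) * ((2 : ℝ) ^ N)⁻¹ ^ d = 1 := by
  rw [card_dyadicBox]
  push_cast
  rw [← mul_pow, mul_inv_cancel₀ (by positivity), one_pow]

theorem sum_affineError_centerMean_le {d : ℕ} {f : EuclideanSpace ℝ (Fin d) → ℝ}
    (hf : ∀ x y, |f x - f y| ≤ ∑ i, |x i - y i|) (hfc : Continuous f)
    (hc : ∀ x y i, (∀ j ≠ i, x j = y j) → 1 ≤ x i → 1 ≤ y i → f x = f y) (N : ℕ) :
    ∑ k ∈ Finset.range (N + 1),
      4 ^ k * ∑ n ∈ dyadicBox d k, affineError f (centerMean f N) k n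
      ≤ 2 * d ^ 2 + 32 * d ^ 2 * 2 ^ d * d := by
  set a := centerMean f N with ha
  have h1 := sum_range_succ_le_of_le_half_succ_add (N := N)
    (Y := fun k => 4 ^ k * ∑ n ∈ dyadicBox d k, affineError f a k n) (E := latticeEnergy a)
    (K := 16 * d ^ 2 * 2 ^ d)
    (fun k hk => sum_affineError_le hfc (fun n => centerMean_eq f hk n) fun i m hm => by
      have hk' : N - (N - (k + 1)) = k + 1 := by omega
      have := latticeSlope_centerMean_eq_zero hc N (N - (k + 1)) (by omega) i m
        (by rwa [hk'])
      rwa [hk'] at this)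
    (mul_nonneg (by positivity) (Finset.sum_nonneg fun n _ => affineError_nonneg f a 0 n))
  have h2 : 4 ^ N * ∑ n ∈ dyadicBox d N, affineError f a N n ≤ d ^ 2 := by
    have := Finset.sum_le_card_nsmul (dyadicBox d N) _ _
      fun n _ => affineError_centerMean_le hf hfc N n
    rw [nsmul_eq_mul, mul_left_comm, card_dyadicBox_mul, mul_one] at this
    calc _ ≤ (4 : ℝ) ^ N * (d ^ 2 * (4 ^ N)⁻¹) := by gcongr
      _ = _ := by field_simp
  have h3 : latticeEnergy a N ≤ d := by
    have e1 : ∀ i, ∑ n ∈ dyadicBox d N, latticeSlope a N i n ^ 2 ≤ (dyadicBox d N).card := by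
      intro i
      refine (Finset.sum_le_card_nsmul _ _ 1 fun n _ => ?_).trans (by simp)
      exact (sq_le_one_iff_abs_le_one _).2 (abs_latticeSlope_centerMean_le hf N i n)
    have e2 : ∑ i, ∑ n ∈ dyadicBox d N, latticeSlope a N i n ^ 2 ≤ d * (dyadicBox d N).card :=
      (Finset.sum_le_card_nsmul _ _ _ fun i _ => e1 i).trans (by simp)
    calc latticeEnergy a N
        ≤ ((2 : ℝ) ^ N)⁻¹ ^ d * (d * (dyadicBox d N).card) := by
          rw [latticeEnergy]
          gcongr
      _ = d * ((dyadicBox d N).card * ((2 : ℝ) ^ N)⁻¹ ^ d) := by ring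
      _ = d := by rw [card_dyadicBox_mul, mul_one]
  have h4 := latticeEnergy_nonneg a 0
  have h5 : 2 * (16 * (d : ℝ) ^ 2 * 2 ^ d) * (latticeEnergy a N - latticeEnergy a 0)
      ≤ 2 * (16 * (d : ℝ) ^ 2 * 2 ^ d) * d := by
    gcongr
    linarith
  refine h1.trans ?_
  linarith

/-- The coordinatewise nearest-point map onto the unit cube. -/
def clampCube {d : ℕ} (x : EuclideanSpace ℝ (Fin d)) : EuclideanSpace ℝ (Fin d) :=
  WithLp.toLp 2 fun i => max 0 (min 1 (x i))

theorem clampCube_mem {d : ℕ} (x : EuclideanSpace ℝ (Fin d)) : clampCube x ∈ unitCube d :=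
  fun _ => ⟨le_max_left _ _, max_le zero_le_one (min_le_left _ _)⟩

theorem clampCube_of_mem {d : ℕ} {x : EuclideanSpace ℝ (Fin d)} (hx : x ∈ unitCube d) :
    clampCube x = x := by
  ext i
  simp [clampCube, (hx i).1, (hx i).2]

theorem dist_le_sum_abs_sub {d : ℕ} (x y : EuclideanSpace ℝ (Fin d)) :
    dist x y ≤ ∑ i, |x i - y i| := by
  rw [EuclideanSpace.dist_eq]
  refine Real.sqrt_le_iff.2 ⟨Finset.sum_nonneg fun _ _ => abs_nonneg _, ?_⟩
  simp only [Real.dist_eq]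
  exact Finset.sum_sq_le_sq_sum_of_nonneg fun _ _ => abs_nonneg _

theorem continuous_clampCube {d : ℕ} : Continuous (clampCube (d := d)) := by
  unfold clampCube
  fun_prop

theorem abs_comp_clampCube_sub_le {d : ℕ} {F : EuclideanSpace ℝ (Fin d) → ℝ}
    (hF : LipschitzOnWith 1 F (unitCube d)) (x y : EuclideanSpace ℝ (Fin d)) :
    |F (clampCube x) - F (clampCube y)| ≤ ∑ i, |x i - y i| := by
  have h := hF.dist_le_mul _ (clampCube_mem x) _ (clampCube_mem y)
  rw [Real.dist_eq, NNReal.coe_one, one_mul] at h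
  refine h.trans ((dist_le_sum_abs_sub _ _).trans (Finset.sum_le_sum fun i _ => ?_))
  simp only [clampCube]
  refine (abs_max_sub_max_le_max _ _ _ _).trans ?_
  rw [sub_self, abs_zero, max_eq_right (abs_nonneg _)]
  refine (abs_min_sub_min_le_max _ _ _ _).trans ?_
  rw [sub_self, abs_zero, max_eq_right (abs_nonneg _)]

theorem mem_dyadicBox_of_subset {d : ℕ} {p : ℕ × (Fin d → ℤ)}
    (hp : dyadicCube d p ⊆ unitCube d) : p.2 ∈ dyadicBox d p.1 := by
  rw [mem_dyadicBox]
  have hpos : (0 : ℝ) < 2 ^ p.1 := by positivity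
  have hlow := hp (show WithLp.toLp 2 (fun i => (p.2 i : ℝ) / 2 ^ p.1) ∈ dyadicCube d p from
    fun i => ⟨le_rfl, by simp only; gcongr; linarith⟩)
  have hup := hp (show WithLp.toLp 2 (fun i => ((p.2 i : ℝ) + 1) / 2 ^ p.1) ∈ dyadicCube d p from
    fun i => ⟨by simp only; gcongr; linarith, le_rfl⟩)
  intro i
  have h1 := (hlow i).1
  have h2 := (hup i).2
  simp only at h1 h2
  rw [le_div_iff₀ hpos, zero_mul] at h1
  rw [div_le_iff₀ hpos, one_mul] at h2
  have h2' : p.2 i + 1 ≤ 2 ^ p.1 := by exact_mod_cast h2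
  exact ⟨by exact_mod_cast h1, by omega⟩

/-- Fefferman's main estimate.  There is a constant `C` depending only on `d`
such that for every `F : Q° → ℝ` with Lipschitz constant at most `1`,
`∑_Q δ_Q^{-2} ∫_Q |F − L_Q|² ≤ C`, the sum ranging over all dyadic subcubes `Q ⊆ Q°`.
(The sum of the nonnegative terms is bounded by `C` iff every finite partial sum is.) -/
theorem cz_main_estimate (d : ℕ) :
    ∃ C : ℝ, 0 < C ∧
      ∀ (F : EuclideanSpace ℝ (Fin d) → ℝ),
        LipschitzOnWith 1 F (unitCube d) →
        ∀ L : (ℕ × (Fin d → ℤ)) → EuclideanSpace ℝ (Fin d) → ℝ,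
          (∀ p, dyadicCube d p ⊆ unitCube d → IsBestAffineApprox F (dyadicCube d p) (L p)) →
          ∀ S : Finset (ℕ × (Fin d → ℤ)),
            (∀ p ∈ S, dyadicCube d p ⊆ unitCube d) →
            ∑ p ∈ S, ((2 : ℝ) ^ p.1) ^ 2 * ∫ x in dyadicCube d p, (F x - L p x) ^ 2 ∂volume
              ≤ C := by

  refine ⟨2 * d ^ 2 + 32 * d ^ 2 * 2 ^ d * d + 1, by positivity, ?_⟩
  intro F hF L hL S hS
  set f : EuclideanSpace ℝ (Fin d) → ℝ := fun x => F (clampCube x) with hfdef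
  have hf : ∀ x y, |f x - f y| ≤ ∑ i, |x i - y i| := abs_comp_clampCube_sub_le hF
  have hfc : Continuous f :=
    hF.continuousOn.comp_continuous continuous_clampCube clampCube_mem
  have hclamp : ∀ x y i, (∀ j ≠ i, x j = y j) → 1 ≤ x i → 1 ≤ y i → f x = f y := by
    intro x y i hxy hx hy
    have : clampCube x = clampCube y := by
      ext j
      by_cases hj : j = i
      · subst hj
        simp [clampCube, hx, hy]
      · simp [clampCube, hxy j hj]
    simp only [hfdef, this]
  set N := S.sup Prod.fst
  have hterm : ∀ p ∈ S, ((2 : ℝ) ^ p.1) ^ 2 * ∫ x in dyadicCube d p, (F x - L p x) ^ 2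
      ≤ 4 ^ p.1 * affineError f (centerMean f N) p.1 p.2 := by
    intro p hp
    have h4 : ((2 : ℝ) ^ p.1) ^ 2 = 4 ^ p.1 := by
      rw [← pow_mul, mul_comm, pow_mul]
      norm_num
    rw [h4]
    refine mul_le_mul_of_nonneg_left ?_ (by positivity)
    refine ((hL p (hS p hp)).2 _ (isAffineFn_localAffine (centerMean f N) p.1 p.2)).trans
      (le_of_eq ?_)
    refine setIntegral_congr_fun (isCompact_dyadicCube d p).measurableSet fun x hx => ?_
    simp only [hfdef, clampCube_of_mem (hS p hp hx)]
  refine (Finset.sum_le_sum hterm).trans ?_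
  have hsub : S ⊆ ((Finset.range (N + 1)).sigma fun k => dyadicBox d k).map
      (Equiv.sigmaEquivProd ℕ (Fin d → ℤ)).toEmbedding := by
    intro p hp
    refine Finset.mem_map.2 ⟨⟨p.1, p.2⟩, Finset.mem_sigma.2 ⟨?_, ?_⟩, rfl⟩
    · exact Finset.mem_range.2 (Nat.lt_succ_of_le (Finset.le_sup (f := Prod.fst) hp))
    · exact mem_dyadicBox_of_subset (hS p hp)
  refine (Finset.sum_le_sum_of_subset_of_nonneg hsub fun p _ _ =>
    mul_nonneg (by positivity) (affineError_nonneg _ _ _ _)).trans ?_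
  rw [Finset.sum_map, Finset.sum_sigma]
  simp only [Equiv.toEmbedding_apply, Equiv.sigmaEquivProd_apply, ← Finset.mul_sum]
  linarith [sum_affineError_centerMean_le hf hfc hclamp N]
end
end

section
/- Fix n ≥ 2 and λ, μ ∈ ℝⁿ with strictly decreasing entries. For ν in the hyperplane H = {ν ∈ ℝⁿ : ∑_i ν_i = ∑_i λ_i + ∑_i μ_i}, define G(ν) = V(ν) · Vol(HIVE_{λ⊞μ→ν}), where V(ν) = ∏_{1 ≤ i < j ≤ n} (ν_i − ν_j), Vol denotes the Lebesgue measure in the coordinates given by the hive values at the (n−1)(n−2)/2 interior vertices of T_n, and G(ν) := 0 when HIVE_{λ⊞μ→ν} is empty. Then G is log-concave on H: for all ν, ν' ∈ H and t ∈ [0,1], G(tν + (1−t)ν') ≥ G(ν)^t · G(ν')^{1−t}. -/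
open MeasureTheory

noncomputable section

/-- Interior vertices of the hive triangle `T_n`: pairs `(i, j)` with `0 < i < j < n`
(stored with both coordinates in `Fin n`, so that `j < n` is automatic). -/
abbrev HiveInterior (n : ℕ) := {p : Fin n × Fin n // 0 < p.1.val ∧ p.1.val < p.2.val}

/-- Partial sum `f 0 + ⋯ + f (k-1)`. -/
def psum {n : ℕ} (f : Fin n → ℝ) (k : ℕ) : ℝ := ∑ i : Fin n, if i.val < k then f i else 0

/-- The hive values on the lattice triangle `T_n`: the free interior coordinates come from
`g`, and the boundary values are the partial sums of `λ`, `μ`, `ν` as dictated by the hive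
boundary conditions.  (The value is irrelevant junk off the triangle.) -/
def hiveVal {n : ℕ} (lam mu nu : Fin n → ℝ) (g : HiveInterior n → ℝ) (i j : ℕ) : ℝ :=
  if hf : 0 < i ∧ i < j ∧ j < n then
    g ⟨(⟨i, lt_trans hf.2.1 hf.2.2⟩, ⟨j, hf.2.2⟩), hf.1, hf.2.1⟩
  else if i = 0 then psum lam j
  else if j = n then psum lam n + psum mu i
  else psum nu i

/-- Discrete (rhombus) concavity of a function on `T_n`: the three families of second
differences are nonpositive whenever all four points of the corresponding rhombus lie in
`T_n = {(i,j) : 0 ≤ i ≤ j ≤ n}`. -/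
def IsDiscreteConcave (n : ℕ) (h : ℕ → ℕ → ℝ) : Prop :=
  (∀ i j : ℕ, i + 1 ≤ j → j + 1 ≤ n →
      h i j - h (i + 1) j - h (i + 1) (j + 1) + h (i + 2) (j + 1) ≤ 0) ∧
  (∀ i j : ℕ, i + 1 ≤ j → j + 1 ≤ n →
      -(h i j) + h (i + 1) j + h i (j + 1) - h (i + 1) (j + 1) ≤ 0) ∧
  (∀ i j : ℕ, i ≤ j → j + 2 ≤ n →
      h i j - h (i + 1) (j + 1) - h i (j + 1) + h (i + 1) (j + 2) ≤ 0)

/-- The hive polytope `HIVE_{λ⊞μ→ν}`, in the coordinates given by the hive values at the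
interior vertices of `T_n`. -/
def hivePolytope (n : ℕ) (lam mu nu : Fin n → ℝ) : Set (HiveInterior n → ℝ) :=
  {g | IsDiscreteConcave n (hiveVal lam mu nu g)}

/-- The Vandermonde factor `V(ν) = ∏_{i<j} (ν_i − ν_j)`. -/
def vandermonde {n : ℕ} (nu : Fin n → ℝ) : ℝ :=
  ∏ p ∈ Finset.univ.filter (fun p : Fin n × Fin n => p.1 < p.2), (nu p.1 - nu p.2)

open scoped Pointwise in
/-- One-dimensional Brunn–Minkowski inequality for compact sets. -/
theorem Real.volume_add_le_of_isCompact {K L : Set ℝ} (hK : IsCompact K) (hL : IsCompact L)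
    (hK0 : K.Nonempty) (hL0 : L.Nonempty) : volume K + volume L ≤ volume (K + L) := by
  obtain ⟨a, haK, ha⟩ := hK.exists_isGreatest hK0
  obtain ⟨b, hbL, hb⟩ := hL.exists_isLeast hL0
  have hK' : volume K = volume ((fun x => x + b) '' K) := by simp
  have hL' : volume L = volume ((fun x => a + x) '' L) := by simp
  have hd : AEDisjoint volume ((fun x => x + b) '' K) ((fun x => a + x) '' L) := by
    refine measure_mono_null (t := {a + b}) ?_ (by simp)
    rintro _ ⟨⟨x, hx, rfl⟩, ⟨y, hy, hxy⟩⟩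
    have h1 := ha hx
    have h2 := hb hy
    simp only [Set.mem_singleton_iff] at hxy ⊢
    linarith
  rw [hK', hL', ← measure_union₀ (hL.image (by fun_prop)).measurableSet.nullMeasurableSet hd]
  refine measure_mono (Set.union_subset ?_ ?_)
  · rintro _ ⟨x, hx, rfl⟩
    exact Set.add_mem_add hx hbL
  · rintro _ ⟨y, hy, rfl⟩
    exact Set.add_mem_add haK hy

open scoped Pointwise in
/-- One-dimensional Brunn–Minkowski inequality. -/
theorem Real.volume_add_le {A B : Set ℝ} (hA : MeasurableSet A) (hB : MeasurableSet B)
    (hA0 : A.Nonempty) (hB0 : B.Nonempty) : volume A + volume B ≤ volume (A + B) := by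
  obtain ⟨a, ha⟩ := hA0
  obtain ⟨b, hb⟩ := hB0
  have key (K : Set ℝ) (hK : K ⊆ A ∧ IsCompact K) (L : Set ℝ) (hL : L ⊆ B ∧ IsCompact L) :
      volume K + volume L ≤ volume (A + B) := by
    calc volume K + volume L ≤ volume (insert a K) + volume (insert b L) := by
          gcongr <;> exact Set.subset_insert _ _
      _ ≤ volume (insert a K + insert b L) :=
          Real.volume_add_le_of_isCompact (hK.2.insert a) (hL.2.insert b)
            (Set.insert_nonempty _ _) (Set.insert_nonempty _ _)
      _ ≤ volume (A + B) :=
          measure_mono (Set.add_subset_add (Set.insert_subset ha hK.1)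
            (Set.insert_subset hb hL.1))
  rw [hA.measure_eq_iSup_isCompact, hB.measure_eq_iSup_isCompact]
  simp only [iSup_and']
  exact ENNReal.biSup_add_biSup_le' ⟨∅, by simp⟩ ⟨∅, by simp⟩ key

/-- One-dimensional Brunn–Minkowski inequality for weighted sums. -/
theorem Real.ofReal_mul_volume_add_le {A B C : Set ℝ} {s t : ℝ} (hs : 0 < s) (ht : 0 < t)
    (hA : MeasurableSet A) (hB : MeasurableSet B) (hA0 : A.Nonempty) (hB0 : B.Nonempty)
    (hC : ∀ x ∈ A, ∀ y ∈ B, s * x + t * y ∈ C) :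
    ENNReal.ofReal s * volume A + ENNReal.ofReal t * volume B ≤ volume C := by
  open scoped Pointwise in
  have h := Real.volume_add_le (hA.const_smul₀ s) (hB.const_smul₀ t)
    (hA0.smul_set (a := s)) (hB0.smul_set (a := t))
  simp only [Measure.addHaar_smul, Module.finrank_self, pow_one, abs_of_pos hs,
    abs_of_pos ht] at h
  refine h.trans (measure_mono ?_)
  rintro _ ⟨_, ⟨x, hx, rfl⟩, _, ⟨y, hy, rfl⟩, rfl⟩
  exact hC x hx y hy

/-- Additive form of the one-dimensional Prékopa–Leindler inequality, for functions whose
supremum is `1`. -/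
theorem Real.lintegral_ofReal_add_le {F G H : ℝ → ℝ} {s t : ℝ} (hs : 0 < s) (ht : 0 < t)
    (hF : Measurable F) (hG : Measurable G) (hH : Measurable H)
    (hF0 : ∀ x, 0 ≤ F x) (hG0 : ∀ x, 0 ≤ G x) (hH0 : ∀ x, 0 ≤ H x)
    (hF1 : ∀ x, F x ≤ 1) (hG1 : ∀ x, G x ≤ 1)
    (hFsup : ∀ r < 1, ∃ x, r < F x) (hGsup : ∀ r < 1, ∃ x, r < G x)
    (hle : ∀ x y r, 0 < r → r < F x → r < G y → r < H (s * x + t * y)) :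
    ENNReal.ofReal s * (∫⁻ x, ENNReal.ofReal (F x)) +
      ENNReal.ofReal t * (∫⁻ x, ENNReal.ofReal (G x)) ≤ ∫⁻ x, ENNReal.ofReal (H x) := by
  have hmeas (F : ℝ → ℝ) : Measurable fun r => volume {a | r < F a} :=
    Antitone.measurable fun _ _ hab => measure_mono fun _ hx => hab.trans_lt hx
  rw [lintegral_eq_lintegral_meas_lt _ (.of_forall hF0) hF.aemeasurable,
    lintegral_eq_lintegral_meas_lt _ (.of_forall hG0) hG.aemeasurable,
    lintegral_eq_lintegral_meas_lt _ (.of_forall hH0) hH.aemeasurable,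
    ← lintegral_const_mul _ (hmeas F), ← lintegral_const_mul _ (hmeas G),
    ← lintegral_add_left ((hmeas F).const_mul _)]
  refine setLIntegral_mono' measurableSet_Ioi fun r hr => ?_
  rcases lt_or_ge r 1 with h1 | h1
  · exact Real.ofReal_mul_volume_add_le hs ht (measurableSet_lt measurable_const hF)
      (measurableSet_lt measurable_const hG) (hFsup r h1) (hGsup r h1)
      fun x hx y hy => hle x y r hr hx hy
  · have h (F : ℝ → ℝ) (hF1 : ∀ x, F x ≤ 1) : {a | r < F a} = ∅ := by
      ext a
      simpa using (hF1 a).trans h1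
    simp [h F hF1, h G hG1]

/-- Weighted arithmetic-geometric mean inequality for extended nonnegative reals. -/
theorem ENNReal.rpow_mul_rpow_le_ofReal_mul_add {a b : ENNReal} {s t : ℝ} (hs : 0 < s)
    (ht : 0 < t) (hst : s + t = 1) :
    a ^ s * b ^ t ≤ ENNReal.ofReal s * a + ENNReal.ofReal t * b := by
  rcases eq_or_ne a ⊤ with rfl | ha
  · simp [ENNReal.mul_top, hs]
  rcases eq_or_ne b ⊤ with rfl | hb
  · simp [ENNReal.mul_top, ht]
  lift a to NNReal using ha
  lift b to NNReal using hb
  have h := NNReal.geom_mean_le_arith_mean2_weighted s.toNNReal t.toNNReal a b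
    (by rw [← Real.toNNReal_add hs.le ht.le, hst, Real.toNNReal_one])
  rw [Real.coe_toNNReal _ hs.le, Real.coe_toNNReal _ ht.le] at h
  rw [← ENNReal.coe_rpow_of_nonneg _ hs.le, ← ENNReal.coe_rpow_of_nonneg _ ht.le]
  simpa [ENNReal.ofReal] using ENNReal.coe_le_coe.2 h

/-- One-dimensional Prékopa–Leindler inequality for bounded functions. -/
theorem Real.lintegral_rpow_mul_lintegral_rpow_le {f g h : ℝ → ENNReal} {s t : ℝ} (hs : 0 < s)
    (ht : 0 < t) (hst : s + t = 1) (hf : Measurable f) (hg : Measurable g) (hh : Measurable h)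
    (hfb : ⨆ x, f x ≠ ⊤) (hgb : ⨆ x, g x ≠ ⊤)
    (hle : ∀ x y, f x ^ s * g y ^ t ≤ h (s * x + t * y)) :
    (∫⁻ x, f x) ^ s * (∫⁻ x, g x) ^ t ≤ ∫⁻ x, h x := by
  set S := ⨆ x, f x with hS
  set T := ⨆ x, g x with hT
  rcases eq_or_ne S 0 with hS0 | hS0
  · have : ∀ x, f x = 0 := by simpa [hS] using hS0
    simp [this, hs]
  rcases eq_or_ne T 0 with hT0 | hT0
  · have : ∀ x, g x = 0 := by simpa [hT] using hT0
    simp [this, ht]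
  have hfS (x) : f x / S ≤ 1 := ENNReal.div_le_of_le_mul (by simpa using le_iSup f x)
  have hgT (x) : g x / T ≤ 1 := ENNReal.div_le_of_le_mul (by simpa using le_iSup g x)
  set c := S ^ s * T ^ t with hc
  have hc0 : c ≠ 0 := by simp [hc, hS0, hT0, hfb, hgb]
  have hct : c ≠ ⊤ := ENNReal.mul_ne_top (ENNReal.rpow_ne_top_of_nonneg hs.le hfb)
    (ENNReal.rpow_ne_top_of_nonneg ht.le hgb)
  have hcinv : (S ^ s)⁻¹ * (T ^ t)⁻¹ = c⁻¹ :=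
    (ENNReal.mul_inv (.inr (ENNReal.rpow_ne_top_of_nonneg ht.le hgb))
      (.inl (ENNReal.rpow_ne_top_of_nonneg hs.le hfb))).symm
  have hsup (f : ℝ → ENNReal) (h0 : ⨆ x, f x ≠ 0) (hb : ⨆ x, f x ≠ ⊤)
      (h1 : ∀ x, f x / (⨆ x, f x) ≤ 1) (r : ℝ) (hr : r < 1) :
      ∃ x, r < (f x / ⨆ x, f x).toReal := by
    have : ENNReal.ofReal (max r 0) * (⨆ x, f x) < ⨆ x, f x := by
      conv_rhs => rw [← one_mul (⨆ x, f x)]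
      exact ENNReal.mul_lt_mul_left h0 hb (by simpa using hr)
    obtain ⟨x, hx⟩ := lt_iSup_iff.1 this
    have hx' : ENNReal.ofReal (max r 0) < f x / ⨆ x, f x :=
      (ENNReal.lt_div_iff_mul_lt (.inl h0) (.inl hb)).2 hx
    exact ⟨x, (le_max_left r 0).trans_lt ((ENNReal.ofReal_lt_iff_lt_toReal (le_max_right r 0)
      ((h1 x).trans_lt ENNReal.one_lt_top).ne).1 hx')⟩
  have key := Real.lintegral_ofReal_add_le (F := fun x => (f x / S).toReal)
    (G := fun x => (g x / T).toReal) (H := fun x => (min (h x / c) 1).toReal) hs ht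
    (by fun_prop) (by fun_prop) (by fun_prop) (fun _ => ENNReal.toReal_nonneg)
    (fun _ => ENNReal.toReal_nonneg) (fun _ => ENNReal.toReal_nonneg)
    (fun x => ENNReal.toReal_le_of_le_ofReal zero_le_one (by simpa using hfS x))
    (fun x => ENNReal.toReal_le_of_le_ofReal zero_le_one (by simpa using hgT x))
    (hsup f hS0 hfb hfS) (hsup g hT0 hgb hgT) ?_
  · have e1 (x) : ENNReal.ofReal (f x / S).toReal = f x / S :=
      ENNReal.ofReal_toReal ((hfS x).trans_lt ENNReal.one_lt_top).ne
    have e2 (x) : ENNReal.ofReal (g x / T).toReal = g x / T :=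
      ENNReal.ofReal_toReal ((hgT x).trans_lt ENNReal.one_lt_top).ne
    have e3 (x) : ENNReal.ofReal (min (h x / c) 1).toReal ≤ h x / c :=
      ENNReal.ofReal_toReal_le.trans (min_le_left _ _)
    have := (ENNReal.rpow_mul_rpow_le_ofReal_mul_add hs ht hst).trans
      (key.trans (lintegral_mono e3))
    simp only [e1, e2] at this
    simp only [div_eq_mul_inv] at this
    rw [lintegral_mul_const _ hf, lintegral_mul_const _ hg, lintegral_mul_const _ hh,
      ENNReal.mul_rpow_of_nonneg _ _ hs.le, ENNReal.mul_rpow_of_nonneg _ _ ht.le,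
      ENNReal.inv_rpow, ENNReal.inv_rpow, mul_mul_mul_comm,
      hcinv] at this
    exact (ENNReal.mul_le_mul_iff_left (ENNReal.inv_ne_zero.2 hct) (ENNReal.inv_ne_top.2 hc0)).1 this
  · intro x y r hr hx hy
    rw [← ENNReal.ofReal_lt_iff_lt_toReal hr.le (by simp)]
    rw [← ENNReal.ofReal_lt_iff_lt_toReal hr.le ((hfS x).trans_lt ENNReal.one_lt_top).ne] at hx
    rw [← ENNReal.ofReal_lt_iff_lt_toReal hr.le ((hgT y).trans_lt ENNReal.one_lt_top).ne] at hy
    refine lt_min (lt_of_lt_of_le ?_ (ENNReal.div_le_div_right (hle x y) c)) (hx.trans_le (hfS x))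
    have e : f x ^ s * g y ^ t / c = (f x / S) ^ s * (g y / T) ^ t := by
      rw [ENNReal.div_rpow_of_nonneg _ _ hs.le, ENNReal.div_rpow_of_nonneg _ _ ht.le]
      simp only [div_eq_mul_inv]
      rw [mul_mul_mul_comm, hcinv]
    rw [e]
    calc ENNReal.ofReal r = ENNReal.ofReal r ^ s * ENNReal.ofReal r ^ t := by
          rw [← ENNReal.rpow_add_of_nonneg _ _ hs.le ht.le, hst, ENNReal.rpow_one]
      _ < _ := ENNReal.mul_lt_mul (ENNReal.rpow_lt_rpow hx hs) (ENNReal.rpow_lt_rpow hy ht)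

/-- Multiplicative Brunn–Minkowski inequality for bounded measurable sets of `Fin n → ℝ`. -/
theorem volume_rpow_mul_volume_rpow_le_fin {n : ℕ} {A B C : Set (Fin n → ℝ)} {s t R : ℝ}
    (hs : 0 < s) (ht : 0 < t) (hst : s + t = 1) (hA : MeasurableSet A) (hB : MeasurableSet B)
    (hC : MeasurableSet C) (hAR : ∀ a ∈ A, ∀ i, |a i| ≤ R) (hBR : ∀ b ∈ B, ∀ i, |b i| ≤ R)
    (h : ∀ a ∈ A, ∀ b ∈ B, s • a + t • b ∈ C) :
    volume A ^ s * volume B ^ t ≤ volume C := by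
  induction n with
  | zero =>
    rcases A.eq_empty_or_nonempty with rfl | ⟨a, ha⟩
    · simp [hs]
    rcases B.eq_empty_or_nonempty with rfl | ⟨b, hb⟩
    · simp [ht]
    have e (D : Set (Fin 0 → ℝ)) (d) (hd : d ∈ D) : D = Set.univ :=
      Set.eq_univ_of_forall fun x => Subsingleton.elim d x ▸ hd
    rw [e A a ha, e B b hb, e C _ (h a ha b hb)]
    simp [volume_pi]
  | succ n ih =>
    let e := MeasurableEquiv.piFinSuccAbove (fun _ : Fin (n + 1) => ℝ) 0
    have hs' (D : Set (Fin (n + 1) → ℝ)) (x : ℝ) : Prod.mk x ⁻¹' (e.symm ⁻¹' D) =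
        (fun y : Fin n → ℝ => (Fin.cons x y : Fin (n + 1) → ℝ)) ⁻¹' D := by
      ext y
      have : e.symm (x, y) = (Fin.cons x y : Fin (n + 1) → ℝ) := by
        simp [e, MeasurableEquiv.piFinSuccAbove, Fin.consEquiv]
      simp [this]
    have hv (D : Set (Fin (n + 1) → ℝ)) (hD : MeasurableSet D) :
        volume D = ∫⁻ x, volume ((fun y : Fin n → ℝ => (Fin.cons x y : Fin (n + 1) → ℝ)) ⁻¹' D) := by
      have h1 := (volume_preserving_piFinSuccAbove (fun _ : Fin (n + 1) => ℝ) 0).symm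
        |>.measure_preimage_equiv D
      rw [← h1, Measure.volume_eq_prod, Measure.prod_apply (e.symm.measurable hD)]
      exact lintegral_congr fun x => congrArg volume (hs' D x)
    have hm (D : Set (Fin (n + 1) → ℝ)) (hD : MeasurableSet D) (x : ℝ) :
        MeasurableSet ((fun y : Fin n → ℝ => (Fin.cons x y : Fin (n + 1) → ℝ)) ⁻¹' D) :=
      hs' D x ▸ measurable_prodMk_left (e.symm.measurable hD)
    have hv' (D : Set (Fin (n + 1) → ℝ)) (hD : MeasurableSet D) :
        Measurable fun x => volume ((fun y : Fin n → ℝ => (Fin.cons x y : Fin (n + 1) → ℝ)) ⁻¹' D) := by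
      have := measurable_measure_prodMk_left (ν := (volume : Measure (Fin n → ℝ)))
        (e.symm.measurable hD)
      simpa only [hs'] using this
    have hb (D : Set (Fin (n + 1) → ℝ)) (hD : ∀ a ∈ D, ∀ i, |a i| ≤ R) :
        ⨆ x, volume ((fun y : Fin n → ℝ => (Fin.cons x y : Fin (n + 1) → ℝ)) ⁻¹' D) ≠ ⊤ := by
      refine ne_top_of_le_ne_top
        (isCompact_Icc (a := fun _ : Fin n => -R) (b := fun _ => R)).measure_lt_top.ne
        (iSup_le fun x => measure_mono fun y hy => ?_)
      have h1 (i : Fin n) := abs_le.1 (by simpa using hD _ hy i.succ)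
      exact ⟨fun i => (h1 i).1, fun i => (h1 i).2⟩
    rw [hv A hA, hv B hB, hv C hC]
    refine Real.lintegral_rpow_mul_lintegral_rpow_le hs ht hst (hv' A hA) (hv' B hB) (hv' C hC)
      (hb A hAR) (hb B hBR) fun x x' => ih (hm A hA x) (hm B hB x') (hm C hC _)
        (fun y hy i => by simpa using hAR _ hy i.succ)
        (fun y hy i => by simpa using hBR _ hy i.succ) fun y hy y' hz => ?_
    have e1 : (Fin.cons (s * x + t * x') (s • y + t • y') : Fin (n + 1) → ℝ) =
        s • (Fin.cons x y : Fin (n + 1) → ℝ) + t • (Fin.cons x' y' : Fin (n + 1) → ℝ) := by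
      ext i
      refine Fin.cases ?_ (fun j => ?_) i <;> simp
    rw [Set.mem_preimage, e1]
    exact h _ hy _ hz

/-- Multiplicative Brunn–Minkowski inequality for bounded measurable sets of `ι → ℝ`. -/
theorem volume_rpow_mul_volume_rpow_le {ι : Type*} [Fintype ι] {A B C : Set (ι → ℝ)} {s t R : ℝ}
    (hs : 0 < s) (ht : 0 < t) (hst : s + t = 1) (hA : MeasurableSet A) (hB : MeasurableSet B)
    (hC : MeasurableSet C) (hAR : ∀ a ∈ A, ∀ i, |a i| ≤ R) (hBR : ∀ b ∈ B, ∀ i, |b i| ≤ R)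
    (h : ∀ a ∈ A, ∀ b ∈ B, s • a + t • b ∈ C) :
    volume A ^ s * volume B ^ t ≤ volume C := by
  let f := (Fintype.equivFin ι).symm
  let e := MeasurableEquiv.piCongrLeft (fun _ : ι => ℝ) f
  have he (x i) : e x (f i) = x i := Equiv.piCongrLeft_apply_apply (fun _ : ι => ℝ) f x i
  have hv (D : Set (ι → ℝ)) : volume (e ⁻¹' D) = volume D :=
    (volume_measurePreserving_piCongrLeft (fun _ : ι => ℝ) f).measure_preimage_equiv D
  rw [← hv A, ← hv B, ← hv C]
  refine volume_rpow_mul_volume_rpow_le_fin hs ht hst (e.measurable hA) (e.measurable hB)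
    (e.measurable hC) (R := R) (fun a ha i => ?_) (fun b hb i => ?_) fun a ha b hb => ?_
  · simpa [he] using hAR _ ha (f i)
  · simpa [he] using hBR _ hb (f i)
  · have : e (s • a + t • b) = s • e a + t • e b := by
      ext i
      obtain ⟨j, rfl⟩ := f.surjective i
      simp [he]
    simpa [this] using h _ ha _ hb

theorem psum_combo {n : ℕ} (nu nu' : Fin n → ℝ) (s t : ℝ) (k : ℕ) :
    psum (fun i => s * nu i + t * nu' i) k = s * psum nu k + t * psum nu' k := by
  simp only [psum, Finset.mul_sum, ← Finset.sum_add_distrib]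
  refine Finset.sum_congr rfl fun i _ => ?_
  split_ifs <;> simp

theorem psum_succ {n : ℕ} (f : Fin n → ℝ) (i : Fin n) :
    psum f (i.val + 1) = psum f i.val + f i := by
  have h : f i = ∑ j : Fin n, if j = i then f j else 0 := by simp
  rw [psum, psum, h, ← Finset.sum_add_distrib]
  refine Finset.sum_congr rfl fun j _ => ?_
  have : j = i ↔ j.val = i.val := Fin.ext_iff
  split_ifs <;> first | omega | simp

theorem psum_self {n : ℕ} (f : Fin n → ℝ) : psum f n = ∑ i, f i := by
  simp [psum]

theorem hiveVal_combo {n : ℕ} (lam mu nu nu' : Fin n → ℝ) (g g' : HiveInterior n → ℝ) {s t : ℝ}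
    (hst : s + t = 1) (i j : ℕ) :
    hiveVal lam mu (fun i => s * nu i + t * nu' i) (s • g + t • g') i j =
      s * hiveVal lam mu nu g i j + t * hiveVal lam mu nu' g' i j := by
  obtain rfl : t = 1 - s := by linarith
  unfold hiveVal
  split_ifs
  · simp
  · ring
  · ring
  · exact psum_combo ..

theorem IsDiscreteConcave.combo {n : ℕ} {h h' : ℕ → ℕ → ℝ} (hh : IsDiscreteConcave n h)
    (hh' : IsDiscreteConcave n h') {s t : ℝ} (hs : 0 ≤ s) (ht : 0 ≤ t) :
    IsDiscreteConcave n fun i j => s * h i j + t * h' i j := by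
  obtain ⟨h1, h2, h3⟩ := hh
  obtain ⟨h1', h2', h3'⟩ := hh'
  refine ⟨fun i j hi hj => ?_, fun i j hi hj => ?_, fun i j hi hj => ?_⟩
  · nlinarith [mul_nonneg hs (neg_nonneg.2 (h1 i j hi hj)),
      mul_nonneg ht (neg_nonneg.2 (h1' i j hi hj))]
  · nlinarith [mul_nonneg hs (neg_nonneg.2 (h2 i j hi hj)),
      mul_nonneg ht (neg_nonneg.2 (h2' i j hi hj))]
  · nlinarith [mul_nonneg hs (neg_nonneg.2 (h3 i j hi hj)),
      mul_nonneg ht (neg_nonneg.2 (h3' i j hi hj))]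

theorem combo_mem_hivePolytope {n : ℕ} {lam mu nu nu' : Fin n → ℝ} {g g' : HiveInterior n → ℝ}
    (hg : g ∈ hivePolytope n lam mu nu) (hg' : g' ∈ hivePolytope n lam mu nu') {s t : ℝ}
    (hs : 0 ≤ s) (ht : 0 ≤ t) (hst : s + t = 1) :
    s • g + t • g' ∈ hivePolytope n lam mu fun i => s * nu i + t * nu' i := by
  have h := IsDiscreteConcave.combo hg hg' hs ht
  simp only [← hiveVal_combo lam mu nu nu' g g' hst] at h
  exact h

theorem continuous_hiveVal {n : ℕ} (lam mu nu : Fin n → ℝ) (i j : ℕ) :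
    Continuous fun g => hiveVal lam mu nu g i j := by
  unfold hiveVal
  split_ifs <;> fun_prop

theorem isClosed_hivePolytope {n : ℕ} (lam mu nu : Fin n → ℝ) :
    IsClosed (hivePolytope n lam mu nu) := by
  have hc := continuous_hiveVal lam mu nu
  simp only [hivePolytope, IsDiscreteConcave, Set.ofPred_and, Set.ofPred_forall]
  refine .inter ?_ (.inter ?_ ?_) <;>
    refine isClosed_iInter fun i => isClosed_iInter fun j => isClosed_iInter fun _ =>
      isClosed_iInter fun _ => isClosed_le ?_ continuous_const <;> fun_prop

theorem hiveVal_zero_left {n : ℕ} (lam mu nu : Fin n → ℝ) (g : HiveInterior n → ℝ) (j : ℕ) :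
    hiveVal lam mu nu g 0 j = psum lam j := by
  simp [hiveVal]

theorem hiveVal_right {n : ℕ} (lam mu nu : Fin n → ℝ) (g : HiveInterior n → ℝ) (i : ℕ) :
    hiveVal lam mu nu g i n = psum lam n + psum mu i := by
  rcases eq_or_ne i 0 with rfl | hi
  · simp [hiveVal, psum]
  · simp [hiveVal, hi]

theorem hiveVal_diag {n : ℕ} {lam mu nu : Fin n → ℝ}
    (hsum : ∑ i, nu i = ∑ i, lam i + ∑ i, mu i) (g : HiveInterior n → ℝ) (i : ℕ) :
    hiveVal lam mu nu g i i = psum nu i := by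
  rcases eq_or_ne i 0 with rfl | hi
  · simp [hiveVal, psum]
  rcases eq_or_ne i n with rfl | hn
  · simp [hiveVal, hi, psum_self, hsum]
  · simp [hiveVal, hi, hn]

theorem hivePolytope_bounded {n : ℕ} (lam mu : Fin n → ℝ) :
    ∃ R, ∀ nu, ∀ g ∈ hivePolytope n lam mu nu, ∀ p, |g p| ≤ R := by
  set M := ∑ i, |mu i|
  set Λ := ∑ i, |lam i|
  refine ⟨Λ + n * M, fun nu g hg p => ?_⟩
  obtain ⟨h1, h2, -⟩ := hg
  set h := hiveVal lam mu nu g with hh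
  have hM0 : 0 ≤ M := Finset.sum_nonneg fun _ _ => abs_nonneg _
  have hedge (i : ℕ) (hi : i < n) : |h (i + 1) n - h i n| ≤ M := by
    have e : h (i + 1) n - h i n = mu ⟨i, hi⟩ := by
      rw [hh, hiveVal_right, hiveVal_right, psum_succ mu ⟨i, hi⟩]
      ring
    rw [e]
    exact Finset.single_le_sum (f := fun i => |mu i|) (fun _ _ => abs_nonneg _)
      (Finset.mem_univ _)
  have hupper (k : ℕ) : ∀ i j, i + 1 ≤ j → j + k = n → h (i + 1) j - h i j ≤ M := by
    induction k with
    | zero =>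
      rintro i j hi rfl
      exact (abs_le.1 (hedge i (by omega))).2
    | succ k ih =>
      intro i j hi hj
      linarith [h2 i j hi (by omega), ih i (j + 1) (by omega) (by omega)]
  have hlower (k : ℕ) : ∀ i j, i + 1 ≤ j → j + k = n → -M ≤ h (i + 1) j - h i j := by
    induction k with
    | zero =>
      rintro i j hi rfl
      exact (abs_le.1 (hedge i (by omega))).1
    | succ k ih =>
      intro i j hi hj
      linarith [h1 i j hi (by omega), ih (i + 1) (j + 1) (by omega) (by omega)]
  have hval (j : ℕ) (hj : j ≤ n) (i : ℕ) : i ≤ j → |h i j| ≤ Λ + i * M := by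
    induction i with
    | zero =>
      intro _
      simp only [hh, hiveVal_zero_left, psum, Nat.cast_zero, zero_mul, add_zero]
      refine (Finset.abs_sum_le_sum_abs _ _).trans (Finset.sum_le_sum fun i _ => ?_)
      split_ifs <;> simp
    | succ i ih =>
      intro hi
      have a1 := abs_le.1 (ih (by omega))
      have a2 := hupper (n - j) i j hi (by omega)
      have a3 := hlower (n - j) i j hi (by omega)
      push_cast
      exact abs_le.2 ⟨by linarith, by linarith⟩
  obtain ⟨⟨i, j⟩, hi, hij⟩ := p
  have hg : h i j = g ⟨(i, j), hi, hij⟩ := by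
    simp only at hi hij
    simp [hh, hiveVal, hi, hij]
  rw [← hg]
  refine (hval j j.2.le i hij.le).trans ?_
  gcongr
  exact i.2.le

theorem antitone_of_nonempty_hivePolytope {n : ℕ} {lam mu nu : Fin n → ℝ}
    (hsum : ∑ i, nu i = ∑ i, lam i + ∑ i, mu i) (hne : (hivePolytope n lam mu nu).Nonempty) :
    Antitone nu := by
  obtain ⟨g, h1, -, h3⟩ := hne
  rcases n with _ | n
  · exact fun i => i.elim0
  refine Fin.antitone_iff_succ_le.2 fun i => ?_
  have a1 := h1 i (i + 1) le_rfl (by omega)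
  have a3 := h3 i i le_rfl (by omega)
  have e0 := psum_succ nu i.castSucc
  have e1 := psum_succ nu i.succ
  simp only [Fin.val_castSucc, Fin.val_succ] at e0 e1
  have b0 := hiveVal_diag hsum g i
  have b1 := hiveVal_diag hsum g (i + 1)
  have b2 := hiveVal_diag hsum g (i + 1 + 1)
  linarith

theorem vandermonde_nonneg {n : ℕ} {nu : Fin n → ℝ} (h : Antitone nu) : 0 ≤ vandermonde nu :=
  Finset.prod_nonneg fun _ hp => sub_nonneg.2 (h (Finset.mem_filter.1 hp).2.le)

theorem vandermonde_rpow_mul_rpow_le {n : ℕ} {nu nu' : Fin n → ℝ} (h : Antitone nu)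
    (h' : Antitone nu') {s t : ℝ} (hs : 0 ≤ s) (ht : 0 ≤ t) (hst : s + t = 1) :
    vandermonde nu ^ s * vandermonde nu' ^ t ≤ vandermonde fun i => s * nu i + t * nu' i := by
  have hn {f : Fin n → ℝ} (hf : Antitone f) :
      ∀ p ∈ Finset.univ.filter (fun p : Fin n × Fin n => p.1 < p.2), 0 ≤ f p.1 - f p.2 :=
    fun p hp => sub_nonneg.2 (hf (Finset.mem_filter.1 hp).2.le)
  rw [vandermonde, vandermonde, ← Real.finsetProd_rpow _ _ (hn h),
    ← Real.finsetProd_rpow _ _ (hn h'), ← Finset.prod_mul_distrib]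
  refine Finset.prod_le_prod (fun p hp => mul_nonneg (Real.rpow_nonneg (hn h p hp) _)
    (Real.rpow_nonneg (hn h' p hp) _)) fun p hp => ?_
  refine (Real.geom_mean_le_arith_mean2_weighted hs ht (hn h p hp) (hn h' p hp) hst).trans_eq ?_
  ring

theorem volume_hivePolytope_ne_top {n : ℕ} (lam mu nu : Fin n → ℝ) :
    volume (hivePolytope n lam mu nu) ≠ ⊤ := by
  obtain ⟨R, hR⟩ := hivePolytope_bounded lam mu
  refine ne_top_of_le_ne_top
    (isCompact_Icc (a := fun _ : HiveInterior n => -R) (b := fun _ => R)).measure_lt_top.ne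
    (measure_mono fun g hg => ?_)
  exact ⟨fun p => (abs_le.1 (hR nu g hg p)).1, fun p => (abs_le.1 (hR nu g hg p)).2⟩

theorem volume_hivePolytope_rpow_mul_rpow_le {n : ℕ} (lam mu nu nu' : Fin n → ℝ) {s t : ℝ}
    (hs : 0 < s) (ht : 0 < t) (hst : s + t = 1) :
    (volume (hivePolytope n lam mu nu)).toReal ^ s *
        (volume (hivePolytope n lam mu nu')).toReal ^ t ≤
      (volume (hivePolytope n lam mu fun i => s * nu i + t * nu' i)).toReal := by
  obtain ⟨R, hR⟩ := hivePolytope_bounded lam mu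
  rw [ENNReal.toReal_rpow, ENNReal.toReal_rpow, ← ENNReal.toReal_mul]
  refine ENNReal.toReal_mono (volume_hivePolytope_ne_top _ _ _) ?_
  exact volume_rpow_mul_volume_rpow_le hs ht hst (isClosed_hivePolytope ..).measurableSet
    (isClosed_hivePolytope ..).measurableSet (isClosed_hivePolytope ..).measurableSet
    (hR nu) (hR nu') fun g hg g' hg' => combo_mem_hivePolytope hg hg' hs.le ht.le hst

theorem vandermonde_mul_volume_hivePolytope_nonneg {n : ℕ} {lam mu nu : Fin n → ℝ}
    (hsum : ∑ i, nu i = ∑ i, lam i + ∑ i, mu i) :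
    0 ≤ vandermonde nu * (volume (hivePolytope n lam mu nu)).toReal := by
  rcases (hivePolytope n lam mu nu).eq_empty_or_nonempty with h | h
  · simp [h]
  · exact mul_nonneg (vandermonde_nonneg (antitone_of_nonempty_hivePolytope hsum h))
      ENNReal.toReal_nonneg

/-- For fixed strictly decreasing `λ, μ ∈ ℝⁿ`, the function
`G(ν) = V(ν) · Vol(HIVE_{λ⊞μ→ν})` is log-concave on the hyperplane
`{ν : ∑ν = ∑λ + ∑μ}`:  `G(tν + (1−t)ν') ≥ G(ν)^t G(ν')^{1−t}`. -/
theorem hive_volume_log_concave (n : ℕ) (hn : 2 ≤ n) (lam mu : Fin n → ℝ)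
    (hlam : StrictAnti lam) (hmu : StrictAnti mu) :
    ∀ nu nu' : Fin n → ℝ,
      (∑ i, nu i) = (∑ i, lam i) + (∑ i, mu i) →
      (∑ i, nu' i) = (∑ i, lam i) + (∑ i, mu i) →
      ∀ t : ℝ, t ∈ Set.Icc (0 : ℝ) 1 →
        (vandermonde nu * (volume (hivePolytope n lam mu nu)).toReal) ^ t *
            (vandermonde nu' * (volume (hivePolytope n lam mu nu')).toReal) ^ (1 - t) ≤
          vandermonde (fun i => t * nu i + (1 - t) * nu' i) *
            (volume (hivePolytope n lam mu (fun i => t * nu i + (1 - t) * nu' i))).toReal := by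
  intro nu nu' hsum hsum' t ht
  rcases ht.1.eq_or_lt with rfl | ht0
  · simp
  rcases ht.2.eq_or_lt with rfl | ht1
  · simp
  have ht1' : 0 < 1 - t := by linarith
  have hst : t + (1 - t) = 1 := by ring
  have hsum'' : ∑ i, (t * nu i + (1 - t) * nu' i) = ∑ i, lam i + ∑ i, mu i := by
    rw [Finset.sum_add_distrib, ← Finset.mul_sum, ← Finset.mul_sum, hsum, hsum']
    ring
  have hnn := vandermonde_mul_volume_hivePolytope_nonneg hsum''
  rcases (hivePolytope n lam mu nu).eq_empty_or_nonempty with h | h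
  · simpa [h, Real.zero_rpow ht0.ne'] using hnn
  rcases (hivePolytope n lam mu nu').eq_empty_or_nonempty with h' | h'
  · simpa [h', Real.zero_rpow ht1'.ne'] using hnn
  have ha := antitone_of_nonempty_hivePolytope hsum h
  have ha' := antitone_of_nonempty_hivePolytope hsum' h'
  rw [Real.mul_rpow (vandermonde_nonneg ha) ENNReal.toReal_nonneg,
    Real.mul_rpow (vandermonde_nonneg ha') ENNReal.toReal_nonneg, mul_mul_mul_comm]
  have hv := vandermonde_rpow_mul_rpow_le ha ha' ht0.le ht1'.le hst
  refine mul_le_mul hv (volume_hivePolytope_rpow_mul_rpow_le lam mu nu nu' ht0 ht1' hst)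
    (by positivity) (le_trans ?_ hv)
  exact mul_nonneg (Real.rpow_nonneg (vandermonde_nonneg ha) _)
    (Real.rpow_nonneg (vandermonde_nonneg ha') _)
end
end

section
/- Let n ∈ ℕ and let v = (i,j) be an interior lattice point of {0,…,n}², and let ⬡_v^n be the excavation hexagon centered at v. If f = (f_up, f_lo) is an asymptotic height function pair for ⬡_v^n, then there exists a height function pair f_n = (f_{n,up}, f_{n,lo}) for ⬡_v^n (arising from a lozenge tiling of ⬡_v^n) such that |f(u) − f_n(u)| < 3 for every lattice point u of ⬡_v^n (comparing the 'up' components on the upper trapezoid and the 'lo' components on the lower trapezoid). -/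
open Pointwise

noncomputable section

/-- Lattice points of the triangular lattice, identified with `ℤ²`. -/
abbrev LPt : Type := ℤ × ℤ

/-- The positive directions `î`, `−ĵ`, `−î+ĵ`. -/
def PosDir : Set LPt := {(1, 0), (0, -1), (-1, 1)}

/-- The planar embedding of a lattice point. -/
def toR2 (p : LPt) : ℝ × ℝ := ((p.1 : ℝ), (p.2 : ℝ))

/-- The six vertices `A, B, C, D, E, F` of the excavation hexagon `⬡_v^n` centered at the
interior point `v = (i, j)` of `{0,…,n}²`. -/
def hexVerts (n i j : ℤ) : Set LPt :=
  if i ≤ j then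
    {(0, n), (0, j), (i, j - i), (n + i - j, j - i), (n + i - j, j), (i, n)}
  else
    {(i - j, n + j - i), (i - j, j), (i, 0), (n, 0), (n, j), (i, n + j - i)}

/-- The excavation hexagon as a planar region (it is convex, being the convex hull of its six
vertices). -/
def hexRegion (n i j : ℤ) : Set (ℝ × ℝ) := convexHull ℝ (toR2 '' hexVerts n i j)

/-- The upper trapezoid `Z_up` of `⬡_v^n` (the part on or above the equator `{x + y = n}`). -/
def Zup (n i j : ℤ) : Set (ℝ × ℝ) := hexRegion n i j ∩ {q | (n : ℝ) ≤ q.1 + q.2}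

/-- The lower trapezoid `Z_lo` of `⬡_v^n` (the part on or below the equator). -/
def Zlo (n i j : ℤ) : Set (ℝ × ℝ) := hexRegion n i j ∩ {q | q.1 + q.2 ≤ (n : ℝ)}

/-- The westmost corner `A` of the hexagon, where the height functions are normalized. -/
def westCorner (n i j : ℤ) : LPt := if i ≤ j then (0, n) else (i - j, n + j - i)

/-- A unit step from `u` to `v` in a positive direction whose edge lies in the region `S`. -/
def IsStepIn (S : Set (ℝ × ℝ)) (u v : LPt) : Prop :=
  v - u ∈ PosDir ∧ segment ℝ (toR2 u) (toR2 v) ⊆ S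

/-- A height function pair `(f_up, f_lo)` on `⬡_v^n`, i.e. the pair of height functions of a
lozenge tiling of the hexagon: integer functions on the lattice points of the two trapezoids
obeying the local rule (along a positive unit step, `+1` along an edge of a tile and `−2`
across a tile), increasing by exactly `1` along each positive unit step of the outer boundary
of the hexagon, whose sum is linear of slope `1` on the equator, normalized at the westmost
corner. -/
def IsHeightPair (n i j : ℤ) (fup flo : LPt → ℤ) : Prop :=
  (∀ u v : LPt, IsStepIn (Zup n i j) u v → fup v - fup u = 1 ∨ fup v - fup u = -2) ∧
  (∀ u v : LPt, IsStepIn (Zlo n i j) u v → flo v - flo u = 1 ∨ flo v - flo u = -2) ∧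
  (∀ u v : LPt, v - u ∈ PosDir →
    segment ℝ (toR2 u) (toR2 v) ⊆ frontier (hexRegion n i j) →
    (toR2 u ∈ Zup n i j → toR2 v ∈ Zup n i j → fup v - fup u = 1) ∧
    (toR2 u ∈ Zlo n i j → toR2 v ∈ Zlo n i j → flo v - flo u = 1)) ∧
  (∀ u : LPt, u.1 + u.2 = n → toR2 u ∈ hexRegion n i j →
    toR2 (u + (1, -1)) ∈ hexRegion n i j →
    fup (u + (1, -1)) + flo (u + (1, -1)) = fup u + flo u + 1) ∧
  fup (westCorner n i j) = 0 ∧ flo (westCorner n i j) = 0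

/-- The gradient constraint set `K` (the convex hull of `2(î−ĵ)`, `2ĵ` and `−2î`), expressed
in the `ℤ²` coordinates used here for the triangular lattice: the convex hull of the three
gradients `(1,2), (1,−1), (−2,−1)` of the height functions of the three
single-lozenge-type tilings. -/
def Kset : Set (ℝ × ℝ) :=
  convexHull ℝ {((1 : ℝ), (2 : ℝ)), ((1 : ℝ), (-1 : ℝ)), ((-2 : ℝ), (-1 : ℝ))}

/-- An asymptotic height function pair `(F_up, F_lo)` on `⬡_v^n`: Lipschitz functions on the
two trapezoids whose gradients lie in `K` wherever they exist, which satisfy the same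
boundary conditions at lattice points as height function pairs do, and whose sum is linear
with derivative `1` on the equator. -/
def IsAsymptoticHeightPair (n i j : ℤ) (Fup Flo : ℝ × ℝ → ℝ) : Prop :=
  (∃ K : NNReal, LipschitzOnWith K Fup (Zup n i j)) ∧
  (∃ K : NNReal, LipschitzOnWith K Flo (Zlo n i j)) ∧
  (∀ q ∈ Zup n i j, ∀ L : ℝ × ℝ →L[ℝ] ℝ, HasFDerivAt Fup L q →
    (L (1, 0), L (0, 1)) ∈ Kset) ∧
  (∀ q ∈ Zlo n i j, ∀ L : ℝ × ℝ →L[ℝ] ℝ, HasFDerivAt Flo L q →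
    (L (1, 0), L (0, 1)) ∈ Kset) ∧
  (∀ u v : LPt, v - u ∈ PosDir →
    segment ℝ (toR2 u) (toR2 v) ⊆ frontier (hexRegion n i j) →
    (toR2 u ∈ Zup n i j → toR2 v ∈ Zup n i j → Fup (toR2 v) = Fup (toR2 u) + 1) ∧
    (toR2 u ∈ Zlo n i j → toR2 v ∈ Zlo n i j → Flo (toR2 v) = Flo (toR2 u) + 1)) ∧
  (∀ q ∈ hexRegion n i j, ∀ q' ∈ hexRegion n i j,
    q.1 + q.2 = (n : ℝ) → q'.1 + q'.2 = (n : ℝ) →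
    (Fup q' + Flo q') - (Fup q + Flo q) = q'.1 - q.1) ∧
  Fup (toR2 (westCorner n i j)) = 0 ∧ Flo (toR2 (westCorner n i j)) = 0

section LipschitzIncrement

open MeasureTheory Filter Topology

variable {E : Type*} [NormedAddCommGroup E] [NormedSpace ℝ E] [FiniteDimensional ℝ E]

/-- If a Lipschitz function has slope at most `C` in the direction `d` wherever it is
differentiable in the interior of a convex set, then it grows by at most `C` along `d`
between two interior points. -/
theorem increment_le_of_mem_interior {S : Set E} (hS : Convex ℝ S) {F : E → ℝ} {K : NNReal}
    (hF : LipschitzOnWith K F S) {d : E} {C : ℝ}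
    (hd : ∀ q ∈ S, ∀ L : E →L[ℝ] ℝ, HasFDerivAt F L q → L d ≤ C)
    {q : E} (hq : q ∈ interior S) (hqd : q + d ∈ interior S) : F (q + d) - F q ≤ C := by
  let _ : MeasurableSpace E := borel E
  have : BorelSpace E := ⟨rfl⟩
  let μ : Measure E := Measure.addHaar
  obtain ⟨G, hG, hFG⟩ := hF.extend_real
  have hGc := hG.continuous
  by_contra! hlt
  obtain ⟨C', hC, hC'⟩ := exists_between hlt
  have hev : ∀ᶠ x in 𝓝 q, x ∈ interior S ∧ x + d ∈ interior S ∧ C' < G (x + d) - G x := by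
    have hadd : Tendsto (fun x => x + d) (𝓝 q) (𝓝 (q + d)) :=
      (continuous_id.add continuous_const).tendsto q
    have hc : Continuous fun x => G (x + d) - G x := by fun_prop
    refine (isOpen_interior.eventually_mem hq).and
      ((hadd.eventually (isOpen_interior.eventually_mem hqd)).and ?_)
    refine hc.continuousAt.eventually_const_lt ?_
    rw [hFG (interior_subset hq), hFG (interior_subset hqd)] at hC'
    exact hC'
  obtain ⟨r, hr, hball⟩ := Metric.eventually_nhds_iff_ball.1 hev
  set B := Metric.ball q r
  have hBm : MeasurableSet B := Metric.isOpen_ball.measurableSet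
  have hBfin : μ B ≠ ⊤ := Metric.isBounded_ball.measure_lt_top.ne
  have : IsFiniteMeasure (μ.restrict B) := isFiniteMeasure_restrict.2 hBfin
  have hBpos : 0 < μ.real B :=
    ENNReal.toReal_pos (Metric.measure_ball_pos μ q hr).ne' hBfin
  have hint : ∀ s : ℝ, IntegrableOn (fun x => G (x + s • d)) B μ := fun s =>
    ((by fun_prop : Continuous fun x => G (x + s • d)).continuousOn.integrableOn_compact
      (isCompact_closedBall q r)).mono_set Metric.ball_subset_closedBall
  have hdiff : ∀ s : ℝ, ∀ᵐ x ∂μ, DifferentiableAt ℝ G (x + s • d) := fun s =>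
    (measurePreserving_add_right μ (s • d)).quasiMeasurePreserving.ae hG.ae_differentiableAt
  have hderiv : ∀ s : ℝ,
      IntegrableOn (fun x => lineDeriv ℝ G (x + s • d) d) B μ ∧
      HasDerivAt (fun t : ℝ => ∫ x in B, G (x + t • d) ∂μ)
        (∫ x in B, lineDeriv ℝ G (x + s • d) d ∂μ) s := by
    intro s
    refine hasDerivAt_integral_of_dominated_loc_of_lip (s := Set.univ)
      (bound := fun _ => (K : ℝ) * ‖d‖) univ_mem
      (Eventually.of_forall fun t => (hint t).aestronglyMeasurable) (hint s) ?_ ?_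
      (integrable_const _) ?_
    · exact ((measurable_lineDeriv hGc).comp (measurable_add_const _)).aestronglyMeasurable
    · refine Eventually.of_forall fun x => LipschitzWith.lipschitzOnWith ?_
      refine LipschitzWith.of_dist_le_mul fun t t' => ?_
      calc dist (G (x + t • d)) (G (x + t' • d))
          ≤ K * dist (x + t • d) (x + t' • d) := hG.dist_le_mul _ _
        _ = _ := by
          have : (0 : ℝ) ≤ K * ‖d‖ := by positivity
          rw [dist_add_left, dist_eq_norm, ← sub_smul, norm_smul, Real.dist_eq,
            Real.coe_nnabs, abs_of_nonneg this, Real.norm_eq_abs]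
          ring
    · refine ae_restrict_of_ae ((hdiff s).mono fun x hx => ?_)
      have h := hx.hasFDerivAt
      rw [hx.lineDeriv_eq_fderiv]
      have hline : HasDerivAt (fun t : ℝ => x + t • d) d s := by
        simpa using ((hasDerivAt_id s).smul_const d).const_add x
      exact h.comp_hasDerivAt s hline
  have hle : ∀ s ∈ Set.Ioo (0 : ℝ) 1,
      ∫ x in B, lineDeriv ℝ G (x + s • d) d ∂μ ≤ C * μ.real B := by
    intro s hs
    have hconst : ∫ _ in B, C ∂μ = C * μ.real B := by simp [mul_comm]
    rw [← hconst]
    refine integral_mono_ae (hderiv s).1 (integrable_const _) ?_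
    filter_upwards [ae_restrict_of_ae (hdiff s), ae_restrict_mem hBm] with x hx hxB
    obtain ⟨h0, h1, -⟩ := hball x hxB
    have hmem : x + s • d ∈ interior S := by
      have := hS.interior h0 h1 (sub_nonneg.2 hs.2.le) hs.1.le (by ring)
      convert this using 1
      module
    rw [hx.lineDeriv_eq_fderiv]
    refine hd _ (interior_subset hmem) _ (hx.hasFDerivAt.congr_of_eventuallyEq ?_)
    filter_upwards [isOpen_interior.mem_nhds hmem] with y hy using hFG (interior_subset hy)
  have hmvt := (convex_Icc (0 : ℝ) 1).image_sub_le_mul_sub_of_deriv_le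
    (f := fun t : ℝ => ∫ x in B, G (x + t • d) ∂μ) (C := C * μ.real B)
    (fun s _ => (hderiv s).2.continuousAt.continuousWithinAt)
    (fun s _ => (hderiv s).2.differentiableAt.differentiableWithinAt)
    (fun s hs => by
      rw [interior_Icc] at hs
      rw [(hderiv s).2.deriv]
      exact hle s hs) 0 (by simp) 1 (by simp) zero_le_one
  have hlow : C' * μ.real B ≤ ∫ x in B, (G (x + (1 : ℝ) • d) - G (x + (0 : ℝ) • d)) ∂μ := by
    have hconst : ∫ _ in B, C' ∂μ = C' * μ.real B := by simp [mul_comm]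
    rw [← hconst]
    refine setIntegral_mono_on (integrable_const _) ((hint 1).sub (hint 0)) hBm fun x hx => ?_
    simpa using (hball x hx).2.2.le
  rw [integral_sub (hint 1) (hint 0)] at hlow
  nlinarith

/-- If a Lipschitz function on a convex set with nonempty interior has slope at most `C` in the
direction `d` wherever it is differentiable, then it grows by at most `C` along `d`. -/
theorem increment_le_of_hasFDerivAt_le {S : Set E} (hS : Convex ℝ S)
    (hne : (interior S).Nonempty) {F : E → ℝ} {K : NNReal}
    (hF : LipschitzOnWith K F S) {d : E} {C : ℝ}
    (hd : ∀ q ∈ S, ∀ L : E →L[ℝ] ℝ, HasFDerivAt F L q → L d ≤ C)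
    {q : E} (hq : q ∈ S) (hqd : q + d ∈ S) : F (q + d) - F q ≤ C := by
  obtain ⟨c, hc⟩ := hne
  obtain ⟨G, hG, hFG⟩ := hF.extend_real
  have hGc := hG.continuous
  have hmem : ∀ t ∈ Set.Ioo (0 : ℝ) 1, ∀ x ∈ S, (1 - t) • x + t • c ∈ interior S :=
    fun t ht x hx => hS.combo_self_interior_mem_interior hx hc (sub_nonneg.2 ht.2.le) ht.1 (by ring)
  have hcont : Continuous fun t : ℝ =>
      G ((1 - t) • (q + d) + t • c) - G ((1 - t) • q + t • c) - (1 - t) * C := by fun_prop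
  have hle : ∀ᶠ t in 𝓝[>] (0 : ℝ),
      G ((1 - t) • (q + d) + t • c) - G ((1 - t) • q + t • c) - (1 - t) * C ≤ 0 := by
    filter_upwards [Ioo_mem_nhdsGT (zero_lt_one' ℝ)] with t ht
    have hx := hmem t ht q hq
    have hy := hmem t ht _ hqd
    have heq : (1 - t) • (q + d) + t • c = ((1 - t) • q + t • c) + (1 - t) • d := by module
    rw [← hFG (interior_subset hx), ← hFG (interior_subset hy)]
    rw [heq] at hy ⊢
    have := increment_le_of_mem_interior hS hF (d := (1 - t) • d) (C := (1 - t) * C)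
      (fun p hp L hL => by
        rw [map_smul, smul_eq_mul]
        exact mul_le_mul_of_nonneg_left (hd p hp L hL) (sub_nonneg.2 ht.2.le)) hx hy
    linarith
  have := le_of_tendsto (hcont.continuousWithinAt (s := Set.Ioi 0) (x := 0)) hle
  rw [hFG hq, hFG hqd]
  simpa using this

end LipschitzIncrement

/-- A convex planar set containing a nondegenerate triangle has nonempty interior. -/
theorem interior_nonempty_of_triangle {S : Set (ℝ × ℝ)} (hS : Convex ℝ S) {a p q : ℝ × ℝ}
    (ha : a ∈ S) (hp : a + p ∈ S) (hq : a + q ∈ S) (hdet : p.1 * q.2 - p.2 * q.1 ≠ 0) :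
    (interior S).Nonempty := by
  set D := p.1 * q.2 - p.2 * q.1 with hD
  let α : ℝ × ℝ → ℝ := fun w => ((w.1 - a.1) * q.2 - (w.2 - a.2) * q.1) / D
  let β : ℝ × ℝ → ℝ := fun w => (p.1 * (w.2 - a.2) - p.2 * (w.1 - a.1)) / D
  have hα : Continuous α := by fun_prop
  have hβ : Continuous β := by fun_prop
  have hopen : IsOpen {w | 0 < α w ∧ 0 < β w ∧ α w + β w < 1} :=
    (isOpen_lt continuous_const hα).inter
      ((isOpen_lt continuous_const hβ).inter (isOpen_lt (hα.add hβ) continuous_const))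
  have hsub : {w | 0 < α w ∧ 0 < β w ∧ α w + β w < 1} ⊆ S := by
    rintro w ⟨h1, h2, h3⟩
    have hw : w = (1 - α w - β w) • a + α w • (a + p) + β w • (a + q) := by
      ext
      · simp only [α, β, Prod.fst_add, Prod.smul_fst, smul_eq_mul]
        field_simp
        rw [hD]
        ring
      · simp only [α, β, Prod.snd_add, Prod.smul_snd, smul_eq_mul]
        field_simp
        rw [hD]
        ring
    have hpos : 0 < 1 - β w := by linarith
    have hcomb := hS (hS ha hp (div_nonneg (by linarith : 0 ≤ 1 - α w - β w) hpos.le)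
      (div_nonneg h1.le hpos.le) (by field_simp; ring)) hq hpos.le h2.le (by ring)
    rw [smul_add, smul_smul, smul_smul, mul_div_cancel₀ _ hpos.ne',
      mul_div_cancel₀ _ hpos.ne', ← hw] at hcomb
    exact hcomb
  refine ⟨a + (1 / 3 : ℝ) • p + (1 / 3 : ℝ) • q, interior_maximal hsub hopen ?_⟩
  have h1 : α (a + (1 / 3 : ℝ) • p + (1 / 3 : ℝ) • q) = 1 / 3 := by
    simp only [α, Prod.fst_add, Prod.snd_add, Prod.smul_fst, Prod.smul_snd, smul_eq_mul]
    field_simp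
    rw [hD]
    ring
  have h2 : β (a + (1 / 3 : ℝ) • p + (1 / 3 : ℝ) • q) = 1 / 3 := by
    simp only [β, Prod.fst_add, Prod.snd_add, Prod.smul_fst, Prod.smul_snd, smul_eq_mul]
    field_simp
    rw [hD]
    ring
  simp only [Set.mem_ofPred_eq, h1, h2]
  norm_num

theorem convex_Zup (n i j : ℤ) : Convex ℝ (Zup n i j) :=
  (convex_convexHull ℝ _).inter (convex_halfSpace_ge
    (IsLinearMap.mk (by intros; simp; ring) (by intros; simp; ring)) (n : ℝ))

theorem convex_Zlo (n i j : ℤ) : Convex ℝ (Zlo n i j) :=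
  (convex_convexHull ℝ _).inter (convex_halfSpace_le
    (IsLinearMap.mk (by intros; simp; ring) (by intros; simp; ring)) (n : ℝ))

theorem toR2_mem_hexRegion {n i j : ℤ} {u : LPt} (hu : u ∈ hexVerts n i j) :
    toR2 u ∈ hexRegion n i j :=
  subset_convexHull ℝ _ ⟨u, hu, rfl⟩

theorem toR2_add (u v : LPt) : toR2 (u + v) = toR2 u + toR2 v := by
  ext <;> simp [toR2]

theorem interior_Zup_nonempty {n i j : ℤ} (hi : 0 < i) (hi' : i < n) (hj : 0 < j) (hj' : j < n) :
    (interior (Zup n i j)).Nonempty := by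
  have hmem : ∀ u ∈ hexVerts n i j, n ≤ u.1 + u.2 → toR2 u ∈ Zup n i j := fun u hu hn =>
    ⟨toR2_mem_hexRegion hu, by simp only [toR2, Set.mem_ofPred_eq]; exact_mod_cast hn⟩
  by_cases hij : i ≤ j
  · refine interior_nonempty_of_triangle (convex_Zup n i j)
      (a := toR2 (0, n)) (p := toR2 (i, 0)) (q := toR2 (n + i - j, j - i - n)) ?_ ?_ ?_ ?_
    · exact hmem _ (by simp [hexVerts, hij]) (by simp)
    · rw [← toR2_add]
      exact hmem _ (by simp [hexVerts, hij]) (by simp; omega)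
    · rw [← toR2_add]
      exact hmem _ (by simp [hexVerts, hij]) (by simp)
    · simp only [toR2]
      norm_cast
      have : 0 < i * (n + i - j) := mul_pos hi (by omega)
      nlinarith
  · refine interior_nonempty_of_triangle (convex_Zup n i j)
      (a := toR2 (i - j, n + j - i)) (p := toR2 (j, 0)) (q := toR2 (n + j - i, i - j - n))
      ?_ ?_ ?_ ?_
    · exact hmem _ (by simp [hexVerts, hij]) (by simp)
    · rw [← toR2_add]
      exact hmem _ (by simp [hexVerts, hij]) (by simp; omega)
    · rw [← toR2_add]
      exact hmem _ (by simp [hexVerts, hij]; omega) (by simp; omega)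
    · simp only [toR2]
      norm_cast
      have : 0 < j * (n + j - i) := mul_pos hj (by omega)
      nlinarith

theorem interior_Zlo_nonempty {n i j : ℤ} (hi : 0 < i) (hi' : i < n) (hj : 0 < j) (hj' : j < n) :
    (interior (Zlo n i j)).Nonempty := by
  have hmem : ∀ u ∈ hexVerts n i j, u.1 + u.2 ≤ n → toR2 u ∈ Zlo n i j := fun u hu hn =>
    ⟨toR2_mem_hexRegion hu, by simp only [toR2, Set.mem_ofPred_eq]; exact_mod_cast hn⟩
  by_cases hij : i ≤ j
  · refine interior_nonempty_of_triangle (convex_Zlo n i j)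
      (a := toR2 (0, n)) (p := toR2 (0, j - n)) (q := toR2 (n + i - j, j - i - n)) ?_ ?_ ?_ ?_
    · exact hmem _ (by simp [hexVerts, hij]) (by simp)
    · rw [← toR2_add]
      exact hmem _ (by simp [hexVerts, hij]) (by simp; omega)
    · rw [← toR2_add]
      exact hmem _ (by simp [hexVerts, hij]) (by simp)
    · simp only [toR2]
      norm_cast
      have : 0 < (n - j) * (n + i - j) := mul_pos (by omega) (by omega)
      nlinarith
  · refine interior_nonempty_of_triangle (convex_Zlo n i j)
      (a := toR2 (i - j, n + j - i)) (p := toR2 (0, i - n)) (q := toR2 (n + j - i, i - j - n))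
      ?_ ?_ ?_ ?_
    · exact hmem _ (by simp [hexVerts, hij]) (by simp)
    · rw [← toR2_add]
      exact hmem _ (by simp [hexVerts, hij]) (by simp; omega)
    · rw [← toR2_add]
      exact hmem _ (by simp [hexVerts, hij]; omega) (by simp; omega)
    · simp only [toR2]
      norm_cast
      have : 0 < (n - i) * (n + j - i) := mul_pos (by omega) (by omega)
      nlinarith

/-- A gradient in `Kset` has slopes between `-2` and `1` along the positive directions. -/
theorem slope_bounds_of_mem_Kset {L : ℝ × ℝ →L[ℝ] ℝ} (hL : (L (1, 0), L (0, 1)) ∈ Kset)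
    {d : LPt} (hd : d ∈ PosDir) : -2 ≤ L (toR2 d) ∧ L (toR2 d) ≤ 1 := by
  have hexp : L (toR2 d) = d.1 * L (1, 0) + d.2 * L (0, 1) := by
    have : toR2 d = (d.1 : ℝ) • ((1, 0) : ℝ × ℝ) + (d.2 : ℝ) • ((0, 1) : ℝ × ℝ) := by
      ext <;> simp [toR2]
    rw [this, map_add, map_smul, map_smul, smul_eq_mul, smul_eq_mul]
  have hlin : IsLinearMap ℝ fun w : ℝ × ℝ => d.1 * w.1 + d.2 * w.2 :=
    IsLinearMap.mk (by intros; simp; ring) (by intros; simp; ring)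
  have hsub : Kset ⊆ {w | -2 ≤ (d.1 : ℝ) * w.1 + d.2 * w.2} ∩
      {w | (d.1 : ℝ) * w.1 + d.2 * w.2 ≤ 1} := by
    refine convexHull_min ?_ ((convex_halfSpace_ge hlin _).inter (convex_halfSpace_le hlin _))
    simp only [PosDir, Set.mem_insert_iff, Set.mem_singleton_iff] at hd
    rintro w hw
    simp only [Set.mem_insert_iff, Set.mem_singleton_iff] at hw
    rcases hd with rfl | rfl | rfl <;> rcases hw with rfl | rfl | rfl <;> norm_num
  rw [hexp]
  exact hsub hL

/-- Along a positive unit step, a Lipschitz function with gradients in `Kset` changes by a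
quantity between `-2` and `1`. -/
theorem step_bounds {S : Set (ℝ × ℝ)} (hS : Convex ℝ S) (hne : (interior S).Nonempty)
    {F : ℝ × ℝ → ℝ} {K : NNReal} (hF : LipschitzOnWith K F S)
    (hgrad : ∀ q ∈ S, ∀ L : ℝ × ℝ →L[ℝ] ℝ, HasFDerivAt F L q → (L (1, 0), L (0, 1)) ∈ Kset)
    {u v : LPt} (huv : IsStepIn S u v) :
    F (toR2 v) ≤ F (toR2 u) + 1 ∧ F (toR2 u) - 2 ≤ F (toR2 v) := by
  obtain ⟨hd, hseg⟩ := huv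
  have hu := hseg (left_mem_segment ℝ _ _)
  have hv := hseg (right_mem_segment ℝ _ _)
  have hvu : toR2 v = toR2 u + toR2 (v - u) := by rw [← toR2_add, add_sub_cancel]
  have huv' : toR2 u = toR2 v + -toR2 (v - u) := by rw [hvu]; abel
  have hup := increment_le_of_hasFDerivAt_le hS hne hF (d := toR2 (v - u)) (C := 1)
    (fun q hq L hL => (slope_bounds_of_mem_Kset (hgrad q hq L hL) hd).2) hu (hvu ▸ hv)
  have hdown := increment_le_of_hasFDerivAt_le hS hne hF (d := -toR2 (v - u)) (C := 2)
    (fun q hq L hL => by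
      rw [map_neg]
      linarith [(slope_bounds_of_mem_Kset (hgrad q hq L hL) hd).1]) hv (huv' ▸ hu)
  rw [← hvu] at hup
  rw [← huv'] at hdown
  constructor <;> linarith

/-- The largest integer congruent to `c` modulo `3` that is at most `x`. -/
def roundDown (c : ℤ) (x : ℝ) : ℤ := c + 3 * ⌊(x - c) / 3⌋

/-- The smallest integer congruent to `c` modulo `3` that is at least `x`. -/
def roundUp (c : ℤ) (x : ℝ) : ℤ := c + 3 * ⌈(x - c) / 3⌉

theorem roundDown_le (c : ℤ) (x : ℝ) : (roundDown c x : ℝ) ≤ x := by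
  have := Int.floor_le ((x - c) / 3)
  push_cast [roundDown]
  linarith

theorem lt_roundDown_add (c : ℤ) (x : ℝ) : x < roundDown c x + 3 := by
  have := Int.lt_floor_add_one ((x - c) / 3)
  push_cast [roundDown]
  linarith

theorem roundUp_eq_neg_roundDown (c : ℤ) (x : ℝ) : roundUp c x = -roundDown (-c) (-x) := by
  have : (-x - ((-c : ℤ) : ℝ)) / 3 = -((x - c) / 3) := by push_cast; ring
  rw [roundUp, roundDown, this, Int.floor_neg]
  ring

theorem roundDown_add_int (c m : ℤ) (x : ℝ) : roundDown (c + m) (x + m) = roundDown c x + m := by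
  have : (x + m - ((c + m : ℤ) : ℝ)) / 3 = (x - c) / 3 := by push_cast; ring
  rw [roundDown, roundDown, this]
  ring

theorem roundDown_congr {c c' : ℤ} (h : (3 : ℤ) ∣ c' - c) (x : ℝ) :
    roundDown c' x = roundDown c x := by
  obtain ⟨k, hk⟩ := h
  obtain rfl : c' = c + 3 * k := by linarith
  have : (x - ((c + 3 * k : ℤ) : ℝ)) / 3 = (x - c) / 3 - k := by push_cast; ring
  rw [roundDown, roundDown, this, Int.floor_sub_intCast]
  ring

theorem roundDown_mono (c : ℤ) {x y : ℝ} (h : x ≤ y) : roundDown c x ≤ roundDown c y := by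
  unfold roundDown
  gcongr

theorem roundDown_step {c c' : ℤ} (h : (3 : ℤ) ∣ c' - (c + 1)) {x y : ℝ}
    (h1 : y ≤ x + 1) (h2 : x - 2 ≤ y) :
    roundDown c' y - roundDown c x = 1 ∨ roundDown c' y - roundDown c x = -2 := by
  have e1 := roundDown_mono c' h1
  have e2 := roundDown_mono c' h2
  have k1 := roundDown_add_int c 1 x
  have k2 := roundDown_add_int c (-2) x
  push_cast at k1 k2
  rw [← roundDown_congr h] at k1
  rw [← roundDown_congr (show (3 : ℤ) ∣ c' - (c + -2) by omega), ← sub_eq_add_neg] at k2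
  have m : (3 : ℤ) ∣ roundDown c' y - roundDown c x - (c' - c) := by
    unfold roundDown
    omega
  omega

theorem roundDown_succ {c c' : ℤ} (h : (3 : ℤ) ∣ c' - (c + 1)) (x : ℝ) :
    roundDown c' (x + 1) - roundDown c x = 1 := by
  have := roundDown_add_int c 1 x
  push_cast at this
  rw [roundDown_congr h, this]
  ring

theorem roundUp_step {c c' : ℤ} (h : (3 : ℤ) ∣ c' - (c + 1)) {x y : ℝ}
    (h1 : y ≤ x + 1) (h2 : x - 2 ≤ y) :
    roundUp c' y - roundUp c x = 1 ∨ roundUp c' y - roundUp c x = -2 := by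
  have := roundDown_step (c := -c') (c' := -c) (by omega)
    (show -x ≤ -y + 1 by linarith) (by linarith)
  simpa [roundUp_eq_neg_roundDown, neg_add_eq_sub] using this

theorem roundUp_succ {c c' : ℤ} (h : (3 : ℤ) ∣ c' - (c + 1)) (x : ℝ) :
    roundUp c' (x + 1) - roundUp c x = 1 := by
  have := roundDown_succ (c := -c') (c' := -c) (by omega) (-(x + 1))
  rw [show -(x + 1) + 1 = -x by ring] at this
  rw [roundUp_eq_neg_roundDown, roundUp_eq_neg_roundDown]
  linarith

theorem roundDown_add_roundUp (k : ℤ) {x y : ℝ} (h : x + y = k) :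
    roundDown (2 * k) x + roundUp (2 * k) y = k := by
  rw [roundUp_eq_neg_roundDown, show -y = x + ((-k : ℤ) : ℝ) by push_cast; linarith,
    show -(2 * k) = -k + -k by ring, roundDown_add_int,
    roundDown_congr (show (3 : ℤ) ∣ 2 * k - -k by omega)]
  ring

/-- The difference of coordinates increases by `1` modulo `3` along positive directions. -/
theorem dvd_of_posDir {u v : LPt} (h : v - u ∈ PosDir) (a : ℤ) :
    (3 : ℤ) ∣ (v.1 - v.2 - a) - (u.1 - u.2 - a + 1) := by
  obtain ⟨x, y⟩ := u
  obtain ⟨x', y'⟩ := v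
  simp only [PosDir, Set.mem_insert_iff, Set.mem_singleton_iff, Prod.mk_sub_mk,
    Prod.mk.injEq] at h
  simp only
  omega

theorem westCorner_mem_hexRegion (n i j : ℤ) : toR2 (westCorner n i j) ∈ hexRegion n i j := by
  refine toR2_mem_hexRegion ?_
  by_cases hij : i ≤ j <;> simp [westCorner, hexVerts, hij]

theorem westCorner_fst_add_snd (n i j : ℤ) :
    (westCorner n i j).1 + (westCorner n i j).2 = n := by
  unfold westCorner
  split_ifs <;> simp

/-- Let `v = (i,j)` be an interior lattice point of `{0,…,n}²` and let
`⬡_v^n` be the excavation hexagon centered at `v`.  Every asymptotic height function pair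
`f = (f_up, f_lo)` for `⬡_v^n` is within `3` (at every lattice point of the respective
trapezoids) of an actual height function pair of a lozenge tiling of `⬡_v^n`. -/
theorem asymptotic_height_pair_approximation (n i j : ℤ)
    (hi : 0 < i) (hi' : i < n) (hj : 0 < j) (hj' : j < n)
    (Fup Flo : ℝ × ℝ → ℝ)
    (hF : IsAsymptoticHeightPair n i j Fup Flo) :
    ∃ fup flo : LPt → ℤ, IsHeightPair n i j fup flo ∧
      (∀ u : LPt, toR2 u ∈ Zup n i j → |Fup (toR2 u) - (fup u : ℝ)| < 3) ∧
      (∀ u : LPt, toR2 u ∈ Zlo n i j → |Flo (toR2 u) - (flo u : ℝ)| < 3) := by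
  obtain ⟨⟨Ku, hKu⟩, ⟨Kl, hKl⟩, hgu, hgl, hbd, heq, hwu, hwl⟩ := hF
  set w := westCorner n i j with hw
  have hwn : w.1 + w.2 = n := westCorner_fst_add_snd n i j
  have hwmem : toR2 w ∈ hexRegion n i j := westCorner_mem_hexRegion n i j
  let c : LPt → ℤ := fun u => u.1 - u.2 - (w.1 - w.2)
  have hc : ∀ {u v : LPt}, v - u ∈ PosDir → (3 : ℤ) ∣ c v - (c u + 1) :=
    fun h => dvd_of_posDir h _
  have hsum : ∀ u : LPt, u.1 + u.2 = n → toR2 u ∈ hexRegion n i j →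
      roundDown (c u) (Fup (toR2 u)) + roundUp (c u) (Flo (toR2 u)) = u.1 - w.1 := by
    intro u hu humem
    have h := heq (toR2 w) hwmem (toR2 u) humem (by simp only [toR2]; exact_mod_cast hwn)
      (by simp only [toR2]; exact_mod_cast hu)
    rw [hwu, hwl] at h
    have hcu : c u = 2 * (u.1 - w.1) := by simp only [c]; omega
    rw [hcu]
    refine roundDown_add_roundUp _ ?_
    simp only [toR2] at h ⊢
    push_cast
    linarith
  refine ⟨fun u => roundDown (c u) (Fup (toR2 u)), fun u => roundUp (c u) (Flo (toR2 u)),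
    ⟨?_, ?_, ?_, ?_, ?_, ?_⟩, ?_, ?_⟩
  · intro u v huv
    obtain ⟨h1, h2⟩ := step_bounds (convex_Zup n i j) (interior_Zup_nonempty hi hi' hj hj')
      hKu hgu huv
    exact roundDown_step (hc huv.1) h1 h2
  · intro u v huv
    obtain ⟨h1, h2⟩ := step_bounds (convex_Zlo n i j) (interior_Zlo_nonempty hi hi' hj hj')
      hKl hgl huv
    exact roundUp_step (hc huv.1) h1 h2
  · intro u v huv hseg
    obtain ⟨hup, hlo⟩ := hbd u v huv hseg
    refine ⟨fun hu hv => ?_, fun hu hv => ?_⟩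
    · simp only [hup hu hv]
      exact roundDown_succ (hc huv) _
    · simp only [hlo hu hv]
      exact roundUp_succ (hc huv) _
  · intro u hu humem hvmem
    simp only
    rw [hsum u hu humem, hsum _ (by simp; omega) hvmem]
    simp
    ring
  · simp [c, ← hw, hwu, roundDown]
  · simp [c, ← hw, hwl, roundUp]
  · intro u _
    have h1 := roundDown_le (c u) (Fup (toR2 u))
    have h2 := lt_roundDown_add (c u) (Fup (toR2 u))
    rw [abs_lt]
    constructor <;> linarith
  · intro u _
    have h1 := roundDown_le (-c u) (-Flo (toR2 u))
    have h2 := lt_roundDown_add (-c u) (-Flo (toR2 u))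
    simp only [roundUp_eq_neg_roundDown, Int.cast_neg, abs_lt]
    constructor <;> linarith
end
end
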